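/- Let F₀ : ℝ → ℝ be bounded and uniformly continuous. Then: (i) there exists a unique function F which belongs to BUC([0,T] × ℝ) for every T > 0, is a viscosity solution of ∂ₜF + (∂ₓF)₊ H̃[F] = 0 on (0,∞) × ℝ, and satisfies F(0,·) = F₀; (ii) if moreover F₀ is Lipschitz continuous with constant K, then for every t ≥ 0 the function F(t,·) is Lipschitz continuous with constant K. -/

import Mathlib

open Filter Set MeasureTheory Topology

/-- The principal value `H̃[φ](x) = pv ∫ (φ(x) - φ(y))/(x-y)² dy` converges to `L`. -/
def HTildeTendsto (φ : ℝ → ℝ) (x L : ℝ) : Prop :=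
  Tendsto (fun ε : ℝ => ∫ y in {y : ℝ | ε ≤ |x - y|}, (φ x - φ y) / (x - y) ^ 2)
    (𝓝[>] 0) (𝓝 L)

/-- The value of the principal value `H̃[φ](x)` (junk value if the limit does not exist). -/
noncomputable def HTilde (φ : ℝ → ℝ) (x : ℝ) : ℝ :=
  limUnder (𝓝[>] (0 : ℝ))
    (fun ε : ℝ => ∫ y in {y : ℝ | ε ≤ |x - y|}, (φ x - φ y) / (x - y) ^ 2)

/-- Test functions: continuously differentiable in time and, for each time, bounded in
space, twice differentiable in space with bounded second spatial derivative. -/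
def TestFun (φ : ℝ → ℝ → ℝ) : Prop :=
  (∀ x, ContDiff ℝ 1 fun t => φ t x) ∧
  ∀ t : ℝ,
    (∃ M, ∀ x, |φ t x| ≤ M) ∧
    (∀ x, DifferentiableAt ℝ (φ t) x) ∧
    (∀ x, DifferentiableAt ℝ (deriv (φ t)) x) ∧
    (∃ M, ∀ x, |deriv (deriv (φ t)) x| ≤ M)

/-- Viscosity subsolution of `∂ₜF + (∂ₓF)₊ Op[F] = 0` on `(0,∞) × ℝ`. -/
def IsSubsolution (Op : (ℝ → ℝ) → ℝ → ℝ) (F : ℝ → ℝ → ℝ) : Prop :=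
  UpperSemicontinuousOn (fun p : ℝ × ℝ => F p.1 p.2) (Set.Ici 0 ×ˢ Set.univ) ∧
  ∀ φ : ℝ → ℝ → ℝ, TestFun φ → ∀ t₀ x₀ : ℝ, 0 < t₀ →
    (∀ t x : ℝ, 0 ≤ t → (t, x) ≠ (t₀, x₀) → F t x - φ t x < F t₀ x₀ - φ t₀ x₀) →
    deriv (fun t => φ t x₀) t₀ + max (deriv (φ t₀) x₀) 0 * Op (φ t₀) x₀ ≤ 0

/-- Viscosity supersolution of `∂ₜF + (∂ₓF)₊ Op[F] = 0` on `(0,∞) × ℝ`. -/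
def IsSupersolution (Op : (ℝ → ℝ) → ℝ → ℝ) (F : ℝ → ℝ → ℝ) : Prop :=
  LowerSemicontinuousOn (fun p : ℝ × ℝ => F p.1 p.2) (Set.Ici 0 ×ˢ Set.univ) ∧
  ∀ φ : ℝ → ℝ → ℝ, TestFun φ → ∀ t₀ x₀ : ℝ, 0 < t₀ →
    (∀ t x : ℝ, 0 ≤ t → (t, x) ≠ (t₀, x₀) → F t₀ x₀ - φ t₀ x₀ < F t x - φ t x) →
    0 ≤ deriv (fun t => φ t x₀) t₀ + max (deriv (φ t₀) x₀) 0 * Op (φ t₀) x₀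

/-- Lower semicontinuous envelope `F₋(t,x) = liminf_{0 ≤ s → t, y → x} F(s,y)`. -/
noncomputable def lscEnv (F : ℝ → ℝ → ℝ) (t x : ℝ) : ℝ :=
  liminf (fun p : ℝ × ℝ => F p.1 p.2) (𝓝[Set.Ici 0 ×ˢ Set.univ] (t, x))

/-- Viscosity solution: an usc subsolution whose lsc envelope is a supersolution. -/
def IsSolution (Op : (ℝ → ℝ) → ℝ → ℝ) (F : ℝ → ℝ → ℝ) : Prop :=
  IsSubsolution Op F ∧ IsSupersolution Op (fun t x => lscEnv F t x)

/-- Bounded and uniformly continuous on a set. -/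
def BUCOn (f : ℝ × ℝ → ℝ) (s : Set (ℝ × ℝ)) : Prop :=
  (∃ M, ∀ p ∈ s, |f p| ≤ M) ∧ UniformContinuousOn f s

/-- The weighted tail integral `∫_{z > r} k z / z²`. -/
noncomputable def tailInt (r : ℝ) (k : ℝ → ℝ) : ℝ := ∫ z in Ioi r, k z / z ^ 2

/-- The operator `H̃` with the singularity cut off at distance `r`. -/
noncomputable def cutOp (r : ℝ) (f : ℝ → ℝ) (x : ℝ) : ℝ :=
  tailInt r fun z => 2 * f x - f (x + z) - f (x - z)

theorem integrableOn_inv_sq {r : ℝ} (hr : 0 < r) (c : ℝ) :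
    IntegrableOn (fun z : ℝ => c / z ^ 2) (Ioi r) := by
  have h := (integrableOn_Ioi_rpow_of_lt (a := -2) (by norm_num) hr).const_mul c
  refine IntegrableOn.congr_fun h (fun z hz => ?_) measurableSet_Ioi
  have hz0 : 0 < z := hr.trans hz
  rw [Real.rpow_neg hz0.le, div_eq_mul_inv]
  norm_num

theorem tailInt_const {r : ℝ} (hr : 0 < r) (c : ℝ) : tailInt r (fun _ => c) = c / r := by
  have h := integral_Ioi_rpow_of_lt (a := -2) (by norm_num) hr
  have h2 : tailInt r (fun _ => c) = ∫ z in Ioi r, c * z ^ (-2 : ℝ) := by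
    refine setIntegral_congr_fun measurableSet_Ioi (fun z hz => ?_)
    have hz0 : 0 < z := hr.trans hz
    simp only
    rw [Real.rpow_neg hz0.le, div_eq_mul_inv]
    norm_num
  rw [h2, integral_const_mul, h]
  norm_num
  rw [Real.rpow_neg hr.le, Real.rpow_one]
  field_simp

theorem integrableOn_tail {r M : ℝ} (hr : 0 < r) {k : ℝ → ℝ} (hk : Continuous k)
    (hM : ∀ z, |k z| ≤ M) : IntegrableOn (fun z => k z / z ^ 2) (Ioi r) := by
  refine Integrable.mono' (integrableOn_inv_sq hr M) ?_ ?_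
  · exact (hk.measurable.div (measurable_id.pow_const 2)).aestronglyMeasurable
  · refine (ae_restrict_iff' measurableSet_Ioi).2 (Eventually.of_forall fun z hz => ?_)
    have hz0 : 0 < z := hr.trans hz
    rw [Real.norm_eq_abs, abs_div, abs_of_pos (by positivity : 0 < z ^ 2)]
    gcongr
    exact hM z

theorem integrableOn_mid {r R : ℝ} (hr : 0 < r) {k : ℝ → ℝ} (hk : Continuous k) :
    IntegrableOn (fun z => k z / z ^ 2) (Ioc r R) := by
  refine (ContinuousOn.integrableOn_Icc (a := r) (b := R) ?_).mono_set Ioc_subset_Icc_self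
  exact hk.continuousOn.div (by fun_prop) fun z hz => by
    have : 0 < z := hr.trans_le hz.1
    positivity

theorem tailInt_split {r R M : ℝ} (hr : 0 < r) (hR : r ≤ R) {k : ℝ → ℝ} (hk : Continuous k)
    (hM : ∀ z, |k z| ≤ M) :
    tailInt r k = (∫ z in Ioc r R, k z / z ^ 2) + tailInt R k := by
  unfold tailInt
  rw [← setIntegral_union (Ioc_disjoint_Ioi le_rfl) measurableSet_Ioi
    (integrableOn_mid hr hk) (integrableOn_tail (hr.trans_le hR) hk hM), Ioc_union_Ioi_eq_Ioi hR]

theorem tailInt_mono {r M M' : ℝ} (hr : 0 < r) {k k' : ℝ → ℝ} (hk : Continuous k)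
    (hM : ∀ z, |k z| ≤ M) (hk' : Continuous k') (hM' : ∀ z, |k' z| ≤ M')
    (h : ∀ z, r < z → k z ≤ k' z) : tailInt r k ≤ tailInt r k' := by
  refine setIntegral_mono_on (integrableOn_tail hr hk hM) (integrableOn_tail hr hk' hM')
    measurableSet_Ioi fun z hz => ?_
  gcongr
  exact h z hz

theorem tailInt_mul (r c : ℝ) (k : ℝ → ℝ) :
    tailInt r (fun z => c * k z) = c * tailInt r k := by
  unfold tailInt
  rw [← integral_const_mul]
  simp only [mul_div_assoc]

theorem tailInt_sub {r M M' : ℝ} (hr : 0 < r) {k k' : ℝ → ℝ} (hk : Continuous k)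
    (hM : ∀ z, |k z| ≤ M) (hk' : Continuous k') (hM' : ∀ z, |k' z| ≤ M') :
    tailInt r (fun z => k z - k' z) = tailInt r k - tailInt r k' := by
  unfold tailInt
  rw [← integral_sub (integrableOn_tail hr hk hM) (integrableOn_tail hr hk' hM')]
  simp only [sub_div]

theorem le_tailInt {r M c : ℝ} (hr : 0 < r) {k : ℝ → ℝ} (hk : Continuous k)
    (hM : ∀ z, |k z| ≤ M) (h : ∀ z, r < z → c ≤ k z) : c / r ≤ tailInt r k := by
  rw [← tailInt_const hr c]
  exact tailInt_mono hr continuous_const (M := |c|) (fun _ => le_rfl) hk hM h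

theorem tailInt_le {r M c : ℝ} (hr : 0 < r) {k : ℝ → ℝ} (hk : Continuous k)
    (hM : ∀ z, |k z| ≤ M) (h : ∀ z, r < z → k z ≤ c) : tailInt r k ≤ c / r := by
  rw [← tailInt_const hr c]
  exact tailInt_mono hr hk hM continuous_const (M' := |c|) (fun _ => le_rfl) h

theorem tailInt_comp_mul {r μ : ℝ} (hμ : 0 < μ) (k : ℝ → ℝ) :
    tailInt r (fun z => k (μ * z)) = μ * tailInt (μ * r) k := by
  unfold tailInt
  have h := integral_comp_mul_left_Ioi (fun w => k w / w ^ 2) r hμ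
  have h2 : ∀ z, k (μ * z) / z ^ 2 = μ ^ 2 * (k (μ * z) / (μ * z) ^ 2) := by
    intro z
    rcases eq_or_ne z 0 with rfl | hz
    · simp
    · field_simp
  simp only [h2]
  rw [integral_const_mul, h, smul_eq_mul]
  field_simp

/-- Lower bound on the part of the integral over `(r, R]`. -/
theorem le_integral_mid {r R b c : ℝ} (hr : 0 < r) (hR : r ≤ R) {k : ℝ → ℝ} (hk : Continuous k)
    (hc : 0 ≤ c) (h : ∀ z, r < z → z ≤ R → - b - c * z ^ 2 ≤ k z) (hb : 0 ≤ b) :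
    - (b / r) - c * R ≤ ∫ z in Ioc r R, k z / z ^ 2 := by
  have hint : IntegrableOn (fun z : ℝ => (-b) / z ^ 2 + (-c)) (Ioc r R) :=
    ((integrableOn_inv_sq hr (-b)).mono_set Ioc_subset_Ioi_self).add (by simp)
  have h1 : ∫ z in Ioc r R, ((-b) / z ^ 2 + (-c)) ≤ ∫ z in Ioc r R, k z / z ^ 2 := by
    refine setIntegral_mono_on hint (integrableOn_mid hr hk) measurableSet_Ioc fun z hz => ?_
    have hz0 : 0 < z := hr.trans hz.1
    have := h z hz.1 hz.2
    rw [le_div_iff₀ (by positivity)]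
    have : ((-b) / z ^ 2 + (-c)) * z ^ 2 = -b - c * z ^ 2 := by field_simp; ring
    linarith
  have h2 : ∫ z in Ioc r R, ((-b) / z ^ 2 + (-c))
      = (∫ z in Ioc r R, (-b) / z ^ 2) + ∫ z in Ioc r R, (-c) :=
    integral_add ((integrableOn_inv_sq hr (-b)).mono_set Ioc_subset_Ioi_self) (by simp)
  have h3 : -(b / r) ≤ ∫ z in Ioc r R, (-b) / z ^ 2 := by
    have e := tailInt_split hr hR (k := fun _ => -b) continuous_const (M := |(-b)|)
      (fun _ => le_rfl)
    rw [tailInt_const hr, tailInt_const (hr.trans_le hR)] at e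
    have : 0 ≤ b / R := div_nonneg hb (hr.trans_le hR).le
    have e2 : -b / R = -(b / R) := neg_div _ _
    have e3 : -b / r = -(b / r) := neg_div _ _
    linarith
  have h4 : ∫ z in Ioc r R, (-c) = -c * (R - r) := by
    simp [hR]; ring
  nlinarith [mul_nonneg hc hr.le]

theorem abs_second_diff_le {M : ℝ} {f : ℝ → ℝ} (hM : ∀ x, |f x| ≤ M) (x z : ℝ) :
    |2 * f x - f (x + z) - f (x - z)| ≤ 4 * M := by
  have h1 := abs_le.1 (hM x)
  have h2 := abs_le.1 (hM (x + z))
  have h3 := abs_le.1 (hM (x - z))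
  rw [abs_le]; constructor <;> linarith [h1.1, h1.2, h2.1, h2.2, h3.1, h3.2]

theorem continuous_second_diff {f : ℝ → ℝ} (hf : Continuous f) (x : ℝ) :
    Continuous fun z => 2 * f x - f (x + z) - f (x - z) := by fun_prop

theorem abs_cutOp_le {r M : ℝ} (hr : 0 < r) {f : ℝ → ℝ} (hf : Continuous f)
    (hM : ∀ x, |f x| ≤ M) (x : ℝ) : |cutOp r f x| ≤ 4 * M / r := by
  rw [abs_le, ← neg_div]
  exact ⟨le_tailInt hr (continuous_second_diff hf x) (abs_second_diff_le hM x)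
      fun z _ => (abs_le.1 (abs_second_diff_le hM x z)).1,
    tailInt_le hr (continuous_second_diff hf x) (abs_second_diff_le hM x)
      fun z _ => (abs_le.1 (abs_second_diff_le hM x z)).2⟩

/-- Bounded, jointly uniformly continuous functions of time and space. -/
structure BddUC (M : ℝ) (F : ℝ → ℝ → ℝ) : Prop where
  bdd : ∀ t x, |F t x| ≤ M
  uc : UniformContinuous fun p : ℝ × ℝ => F p.1 p.2

theorem BddUC.continuous₂ {M : ℝ} {F : ℝ → ℝ → ℝ} (h : BddUC M F) :
    Continuous fun p : ℝ × ℝ => F p.1 p.2 := h.uc.continuous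

theorem BddUC.comp {M : ℝ} {F : ℝ → ℝ → ℝ} (h : BddUC M F) {X : Type*} [TopologicalSpace X]
    {u v : X → ℝ} (hu : Continuous u) (hv : Continuous v) :
    Continuous fun a => F (u a) (v a) := h.continuous₂.comp (hu.prodMk hv)

theorem BddUC.slice {M : ℝ} {F : ℝ → ℝ → ℝ} (h : BddUC M F) (t : ℝ) : Continuous (F t) :=
  h.comp continuous_const continuous_id

theorem BddUC.nonneg {M : ℝ} {F : ℝ → ℝ → ℝ} (h : BddUC M F) : 0 ≤ M :=
  (abs_nonneg _).trans (h.bdd 0 0)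

theorem BddUC.modulus {M : ℝ} {F : ℝ → ℝ → ℝ} (h : BddUC M F) {e : ℝ} (he : 0 < e) :
    ∃ d > 0, ∀ t s x y, |t - s| ≤ d → |x - y| ≤ d → |F t x - F s y| ≤ e := by
  obtain ⟨d, hd, H⟩ := Metric.uniformContinuous_iff.1 h.uc e he
  refine ⟨d / 2, half_pos hd, fun t s x y h1 h2 => ?_⟩
  have := H (a := (t, x)) (b := (s, y)) (by
    rw [Prod.dist_eq, Real.dist_eq, Real.dist_eq]
    exact max_lt (by simp only; linarith) (by simp only; linarith))
  rw [Real.dist_eq] at this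
  exact this.le

theorem BddUC.continuous_cutOp {M : ℝ} {F : ℝ → ℝ → ℝ} (h : BddUC M F) {r : ℝ} (hr : 0 < r) :
    Continuous fun p : ℝ × ℝ => cutOp r (F p.1) p.2 := by
  unfold cutOp tailInt
  refine continuous_of_dominated (bound := fun z => 4 * M / z ^ 2) ?_ ?_
    (integrableOn_inv_sq hr _) ?_
  · intro p
    exact ((continuous_second_diff (h.slice p.1) p.2).measurable.div
      (measurable_id.pow_const 2)).aestronglyMeasurable
  · intro p
    refine Eventually.of_forall fun z => ?_
    rw [Real.norm_eq_abs, abs_div, abs_of_nonneg (by positivity : 0 ≤ z ^ 2)]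
    gcongr
    exact abs_second_diff_le (h.bdd p.1) p.2 z
  · refine Eventually.of_forall fun z => ?_
    have h1 := h.continuous₂
    have h2 := h.comp (X := ℝ × ℝ) (u := fun p => p.1) (v := fun p => p.2 + z)
      (by fun_prop) (by fun_prop)
    have h3 := h.comp (X := ℝ × ℝ) (u := fun p => p.1) (v := fun p => p.2 - z)
      (by fun_prop) (by fun_prop)
    fun_prop

/-- The reflection exchanging subsolutions and supersolutions. -/
def dual (F : ℝ → ℝ → ℝ) : ℝ → ℝ → ℝ := fun t x => -F t (-x)

theorem dual_dual (F : ℝ → ℝ → ℝ) : dual (dual F) = F := by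
  funext t x; simp [dual]

theorem BddUC.dual {M : ℝ} {F : ℝ → ℝ → ℝ} (h : BddUC M F) : BddUC M (dual F) := by
  refine ⟨fun t x => by simpa [_root_.dual] using h.bdd t (-x), ?_⟩
  exact (h.uc.comp (uniformContinuous_fst.prodMk uniformContinuous_snd.neg)).neg

theorem cutOp_dual (F : ℝ → ℝ → ℝ) (r t x : ℝ) :
    cutOp r (dual F t) x = -cutOp r (F t) (-x) := by
  have := tailInt_mul r (-1) (fun z => 2 * F t (-x) - F t (-x + z) - F t (-x - z))
  unfold cutOp
  rw [neg_one_mul] at this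
  rw [← this]
  congr 1
  funext z
  simp only [dual]
  rw [show -(x + z) = -x - z by ring, show -(x - z) = -x + z by ring]
  ring

/-- Subsolution property up to time `T`, tested by parabolas touching from above in the past. -/
def PastSub (T : ℝ) (F : ℝ → ℝ → ℝ) : Prop :=
  ∀ t₀ x₀ a p C τ r ρ : ℝ, 0 < t₀ → t₀ ≤ T → 0 < τ → τ ≤ t₀ → 0 ≤ C → 0 < ρ → ρ < r →
    (∀ t y, t₀ - τ ≤ t → t ≤ t₀ → |y| ≤ r →
      F t (x₀ + y) ≤ F t₀ x₀ + a * (t - t₀) + p * y + C * y ^ 2) →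
    a + max p 0 * (cutOp ρ (F t₀) x₀ - 2 * C * ρ) ≤ 0

theorem PastSub.mono {T T' : ℝ} {F : ℝ → ℝ → ℝ} (h : PastSub T F) (hT : T' ≤ T) :
    PastSub T' F := fun t₀ x₀ a p C τ r ρ h1 h2 =>
  h t₀ x₀ a p C τ r ρ h1 (h2.trans hT)

theorem PastSub.super {T : ℝ} {F : ℝ → ℝ → ℝ} (h : PastSub T (dual F))
    {t₀ x₀ a p C τ r ρ : ℝ} (ht : 0 < t₀) (htT : t₀ ≤ T) (hτ : 0 < τ) (hτt : τ ≤ t₀) (hC : 0 ≤ C)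
    (hρ : 0 < ρ) (hr : ρ < r)
    (H : ∀ t y, t₀ - τ ≤ t → t ≤ t₀ → |y| ≤ r →
      F t₀ x₀ + a * (t - t₀) + p * y - C * y ^ 2 ≤ F t (x₀ + y)) :
    0 ≤ a + max p 0 * (cutOp ρ (F t₀) x₀ + 2 * C * ρ) := by
  have := h t₀ (-x₀) (-a) p C τ r ρ ht htT hτ hτt hC hρ hr (fun t y h1 h2 h3 => by
    have := H t (-y) h1 h2 (by rwa [abs_neg])
    simp only [dual, neg_neg]
    rw [show -(-x₀ + y) = x₀ + -y by ring]
    nlinarith)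
  rw [cutOp_dual, neg_neg] at this
  nlinarith

theorem PastSub.scale {T : ℝ} {F : ℝ → ℝ → ℝ} (h : PastSub T F) {l m : ℝ} (hl : 0 < l)
    (hm : 0 < m) (x₁ c : ℝ) {f : ℝ} (hf : f = l * m ^ 2) :
    PastSub (T / f) (fun s y => l * F (f * s) (x₁ + m * y) + c) := by
  intro t₀ x₀ a p C τ r ρ ht htT hτ hτt hC hρ hr H
  have hf0 : 0 < f := by rw [hf]; positivity
  have key := h (f * t₀) (x₁ + m * x₀) (a / (l * f)) (p / (l * m)) (C / (l * m ^ 2)) (f * τ)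
    (m * r) (m * ρ) (by positivity) (by rw [le_div_iff₀ hf0] at htT; linarith) (by positivity)
    (by gcongr) (by positivity) (by positivity) (by gcongr) (fun t y h1 h2 h3 => by
      have := H (t / f) (y / m) (by rw [le_div_iff₀ hf0]; linarith)
        (by rw [div_le_iff₀ hf0]; linarith)
        (by rw [abs_div, abs_of_pos hm, div_le_iff₀ hm]; linarith)
      simp only at this
      rw [mul_div_cancel₀ _ hf0.ne', show x₁ + m * (x₀ + y / m) = x₁ + m * x₀ + y by
        field_simp; ring] at this
      refine le_of_mul_le_mul_left ?_ hl
      have e : l * (F (f * t₀) (x₁ + m * x₀) + a / (l * f) * (t - f * t₀) + p / (l * m) * y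
          + C / (l * m ^ 2) * y ^ 2) = l * F (f * t₀) (x₁ + m * x₀) + a * (t / f - t₀)
          + p * (y / m) + C * (y / m) ^ 2 := by field_simp
      rw [e]
      linarith)
  have e1 : max (p / (l * m)) 0 = max p 0 / (l * m) := by
    rw [← max_div_div_right (by positivity), zero_div]
  have e2 : cutOp ρ (fun y => l * F (f * t₀) (x₁ + m * y) + c) x₀
      = l * m * cutOp (m * ρ) (F (f * t₀)) (x₁ + m * x₀) := by
    unfold cutOp
    rw [mul_assoc, ← tailInt_comp_mul hm, ← tailInt_mul]
    congr 1
    funext z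
    simp only
    rw [show x₁ + m * (x₀ + z) = x₁ + m * x₀ + m * z by ring,
      show x₁ + m * (x₀ - z) = x₁ + m * x₀ - m * z by ring]
    ring
  rw [e1] at key
  rw [e2]
  have key2 := mul_le_mul_of_nonneg_left key (by positivity : 0 ≤ l * f)
  rw [mul_zero] at key2
  refine le_of_eq_of_le ?_ key2
  rw [hf]
  field_simp

theorem BddUC.scale {M : ℝ} {F : ℝ → ℝ → ℝ} (h : BddUC M F) {l : ℝ} (hl : 0 ≤ l)
    (m x₁ c f : ℝ) : BddUC (l * M + |c|) (fun s y => l * F (f * s) (x₁ + m * y) + c) := by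
  refine ⟨fun t x => (abs_add_le _ _).trans ?_, ?_⟩
  · rw [abs_mul, abs_of_nonneg hl]
    gcongr
    exact h.bdd _ _
  · have h1 : UniformContinuous fun p : ℝ × ℝ => (f * p.1, x₁ + m * p.2) :=
      (uniformContinuous_fst.const_mul' f).prodMk
        (uniformContinuous_const.add (uniformContinuous_snd.const_mul' m))
    exact ((h.uc.comp h1).const_mul' l).add uniformContinuous_const

theorem nonpos_of_approx {X : Type*} [PseudoMetricSpace X] {Ψ : X → ℝ} {x₀ : X}
    (hc : ContinuousAt Ψ x₀) (h : ∀ ε > 0, ∃ x, dist x x₀ < ε ∧ Ψ x ≤ 0) : Ψ x₀ ≤ 0 := by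
  by_contra! hpos
  obtain ⟨ε, hε, H⟩ := Metric.eventually_nhds_iff.1 (hc.eventually (lt_mem_nhds hpos))
  obtain ⟨x, hx, hx2⟩ := h ε hε
  exact (H hx).not_ge hx2

/-- A quadratic error in time is harmless. -/
theorem PastSub.quad {T : ℝ} {F : ℝ → ℝ → ℝ} (h : PastSub T F) {t₀ x₀ a p C A τ r ρ : ℝ}
    (ht : 0 < t₀) (htT : t₀ ≤ T) (hτ : 0 < τ) (hτt : τ ≤ t₀) (hC : 0 ≤ C) (hA : 0 ≤ A)
    (hρ : 0 < ρ) (hr : ρ < r)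
    (H : ∀ t y, t₀ - τ ≤ t → t ≤ t₀ → |y| ≤ r →
      F t (x₀ + y) ≤ F t₀ x₀ + a * (t - t₀) + p * y + C * y ^ 2 + A * (t - t₀) ^ 2) :
    a + max p 0 * (cutOp ρ (F t₀) x₀ - 2 * C * ρ) ≤ 0 := by
  refine le_of_forall_pos_le_add fun e he => ?_
  have key := h t₀ x₀ (a - e) p C (min τ (e / (A + 1))) r ρ ht htT (lt_min hτ (by positivity))
    ((min_le_left _ _).trans hτt) hC hρ hr (fun t y h1 h2 h3 => by
      have h4 := H t y (by linarith [min_le_left τ (e / (A + 1))]) h2 h3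
      have h5 : t₀ - t ≤ e / (A + 1) := by linarith [min_le_right τ (e / (A + 1))]
      rw [le_div_iff₀ (by positivity)] at h5
      have h6 : 0 ≤ t₀ - t := by linarith
      nlinarith [mul_le_mul_of_nonneg_left h5 h6])
  linarith

set_option maxHeartbeats 1000000 in
theorem PastSub.two_point_max {T M M' : ℝ} {F G : ℝ → ℝ → ℝ} (hF : PastSub T F)
    (hG : PastSub T (dual G)) (bF : BddUC M F) (bG : BddUC M' G)
    {t₀ y₀ x₀ a p q C τ r ρ : ℝ} (htT : t₀ ≤ T) (hτ : 0 < τ) (hτt : τ ≤ t₀) (hC : 0 ≤ C)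
    (hρ : 0 < ρ) (hr : ρ < r)
    (H : ∀ t y x, t₀ - τ ≤ t → t ≤ t₀ → |y| ≤ r → |x| ≤ r →
      F t (y₀ + y) - G t (x₀ + x) ≤
        F t₀ y₀ - G t₀ x₀ + a * (t - t₀) + p * y - q * x + C * (y ^ 2 + x ^ 2))
    {ε : ℝ} (hε : 0 < ε) :
    ∃ t s y x z, |t - t₀| < ε ∧ |s - t₀| < ε ∧ |y| < ε ∧ |x| < ε ∧ |z| < ε ∧
      a - z + max (p + 2 * (C + z) * y) 0 * (cutOp ρ (F t) (y₀ + y) - 2 * (C + z) * ρ)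
        - max (q - 2 * (C + z) * x) 0 * (cutOp ρ (G s) (x₀ + x) + 2 * (C + z) * ρ) ≤ 0 := by
  set z := ε / 2 with hz
  have hz0 : 0 < z := by positivity
  -- radius within which the maximiser must lie
  set ω := min (min (ε / 2) (τ / 2)) ((r - ρ) / 2) with hω
  have hω0 : 0 < ω := by
    refine lt_min (lt_min (by positivity) (by positivity)) (by linarith)
  have hωε : ω ≤ ε / 2 := (min_le_left _ _).trans (min_le_left _ _)
  have hωτ : ω ≤ τ / 2 := (min_le_left _ _).trans (min_le_right _ _)
  have hωr : ω ≤ (r - ρ) / 2 := min_le_right _ _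
  set e := min (z * (ω / 4)) (z * (ω / 4) ^ 2) with he
  have he0 : 0 < e := lt_min (by positivity) (by positivity)
  obtain ⟨d, hd, hmod⟩ := bG.modulus he0
  set d' := min d (ω / 4) with hd'
  have hd'0 : 0 < d' := lt_min hd (by positivity)
  -- total oscillation bound
  set B := 2 * (M + M') + (|a| + z) * τ + (|p| + |q|) * r + 1 with hB
  have hMM : 0 ≤ M + M' := add_nonneg bF.nonneg bG.nonneg
  have hr0 : 0 < r := hρ.trans hr
  have hB0 : 0 < B := by positivity
  set κ := d' ^ 2 / B with hκ
  have hκ0 : 0 < κ := by positivity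
  let Φ : ℝ × ℝ × ℝ × ℝ → ℝ := fun w => F w.1 (y₀ + w.2.2.1) - G w.2.1 (x₀ + w.2.2.2)
    - (a - z) * (w.1 - t₀) - p * w.2.2.1 + q * w.2.2.2 - (C + z) * (w.2.2.1 ^ 2 + w.2.2.2 ^ 2)
    - (w.1 - w.2.1) ^ 2 / κ
  have hΦ : Continuous Φ := by
    have h1 := bF.comp (X := ℝ × ℝ × ℝ × ℝ) (u := fun w => w.1) (v := fun w => y₀ + w.2.2.1)
      (by fun_prop) (by fun_prop)
    have h2 := bG.comp (X := ℝ × ℝ × ℝ × ℝ) (u := fun w => w.2.1) (v := fun w => x₀ + w.2.2.2)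
      (by fun_prop) (by fun_prop)
    have h3 : Continuous fun w : ℝ × ℝ × ℝ × ℝ => - (a - z) * (w.1 - t₀) - p * w.2.2.1
        + q * w.2.2.2 - (C + z) * (w.2.2.1 ^ 2 + w.2.2.2 ^ 2) - κ⁻¹ * (w.1 - w.2.1) ^ 2 := by
      fun_prop
    exact ((h1.sub h2).add h3).congr fun w => by simp only [Φ, Pi.add_apply, Pi.sub_apply]; ring
  obtain ⟨⟨t, s, y, x⟩, hmem, hmax⟩ := (isCompact_Icc.prod (isCompact_Icc.prod
    (isCompact_Icc.prod isCompact_Icc))).exists_isMaxOn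
    (s := Icc (t₀ - τ) t₀ ×ˢ Icc (t₀ - τ) t₀ ×ˢ Icc (-r) r ×ˢ Icc (-r) r)
    ⟨(t₀, t₀, 0, 0), by simp [hτ.le, hr0.le]⟩ hΦ.continuousOn
  simp only [mem_prod, mem_Icc] at hmem
  obtain ⟨⟨ht1, ht2⟩, ⟨hs1, hs2⟩, ⟨hy1, hy2⟩, ⟨hx1, hx2⟩⟩ := hmem
  have hM : ∀ t' s' y' x', t₀ - τ ≤ t' → t' ≤ t₀ → t₀ - τ ≤ s' → s' ≤ t₀ → |y'| ≤ r → |x'| ≤ r →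
      Φ (t', s', y', x') ≤ Φ (t, s, y, x) := fun t' s' y' x' h1 h2 h3 h4 h5 h6 =>
    hmax (by simp only [mem_prod, mem_Icc]; exact ⟨⟨h1, h2⟩, ⟨h3, h4⟩, abs_le.1 h5, abs_le.1 h6⟩)
  have h0 := hM t₀ t₀ 0 0 (by linarith) le_rfl (by linarith) le_rfl (by simpa using hr0.le)
    (by simpa using hr0.le)
  simp only [Φ] at h0
  simp only [add_zero, sub_self, mul_zero, sub_zero, ne_eq, OfNat.ofNat_ne_zero,
    not_false_eq_true, zero_pow, zero_div] at h0
  have hay : |y| ≤ r := abs_le.2 ⟨hy1, hy2⟩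
  have hax : |x| ≤ r := abs_le.2 ⟨hx1, hx2⟩
  have hCsq : 0 ≤ (C + z) * (y ^ 2 + x ^ 2) := by positivity
  have hts : |t - s| ≤ d' := by
    have b1 := abs_le.1 (bF.bdd t (y₀ + y))
    have b2 := abs_le.1 (bG.bdd s (x₀ + x))
    have b3 := abs_le.1 (bF.bdd t₀ y₀)
    have b4 := abs_le.1 (bG.bdd t₀ x₀)
    have c1 : -((a - z) * (t - t₀)) ≤ (|a| + z) * τ := by
      have : (a - z) * (t₀ - t) ≤ (|a| + z) * τ :=
        mul_le_mul (by linarith [le_abs_self a]) (by linarith) (by linarith)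
          (by positivity)
      linarith
    have c2 : -(p * y) ≤ |p| * r := by
      calc -(p * y) ≤ |p * y| := neg_le_abs _
        _ = |p| * |y| := abs_mul _ _
        _ ≤ |p| * r := by gcongr
    have c3 : q * x ≤ |q| * r := by
      calc q * x ≤ |q * x| := le_abs_self _
        _ = |q| * |x| := abs_mul _ _
        _ ≤ |q| * r := by gcongr
    have : (t - s) ^ 2 / κ ≤ B := by rw [hB]; linarith [b1.1, b1.2, b2.1, b2.2, b3.1, b3.2, b4.1, b4.2]
    rw [div_le_iff₀ hκ0, hκ, mul_div_cancel₀ _ hB0.ne'] at this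
    exact abs_le_of_sq_le_sq this hd'0.le
  have hGd := hmod t s (x₀ + x) (x₀ + x) (hts.trans (min_le_left _ _)) (by simpa using hd.le)
  have hH := H t y x ht1 ht2 hay hax
  have hloc : z * (t₀ - t) + z * (y ^ 2 + x ^ 2) ≤ e := by
    have := (abs_le.1 hGd).2
    have : 0 ≤ (t - s) ^ 2 / κ := by positivity
    linarith [(abs_le.1 hGd).1]
  have htω : t₀ - t ≤ ω / 4 := by
    refine le_of_mul_le_mul_left ?_ hz0
    have : e ≤ z * (ω / 4) := min_le_left _ _
    have : 0 ≤ z * (y ^ 2 + x ^ 2) := by positivity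
    linarith
  have hyω : |y| ≤ ω / 4 := by
    refine abs_le_of_sq_le_sq ?_ (by positivity)
    refine le_of_mul_le_mul_left ?_ hz0
    have : e ≤ z * (ω / 4) ^ 2 := min_le_right _ _
    nlinarith [mul_nonneg hz0.le (sq_nonneg x), mul_nonneg hz0.le (sub_nonneg.2 ht2)]
  have hxω : |x| ≤ ω / 4 := by
    refine abs_le_of_sq_le_sq ?_ (by positivity)
    refine le_of_mul_le_mul_left ?_ hz0
    have : e ≤ z * (ω / 4) ^ 2 := min_le_right _ _
    nlinarith [mul_nonneg hz0.le (sq_nonneg y), mul_nonneg hz0.le (sub_nonneg.2 ht2)]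
  have hts' := abs_le.1 (hts.trans (min_le_right _ _))
  have hay' := abs_le.1 hyω
  have hax' := abs_le.1 hxω
  -- the inequality for `F`
  have hFz : a - z + 2 * (t - s) / κ
      + max (p + 2 * (C + z) * y) 0 * (cutOp ρ (F t) (y₀ + y) - 2 * (C + z) * ρ) ≤ 0 := by
    refine hF.quad (A := κ⁻¹) (τ := τ / 4) (r := r - |y|) (by linarith) (by linarith)
      (by positivity) (by linarith) (by positivity) (by positivity) hρ (by linarith)
      (fun t' w h1 h2 h3 => ?_)
    have := hM t' s (y + w) x (by linarith) (by linarith) hs1 hs2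
      ((abs_add_le _ _).trans (by linarith)) hax
    simp only [Φ, ← add_assoc y₀ y w, div_eq_mul_inv] at this ⊢
    clear hmax hM hH hmod h0
    linarith
  have hGz : -(2 * (t - s) / κ)
      + max (q - 2 * (C + z) * x) 0 * (-cutOp ρ (G s) (x₀ + x) - 2 * (C + z) * ρ) ≤ 0 := by
    have := hG.quad (t₀ := s) (x₀ := -(x₀ + x)) (a := -(2 * (t - s) / κ))
      (p := q - 2 * (C + z) * x) (C := C + z) (A := κ⁻¹) (τ := τ / 4) (r := r - |x|) (ρ := ρ)
      (by linarith) (by linarith) (by positivity) (by linarith) (by positivity) (by positivity)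
      hρ (by linarith) (fun s' w h1 h2 h3 => ?_)
    · rwa [cutOp_dual, neg_neg] at this
    have := hM t s' y (x - w) (by linarith) (by linarith) (by linarith) (by linarith) hay
      ((abs_sub _ _).trans (by linarith))
    simp only [Φ, dual, neg_neg, div_eq_mul_inv] at this ⊢
    rw [show -(-(x₀ + x) + w) = x₀ + (x - w) by ring]
    clear hmax hM hH hmod h0
    linarith
  refine ⟨t, s, y, x, z, ?_, ?_, ?_, ?_, ?_, ?_⟩
  · rw [abs_lt]; constructor <;> linarith
  · rw [abs_lt]; constructor <;> linarith
  · linarith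
  · linarith
  · rw [abs_of_pos hz0]; linarith
  · linarith

theorem PastSub.two_point {T M M' : ℝ} {F G : ℝ → ℝ → ℝ} (hF : PastSub T F)
    (hG : PastSub T (dual G)) (bF : BddUC M F) (bG : BddUC M' G)
    {t₀ y₀ x₀ a p q C τ r ρ : ℝ} (htT : t₀ ≤ T) (hτ : 0 < τ) (hτt : τ ≤ t₀) (hC : 0 ≤ C)
    (hρ : 0 < ρ) (hr : ρ < r)
    (H : ∀ t y x, t₀ - τ ≤ t → t ≤ t₀ → |y| ≤ r → |x| ≤ r →
      F t (y₀ + y) - G t (x₀ + x) ≤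
        F t₀ y₀ - G t₀ x₀ + a * (t - t₀) + p * y - q * x + C * (y ^ 2 + x ^ 2)) :
    a + max p 0 * (cutOp ρ (F t₀) y₀ - 2 * C * ρ)
      - max q 0 * (cutOp ρ (G t₀) x₀ + 2 * C * ρ) ≤ 0 := by
  let Ψ : ℝ × ℝ × ℝ × ℝ × ℝ → ℝ := fun w => a - w.2.2.2.2 +
    max (p + 2 * (C + w.2.2.2.2) * w.2.2.1) 0 *
      (cutOp ρ (F w.1) (y₀ + w.2.2.1) - 2 * (C + w.2.2.2.2) * ρ)
    - max (q - 2 * (C + w.2.2.2.2) * w.2.2.2.1) 0 *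
      (cutOp ρ (G w.2.1) (x₀ + w.2.2.2.1) + 2 * (C + w.2.2.2.2) * ρ)
  have hc : Continuous Ψ := by
    have h1 := (bF.continuous_cutOp hρ).comp (f := fun w : ℝ × ℝ × ℝ × ℝ × ℝ =>
      (w.1, y₀ + w.2.2.1)) (by fun_prop)
    have h2 := (bG.continuous_cutOp hρ).comp (f := fun w : ℝ × ℝ × ℝ × ℝ × ℝ =>
      (w.2.1, x₀ + w.2.2.2.1)) (by fun_prop)
    simp only [Function.comp_def] at h1 h2
    simp only [Ψ]
    fun_prop
  have := nonpos_of_approx (x₀ := (t₀, t₀, 0, 0, 0)) hc.continuousAt (fun ε hε => by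
    obtain ⟨t, s, y, x, z, h1, h2, h3, h4, h5, h6⟩ :=
      hF.two_point_max hG bF bG htT hτ hτt hC hρ hr H hε
    refine ⟨(t, s, y, x, z), ?_, h6⟩
    simp only [Prod.dist_eq, Real.dist_eq, sub_zero, sup_lt_iff]
    exact ⟨h1, h2, h3, h4, h5⟩)
  simpa [Ψ] using this

/-- Two-point test with a coupling between time and space and a quadratic error in time. -/
theorem PastSub.two_point_coupled {T M M' : ℝ} {F G : ℝ → ℝ → ℝ} (hF : PastSub T F)
    (hG : PastSub T (dual G)) (bF : BddUC M F) (bG : BddUC M' G)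
    {t₀ y₀ x₀ a p q C A τ r ρ : ℝ} (htT : t₀ ≤ T) (hτ : 0 < τ) (hτt : τ ≤ t₀) (hC : 0 ≤ C)
    (hA : 0 ≤ A) (hρ : 0 < ρ) (hr : ρ < r)
    (H : ∀ t y x, t₀ - τ ≤ t → t ≤ t₀ → |y| ≤ r → |x| ≤ r →
      F t (y₀ + y) - G t (x₀ + x) ≤
        F t₀ y₀ - G t₀ x₀ + a * (t - t₀) + p * y - q * x + C * (y ^ 2 + x ^ 2)
          + A * (t - t₀) ^ 2 + A * |t - t₀| * (|y| + |x|)) :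
    a + max p 0 * (cutOp ρ (F t₀) y₀ - 2 * C * ρ)
      - max q 0 * (cutOp ρ (G t₀) x₀ + 2 * C * ρ) ≤ 0 := by
  let Ψ : ℝ → ℝ := fun z => a - z + max p 0 * (cutOp ρ (F t₀) y₀ - 2 * (C + z) * ρ)
      - max q 0 * (cutOp ρ (G t₀) x₀ + 2 * (C + z) * ρ)
  have hc : Continuous Ψ := by simp only [Ψ]; fun_prop
  have := nonpos_of_approx (x₀ := 0) hc.continuousAt (fun ε hε => by
    set z := ε / 2 with hz
    have hz0 : 0 < z := by positivity
    have hA1 : 0 < A + A ^ 2 / z + 1 := by positivity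
    refine ⟨z, by rw [Real.dist_eq, sub_zero, abs_of_pos hz0]; linarith, ?_⟩
    refine hF.two_point hG bF bG htT (τ := min τ (z / (A + A ^ 2 / z + 1)))
      (lt_min hτ (by positivity)) ((min_le_left _ _).trans hτt) (by positivity) hρ hr
      (fun t y x h1 h2 h3 h4 => (H t y x (by linarith [min_le_left τ (z / (A + A ^ 2 / z + 1))])
        h2 h3 h4).trans ?_)
    have hu : t₀ - t ≤ z / (A + A ^ 2 / z + 1) := by
      linarith [min_le_right τ (z / (A + A ^ 2 / z + 1))]
    have hu0 : 0 ≤ t₀ - t := by linarith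
    rw [show |t - t₀| = t₀ - t by rw [abs_sub_comm, abs_of_nonneg hu0]]
    set u := t₀ - t with hu_def
    have e0 : (t - t₀) = -u := by rw [hu_def]; ring
    rw [e0]
    have key : A * u ^ 2 + A ^ 2 * u ^ 2 / z ≤ z * u := by
      rw [le_div_iff₀ hA1] at hu
      have : A * u ^ 2 + A ^ 2 * u ^ 2 / z + u ^ 2 = u * (u * (A + A ^ 2 / z + 1)) := by
        field_simp
      nlinarith [mul_le_mul_of_nonneg_left hu hu0]
    have y1 : ∀ w : ℝ, A * u * |w| ≤ z * w ^ 2 + A ^ 2 * u ^ 2 / (4 * z) := by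
      intro w
      have : z * w ^ 2 + A ^ 2 * u ^ 2 / (4 * z) - A * u * |w| = (2 * z * |w| - A * u) ^ 2 / (4 * z) := by
        rw [← sq_abs w]; field_simp; ring
      have : 0 ≤ (2 * z * |w| - A * u) ^ 2 / (4 * z) := by positivity
      linarith
    have y2 := y1 y
    have y3 := y1 x
    have : A ^ 2 * u ^ 2 / (4 * z) = (A ^ 2 * u ^ 2 / z) / 4 := by field_simp
    have : 0 ≤ A ^ 2 * u ^ 2 / z := by positivity
    nlinarith)
  simpa [Ψ] using this

theorem bump_expansion (u z : ℝ) :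
    (u + z) ^ 2 / (1 + (u + z) ^ 2) ≤
      u ^ 2 / (1 + u ^ 2) + (2 * u / (1 + u ^ 2) ^ 2) * z + z ^ 2 := by
  have h : u ^ 2 / (1 + u ^ 2) + (2 * u / (1 + u ^ 2) ^ 2) * z + z ^ 2
      - (u + z) ^ 2 / (1 + (u + z) ^ 2)
      = z ^ 2 * ((2 * u ^ 2 + (u + (u + z)) ^ 2) + u ^ 2 * (u ^ 2 + (u + z) ^ 2)
        + (1 + u ^ 2) * (u ^ 2 * (u + z) ^ 2)) / ((1 + u ^ 2) ^ 2 * (1 + (u + z) ^ 2)) := by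
    field_simp
    ring
  have : 0 ≤ z ^ 2 * ((2 * u ^ 2 + (u + (u + z)) ^ 2) + u ^ 2 * (u ^ 2 + (u + z) ^ 2)
        + (1 + u ^ 2) * (u ^ 2 * (u + z) ^ 2)) / ((1 + u ^ 2) ^ 2 * (1 + (u + z) ^ 2)) := by
    positivity
  linarith

/-- An almost-maximum on a strip, perturbed to a maximum. -/
theorem exists_penalized_max {Φ : ℝ → ℝ → ℝ → ℝ} {t₁ t₂ d₁ d₂ N β : ℝ} (ht : t₁ ≤ t₂)
    (hd : d₁ ≤ d₂) (hβ : 0 < β)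
    (hΦ : ContinuousOn (fun w : ℝ × ℝ × ℝ => Φ w.1 w.2.1 w.2.2)
      (Icc t₁ t₂ ×ˢ univ ×ˢ Icc d₁ d₂))
    (hN : ∀ t ∈ Icc t₁ t₂, ∀ x, ∀ η ∈ Icc d₁ d₂, Φ t x η ≤ N) :
    ∃ t ∈ Icc t₁ t₂, ∃ x, ∃ η ∈ Icc d₁ d₂, ∃ m, |m| ≤ 1 ∧
      ∀ t' ∈ Icc t₁ t₂, ∀ z, ∀ η' ∈ Icc d₁ d₂,
        Φ t' (x + z) η' ≤ Φ t x η + β * (m * z + z ^ 2) ∧ Φ t' (x + z) η' ≤ Φ t x η + β := by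
  set S := (fun w : ℝ × ℝ × ℝ => Φ w.1 w.2.1 w.2.2) '' (Icc t₁ t₂ ×ˢ univ ×ˢ Icc d₁ d₂) with hS
  have hne : S.Nonempty := ⟨_, (t₁, 0, d₁), by simp [ht, hd], rfl⟩
  have hbd : BddAbove S := by
    refine ⟨N, ?_⟩
    rintro _ ⟨⟨t, x, η⟩, ⟨h1, -, h2⟩, rfl⟩
    exact hN t h1 x η h2
  obtain ⟨_, ⟨⟨ts, xs, ηs⟩, ⟨hts, -, hηs⟩, rfl⟩, hs⟩ :=
    exists_lt_of_lt_csSup hne (show sSup S - β / 2 < sSup S by linarith)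
  simp only at hts hηs hs
  let θ : ℝ → ℝ := fun u => u ^ 2 / (1 + u ^ 2)
  have hθc : Continuous θ := by
    refine (continuous_pow 2).div (by fun_prop) fun u => by positivity
  have hθ1 : ∀ u, θ u ≤ 1 := fun u => by
    simp only [θ]; rw [div_le_one (by positivity)]; linarith
  have hθ0 : ∀ u, 0 ≤ θ u := fun u => by simp only [θ]; positivity
  have hcompact : IsCompact (Icc t₁ t₂ ×ˢ Icc (xs - 1) (xs + 1) ×ˢ Icc d₁ d₂) :=
    isCompact_Icc.prod (isCompact_Icc.prod isCompact_Icc)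
  obtain ⟨⟨t, x, η⟩, ⟨h1, h2, h3⟩, hmax⟩ := hcompact.exists_isMaxOn
    (f := fun w : ℝ × ℝ × ℝ => Φ w.1 w.2.1 w.2.2 - β * θ (w.2.1 - xs))
    ⟨(ts, xs, ηs), hts, by simp, hηs⟩ (by
      refine ContinuousOn.sub (hΦ.mono ?_) ?_
      · exact Set.prod_mono le_rfl (Set.prod_mono (subset_univ _) le_rfl)
      · exact (continuous_const.mul (hθc.comp (by fun_prop))).continuousOn)
  simp only at h1 h2 h3
  have hstar := hmax (show (ts, xs, ηs) ∈ _ from ⟨hts, by simp, hηs⟩)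
  simp only [mem_ofPred_eq, sub_self] at hstar
  have hθz : θ 0 = 0 := by simp [θ]
  rw [hθz] at hstar
  have hglob : ∀ t' ∈ Icc t₁ t₂, ∀ x', ∀ η' ∈ Icc d₁ d₂,
      Φ t' x' η' - β * θ (x' - xs) ≤ Φ t x η - β * θ (x - xs) := by
    intro t' ht' x' η' hη'
    by_cases hx : x' ∈ Icc (xs - 1) (xs + 1)
    · exact hmax (show (t', x', η') ∈ _ from ⟨ht', hx, hη'⟩)
    · have h4 : 1 ≤ (x' - xs) ^ 2 := by
        rw [mem_Icc, not_and_or, not_le, not_le] at hx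
        rcases hx with hx | hx <;> nlinarith
      have h5 : 1 / 2 ≤ θ (x' - xs) := by
        simp only [θ]
        rw [div_le_div_iff₀ (by norm_num) (by positivity)]
        linarith
      have h6 : Φ t' x' η' ≤ sSup S :=
        le_csSup hbd ⟨(t', x', η'), ⟨ht', mem_univ _, hη'⟩, rfl⟩
      nlinarith
  refine ⟨t, h1, x, η, h3, 2 * (x - xs) / (1 + (x - xs) ^ 2) ^ 2, ?_, fun t' ht' z η' hη' => ?_⟩
  · set u := x - xs
    rw [abs_div, abs_of_pos (by positivity : 0 < (1 + u ^ 2) ^ 2), div_le_one (by positivity),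
      abs_mul, abs_two]
    nlinarith [sq_nonneg (|u| - 1), sq_abs u, sq_nonneg u, sq_nonneg (u ^ 2)]
  · have h4 := hglob t' ht' (x + z) η' hη'
    have h5 := bump_expansion (x - xs) z
    rw [show x - xs + z = x + z - xs by ring] at h5
    constructor
    · have := mul_le_mul_of_nonneg_left h5 hβ.le
      simp only [θ] at h4
      nlinarith
    · have := hθ1 (x + z - xs)
      have := hθ0 (x - xs)
      nlinarith

theorem PastSub.comparison {T M M' : ℝ} {F G : ℝ → ℝ → ℝ} (hF : PastSub T F)
    (hG : PastSub T (dual G)) (bF : BddUC M F) (bG : BddUC M' G)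
    (h0 : ∀ x, F 0 x ≤ G 0 x) {t₁ : ℝ} (ht₁ : 0 ≤ t₁) (ht₁T : t₁ ≤ T) (x₁ : ℝ) :
    F t₁ x₁ ≤ G t₁ x₁ := by
  by_contra! hlt
  have ht₁ : 0 < t₁ := by
    rcases ht₁.eq_or_lt with rfl | h
    · exact absurd (h0 x₁) hlt.not_ge
    · exact h
  obtain ⟨σ, hσdef⟩ : ∃ σ, F t₁ x₁ - G t₁ x₁ = 4 * σ := ⟨(F t₁ x₁ - G t₁ x₁) / 4, by ring⟩
  have hσ : 0 < σ := by linarith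
  have hM := bF.nonneg
  have hM' := bG.nonneg
  obtain ⟨κ, hκdef, hκ⟩ : ∃ κ, κ * t₁ = σ ∧ 0 < κ :=
    ⟨σ / t₁, by field_simp, by positivity⟩
  obtain ⟨D, hD, hmod⟩ := bF.modulus hσ
  obtain ⟨k, hk, hk0⟩ : ∃ k, k * D ^ 2 = 4 * (M + M' + 1) ∧ 0 < k :=
    ⟨4 * (M + M' + 1) / D ^ 2, by field_simp, by positivity⟩
  obtain ⟨ρ, hρ, hρD, hρκ⟩ : ∃ ρ > 0, ρ ≤ D / 8 ∧ (2 * (k * D) + 1) * (2 * (2 * k + 1)) * ρ ≤ κ / 4 := by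
    refine ⟨min (D / 8) (κ / 4 / ((2 * (k * D) + 1) * (2 * (2 * k + 1)))),
      lt_min (by positivity) (by positivity), min_le_left _ _, ?_⟩
    have := min_le_right (D / 8) (κ / 4 / ((2 * (k * D) + 1) * (2 * (2 * k + 1))))
    rwa [le_div_iff₀ (by positivity), mul_comm] at this
  obtain ⟨β, hβ, hβ1, hβσ, hβκ⟩ : ∃ β > 0, β ≤ 1 ∧ β ≤ σ ∧
      β * (2 * (k * D) + 4 * M') / ρ ≤ κ / 4 := by
    refine ⟨min (min 1 σ) (κ / 4 * ρ / (2 * (k * D) + 4 * M' + 1)),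
      lt_min (lt_min one_pos hσ) (by positivity), (min_le_left _ _).trans (min_le_left _ _),
      (min_le_left _ _).trans (min_le_right _ _), ?_⟩
    have h := min_le_right (min 1 σ) (κ / 4 * ρ / (2 * (k * D) + 4 * M' + 1))
    rw [le_div_iff₀ (by positivity)] at h
    rw [div_le_iff₀ hρ]
    have h' : 0 ≤ min (min 1 σ) (κ / 4 * ρ / (2 * (k * D) + 4 * M' + 1)) :=
      (lt_min (lt_min one_pos hσ) (by positivity)).le
    linarith
  obtain ⟨t, ht, x, η, hη, m, hm, hmax⟩ := exists_penalized_max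
    (Φ := fun t x η => F t (x + η) - G t x - k * η ^ 2 - κ * t) (t₁ := 0) (t₂ := t₁) (d₁ := -D)
    (d₂ := D) (N := M + M') ht₁.le (by linarith) hβ (by
      have h1 := bF.comp (X := ℝ × ℝ × ℝ) (u := fun w => w.1) (v := fun w => w.2.1 + w.2.2)
        (by fun_prop) (by fun_prop)
      have h2 := bG.comp (X := ℝ × ℝ × ℝ) (u := fun w => w.1) (v := fun w => w.2.1)
        (by fun_prop) (by fun_prop)
      have h3 : Continuous fun w : ℝ × ℝ × ℝ => - k * w.2.2 ^ 2 - κ * w.1 := by fun_prop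
      exact (((h1.sub h2).add h3).congr fun w => by
        simp only [Pi.add_apply, Pi.sub_apply]; ring).continuousOn) (by
      intro t ht x η _
      have := abs_le.1 (bF.bdd t (x + η))
      have := abs_le.1 (bG.bdd t x)
      have : 0 ≤ k * η ^ 2 := by positivity
      have : 0 ≤ κ * t := mul_nonneg hκ.le ht.1
      linarith)
  have hbig : 2 * σ ≤ F t (x + η) - G t x - k * η ^ 2 - κ * t := by
    have := (hmax t₁ (right_mem_Icc.2 ht₁.le) (x₁ - x) 0 ⟨by linarith, by linarith⟩).2
    rw [show x + (x₁ - x) = x₁ by ring] at this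
    simp only [add_zero] at this
    nlinarith
  have hκt : 0 ≤ κ * t := mul_nonneg hκ.le ht.1
  have hηD : |η| ≤ D / 2 := by
    refine abs_le_of_sq_le_sq ?_ (by positivity)
    have := abs_le.1 (bF.bdd t (x + η))
    have := abs_le.1 (bG.bdd t x)
    refine le_of_mul_le_mul_left ?_ hk0
    nlinarith
  have htpos : 0 < t := by
    refine ht.1.lt_of_ne fun h => ?_
    rw [← h] at hbig
    have := h0 x
    have := (abs_le.1 (hmod 0 0 (x + η) x (by simpa using hD.le) (by simp; linarith))).2
    have : 0 ≤ k * η ^ 2 := by positivity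
    linarith
  have hη' := abs_le.1 hηD
  have key := hF.two_point hG bF bG (t₀ := t) (y₀ := x + η) (x₀ := x) (a := κ) (p := 2 * k * η)
    (q := 2 * k * η - β * m) (C := 2 * k + β) (τ := t) (r := D / 4) (ρ := ρ) (ht.2.trans ht₁T)
    htpos le_rfl (by positivity) hρ (by linarith) (fun t' y' x' h1 h2 h3 h4 => by
      have h3' := abs_le.1 h3
      have h4' := abs_le.1 h4
      have := (hmax t' ⟨by linarith, h2.trans ht.2⟩ x' (η + y' - x')
        ⟨by linarith, by linarith⟩).1
      rw [show x + x' + (η + y' - x') = x + η + y' by ring] at this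
      linarith [mul_nonneg hk0.le (sq_nonneg (y' + x')), mul_nonneg hβ.le (sq_nonneg y')])
  have hI : cutOp ρ (G t) x - 2 * β / ρ ≤ cutOp ρ (F t) (x + η) := by
    rw [← tailInt_const hρ]
    unfold cutOp
    rw [← tailInt_sub hρ (continuous_second_diff (bG.slice t) x) (abs_second_diff_le (bG.bdd t) x)
      continuous_const (M' := |2 * β|) (fun _ => le_rfl)]
    refine tailInt_mono hρ ((continuous_second_diff (bG.slice t) x).sub continuous_const)
      (M := 4 * M' + |2 * β|) (fun z => (abs_sub _ _).trans
        (add_le_add_left (abs_second_diff_le (bG.bdd t) x z) _))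
      (continuous_second_diff (bF.slice t) _) (abs_second_diff_le (bF.bdd t) _) fun z _ => ?_
    have h1 := (hmax t ht z η hη).2
    have h2 := (hmax t ht (-z) η hη).2
    rw [show x + z + η = x + η + z by ring] at h1
    rw [show x + -z + η = x + η - z by ring, ← sub_eq_add_neg] at h2
    linarith
  have hIG := abs_le.1 (abs_cutOp_le hρ (bG.slice t) (bG.bdd t) x)
  have hp : |2 * k * η| ≤ k * D := by
    rw [abs_mul, abs_of_pos (by positivity : 0 < 2 * k)]
    nlinarith
  have hpp : max (2 * k * η) 0 ≤ k * D := max_le ((le_abs_self _).trans hp) (by positivity)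
  have hpq : |max (2 * k * η) 0 - max (2 * k * η - β * m) 0| ≤ β := by
    refine (abs_max_sub_max_le_abs _ _ _).trans ?_
    rw [show 2 * k * η - (2 * k * η - β * m) = β * m by ring, abs_mul, abs_of_pos hβ]
    nlinarith
  have hp0 : 0 ≤ max (2 * k * η) 0 := le_max_right _ _
  have hq0 : 0 ≤ max (2 * k * η - β * m) 0 := le_max_right _ _
  generalize max (2 * k * η) 0 = P at *
  generalize max (2 * k * η - β * m) 0 = Q at *
  generalize cutOp ρ (G t) x = IG at *
  generalize cutOp ρ (F t) (x + η) = IF at *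
  have hpq' := abs_le.1 hpq
  have e1 : P * (IG - 2 * β / ρ) ≤ P * IF := mul_le_mul_of_nonneg_left hI hp0
  have e2 : - (β * (4 * M' / ρ)) ≤ (P - Q) * IG := by
    have : |(P - Q) * IG| ≤ β * (4 * M' / ρ) := by
      rw [abs_mul]
      exact mul_le_mul hpq (abs_le.2 hIG) (abs_nonneg _) hβ.le
    linarith [(abs_le.1 this).1]
  have e3 : P * (2 * β / ρ) ≤ (k * D) * (2 * β / ρ) := by gcongr
  have e4 : (P + Q) * (2 * (2 * k + β) * ρ) ≤ (2 * (k * D) + 1) * (2 * (2 * k + 1) * ρ) := by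
    refine mul_le_mul (by linarith) ?_ (by positivity) (by positivity)
    gcongr
  have e5 : β * (2 * (k * D) + 4 * M') / ρ = (k * D) * (2 * β / ρ) + β * (4 * M' / ρ) := by
    field_simp
  linarith

theorem PastSub.dual_scale {T : ℝ} {F : ℝ → ℝ → ℝ} (h : PastSub T (dual F)) {l m : ℝ}
    (hl : 0 < l) (hm : 0 < m) (x₁ c : ℝ) {f : ℝ} (hf : f = l * m ^ 2) :
    PastSub (T / f) (dual fun s y => l * F (f * s) (x₁ + m * y) + c) := by
  have := h.scale hl hm (-x₁) (-c) hf
  have e : (dual fun s y => l * F (f * s) (x₁ + m * y) + c)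
      = fun s y => l * dual F (f * s) (-x₁ + m * y) + -c := by
    funext s y
    simp only [dual]
    rw [show x₁ + m * -y = -(-x₁ + m * y) by ring]
    ring
  rwa [e]

theorem PastSub.time_lip {T M : ℝ} {F : ℝ → ℝ → ℝ} (hF : PastSub T F)
    (hF' : PastSub T (dual F)) (bF : BddUC M F) {t t' : ℝ} (ht : 0 < t) (htt : t ≤ t')
    (htT : t' ≤ T) (x : ℝ) : |F t' x - F t x| ≤ 2 * M / t * (t' - t) := by
  set l := t' / t with hl
  have hl1 : 1 ≤ l := by rw [hl, le_div_iff₀ ht]; linarith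
  have hl0 : 0 < l := by linarith
  have hM := bF.nonneg
  have hlt : l * t = t' := by rw [hl]; field_simp
  have hlT : t ≤ T / l := by rw [le_div_iff₀ hl0]; linarith
  have hb := fun y => abs_le.1 (bF.bdd 0 y)
  have e1 : 2 * M / t * (t' - t) = 2 * M * (l - 1) := by rw [hl]; field_simp
  have hbt := abs_le.1 (bF.bdd t' x)
  have tT : t ≤ T := by linarith
  have up := (hF.mono tT).comparison (M' := l * M + |(l - 1) * M|)
    ((hF'.dual_scale hl0 one_pos 0 ((l - 1) * M) (f := l) (by ring)).mono hlT) bF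
    (bF.scale hl0.le 1 0 ((l - 1) * M) l)
    (fun y => by
      simp only [mul_zero, zero_add, one_mul]
      nlinarith [hb y]) ht.le le_rfl x
  have lo := ((hF.scale hl0 one_pos 0 (-((l - 1) * M)) (f := l) (by ring)).mono hlT).comparison
    (M := l * M + |-((l - 1) * M)|) (hF'.mono tT)
    (bF.scale hl0.le 1 0 (-((l - 1) * M)) l) bF
    (fun y => by
      simp only [mul_zero, zero_add, one_mul]
      nlinarith [hb y]) ht.le le_rfl x
  simp only [hlt, zero_add, one_mul] at up lo
  rw [e1, abs_le]
  constructor <;> nlinarith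

theorem integral_second_diff_sub {f : ℝ → ℝ} (hf : Continuous f) (x y R : ℝ) :
    ∫ z in (0 : ℝ)..R, ((2 * f y - f (y + z) - f (y - z)) - (2 * f x - f (x + z) - f (x - z)))
      = 2 * R * (f y - f x) - ∫ w in x..y, (f (w + R) - f (w - R)) := by
  have ii : ∀ a b, IntervalIntegrable f volume a b := fun a b => hf.intervalIntegrable a b
  have key : ∀ y, ∫ z in (0 : ℝ)..R, (2 * f y - f (y + z) - f (y - z))
      = 2 * R * f y - ∫ w in (y - R)..(y + R), f w := by
    intro y
    rw [intervalIntegral.integral_sub, intervalIntegral.integral_sub,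
      intervalIntegral.integral_comp_add_left, intervalIntegral.integral_comp_sub_left,
      intervalIntegral.integral_const, ← intervalIntegral.integral_add_adjacent_intervals
        (ii (y - R) y) (ii y (y + R))]
    · simp only [add_zero, sub_zero, smul_eq_mul]; ring
    all_goals exact Continuous.intervalIntegrable (by fun_prop) _ _
  rw [intervalIntegral.integral_sub, key, key, intervalIntegral.integral_sub,
    intervalIntegral.integral_comp_add_right, intervalIntegral.integral_comp_sub_right]
  · have e1 := intervalIntegral.integral_add_adjacent_intervals (ii (x - R) (x + R))
      (ii (x + R) (y + R))
    have e2 := intervalIntegral.integral_add_adjacent_intervals (ii (x - R) (y - R))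
      (ii (y - R) (y + R))
    linarith
  all_goals exact Continuous.intervalIntegrable (by fun_prop) _ _

/-- A jump of `f` from `x` to `y` that is not continued on the scale `R` produces a gain. -/
theorem gain_le_integral_mid {f : ℝ → ℝ} (hf : Continuous f) {x y ρ R A K e₀ e₂ : ℝ} (hρ : 0 < ρ)
    (hρR : ρ ≤ R) (hxy : x ≤ y) (hA : ∀ w, x ≤ w → w ≤ y → f (w + R) - f (w - R) ≤ A)
    (he₀ : 0 ≤ e₀) (he₂ : 0 ≤ e₂) {k : ℝ → ℝ} (hk : k = fun z =>
      (2 * f y - f (y + z) - f (y - z)) - (2 * f x - f (x + z) - f (x - z)))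
    (hK : ∀ z, 0 ≤ z → z ≤ ρ → k z ≤ K)
    (hlow : ∀ z, ρ < z → z ≤ R → -e₀ - e₂ * z ^ 2 ≤ k z) :
    (2 * R * (f y - f x) - (y - x) * A - ρ * K) / R ^ 2 - e₀ / ρ - e₂ * R ≤
      ∫ z in Ioc ρ R, k z / z ^ 2 := by
  have hR : 0 < R := hρ.trans_le hρR
  have hkc : Continuous k := by rw [hk]; fun_prop
  have h0 : ∫ z in (0 : ℝ)..R, k z = 2 * R * (f y - f x) - ∫ w in x..y, (f (w + R) - f (w - R)) := by
    rw [hk]; exact integral_second_diff_sub hf x y R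
  have h1 : ∫ w in x..y, (f (w + R) - f (w - R)) ≤ (y - x) * A := by
    have := intervalIntegral.integral_mono_on (μ := volume) hxy
      (Continuous.intervalIntegrable (u := fun w => f (w + R) - f (w - R)) (by fun_prop) _ _)
      (intervalIntegrable_const (c := A)) fun w hw => hA w hw.1 hw.2
    rwa [intervalIntegral.integral_const, smul_eq_mul] at this
  have h2 : ∫ z in (0 : ℝ)..ρ, k z ≤ ρ * K := by
    have := intervalIntegral.integral_mono_on (μ := volume) hρ.le
      (hkc.intervalIntegrable _ _)
      (intervalIntegrable_const (c := K)) fun w hw => hK w hw.1 hw.2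
    rwa [intervalIntegral.integral_const, smul_eq_mul, sub_zero] at this
  have h3 := intervalIntegral.integral_add_adjacent_intervals (μ := volume)
    (hkc.intervalIntegrable 0 ρ) (hkc.intervalIntegrable ρ R)
  rw [intervalIntegral.integral_of_le hρR] at h3
  have hik : IntegrableOn k (Ioc ρ R) := hkc.integrableOn_Ioc
  -- compare `k / z²` with `k / R²` on `(ρ, R]`
  have hi1 : IntegrableOn (fun z => k z / R ^ 2) (Ioc ρ R) := hik.div_const _
  have hi2 : IntegrableOn (fun z : ℝ => (-e₀) / z ^ 2 + (-e₂)) (Ioc ρ R) :=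
    ((integrableOn_inv_sq hρ (-e₀)).mono_set Ioc_subset_Ioi_self).add (by simp)
  have h4 : ∫ z in Ioc ρ R, (k z / R ^ 2 + ((-e₀) / z ^ 2 + (-e₂))) ≤
      ∫ z in Ioc ρ R, k z / z ^ 2 := by
    refine setIntegral_mono_on
      (hi1.add hi2)
      (integrableOn_mid hρ hkc) measurableSet_Ioc fun z hz => ?_
    have hz0 : 0 < z := hρ.trans hz.1
    have h5 : 0 ≤ k z + e₀ + e₂ * z ^ 2 := by linarith [hlow z hz.1 hz.2]
    have h6 : (k z + e₀ + e₂ * z ^ 2) / R ^ 2 ≤ (k z + e₀ + e₂ * z ^ 2) / z ^ 2 := by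
      gcongr
      exact hz.2
    have h7 : (k z + e₀ + e₂ * z ^ 2) / z ^ 2 = k z / z ^ 2 - (-e₀) / z ^ 2 + e₂ := by
      field_simp
      ring
    have h8 : k z / R ^ 2 ≤ (k z + e₀ + e₂ * z ^ 2) / R ^ 2 := by
      gcongr
      nlinarith [mul_nonneg he₂ (sq_nonneg z)]
    linarith
  rw [integral_add hi1 hi2, integral_div] at h4
  have h9 : -(e₀ / ρ) - e₂ * R ≤ ∫ z in Ioc ρ R, ((-e₀) / z ^ 2 + (-e₂)) := by
    have := le_integral_mid (k := fun z => -e₀ + (-e₂) * z ^ 2) hρ hρR (by fun_prop) he₂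
      (fun z _ _ => by linarith) he₀
    refine this.trans_eq (setIntegral_congr_fun measurableSet_Ioc fun z hz => ?_)
    have hz0 : 0 < z := hρ.trans hz.1
    field_simp
  have h10 : (2 * R * (f y - f x) - (y - x) * A - ρ * K) / R ^ 2 ≤ (∫ z in Ioc ρ R, k z) / R ^ 2 := by
    gcongr
    linarith
  linarith

theorem eventually_small_mul (c : ℝ) {e : ℝ} (he : 0 < e) : ∀ᶠ ρ in 𝓝[>] (0 : ℝ), c * ρ < e := by
  have : Tendsto (fun ρ : ℝ => c * ρ) (𝓝[>] 0) (𝓝 (c * 0)) :=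
    ((continuous_const.mul continuous_id).tendsto 0).mono_left nhdsWithin_le_nhds
  rw [mul_zero] at this
  exact this.eventually (gt_mem_nhds he)

theorem eventually_small {e : ℝ} (he : 0 < e) : ∀ᶠ ρ in 𝓝[>] (0 : ℝ), ρ < e := by
  simpa using eventually_small_mul 1 he

theorem eventually_pos : ∀ᶠ ρ in 𝓝[>] (0 : ℝ), 0 < ρ := self_mem_nhdsWithin

theorem slope_bound_arith {M U Q t η ρ β IF IG U₁ c : ℝ} (hM : 0 < M) (hU : 0 < U) (hUU : U ≤ U₁)
    (hQ : |U - Q| ≤ β) (hβ1 : β ≤ 1) (hρ : 0 < ρ) (hρ1 : ρ < 1)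
    (hUM : 4 * M ≤ U ^ 2 * t) (ht : 0 < t) (hη : 0 < η) (hc : c ≤ U * η / t) (hc0 : 0 < c)
    (hIG : |IG| ≤ 4 * M / ρ) (hgain : U ^ 2 * (η - 4 * ρ) / (2 * M) - 4 * β / ρ ≤ IF - IG)
    (hρc : (2 * U₁ ^ 3 / M) * ρ < c / 4) (hβc : ((4 * U₁ + 4 * M) / ρ) * β < c / 4)
    (hβc' : (2 * U₁ + 1) * 2 * β < c / 4)
    (key : -(U * η / t) + U * (IF - 2 * β * ρ) - Q * (IG + 2 * β * ρ) ≤ 0) : False := by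
  have hβ : 0 ≤ β := (abs_nonneg _).trans hQ
  have e1 : U * (U ^ 2 * (η - 4 * ρ) / (2 * M) - 4 * β / ρ) ≤ U * (IF - IG) :=
    mul_le_mul_of_nonneg_left hgain hU.le
  have e2 : - (β * (4 * M / ρ)) ≤ (U - Q) * IG := by
    have : |(U - Q) * IG| ≤ β * (4 * M / ρ) := by
      rw [abs_mul]
      exact mul_le_mul hQ hIG (abs_nonneg _) hβ
    linarith [(abs_le.1 this).1]
  have e3 : 2 * (U * η / t) ≤ U * (U ^ 2 * η / (2 * M)) := by
    rw [show U * (U ^ 2 * η / (2 * M)) = (U * η / t) * (U ^ 2 * t / (2 * M)) by field_simp]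
    rw [mul_comm]
    refine mul_le_mul_of_nonneg_left ?_ (by positivity)
    rw [le_div_iff₀ (by positivity)]
    linarith
  have e4 : U * (U ^ 2 * (η - 4 * ρ) / (2 * M) - 4 * β / ρ)
      = U * (U ^ 2 * η / (2 * M)) - 2 * U ^ 3 / M * ρ - U * (4 * β / ρ) := by
    field_simp
    ring
  have e5 : 2 * U ^ 3 / M * ρ ≤ 2 * U₁ ^ 3 / M * ρ := by gcongr
  have e6 : U * (4 * β / ρ) ≤ U₁ * (4 * β / ρ) := by gcongr
  have e7 : ((4 * U₁ + 4 * M) / ρ) * β = U₁ * (4 * β / ρ) + β * (4 * M / ρ) := by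
    field_simp
  have e8 : (U + Q) * (2 * β * ρ) ≤ (2 * U₁ + 1) * 2 * β := by
    have h1 : U + Q ≤ 2 * U₁ + 1 := by linarith [(abs_le.1 hQ).1]
    calc (U + Q) * (2 * β * ρ) ≤ (2 * U₁ + 1) * (2 * β * ρ) := by gcongr
      _ ≤ (2 * U₁ + 1) * (2 * β * 1) := by
        have : 0 ≤ 2 * U₁ + 1 := by linarith
        gcongr
      _ = _ := by ring
  linarith

set_option maxHeartbeats 1000000 in
theorem PastSub.slope_bound {T M B : ℝ} {F : ℝ → ℝ → ℝ} (hF : PastSub T F)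
    (hF' : PastSub T (dual F)) (bF : BddUC M F) (hM : 0 < M) (hT : 0 < T) (hB : 0 < B)
    (hB2 : 4 * M * T ≤ B ^ 2) {t₁ x₁ y₁ : ℝ} (ht₁ : 0 < t₁) (ht₁T : t₁ ≤ T) (hxy : x₁ ≤ y₁) :
    F t₁ y₁ - F t₁ x₁ ≤ B / t₁ * (y₁ - x₁) := by
  by_contra! hlt
  obtain ⟨σ, hσdef⟩ : ∃ σ, σ = F t₁ y₁ - F t₁ x₁ - B / t₁ * (y₁ - x₁) := ⟨_, rfl⟩
  have hσ : 0 < σ := by linarith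
  have hdiff : ∀ t y x, F t y - F t x ≤ 2 * M := fun t y x => by
    have := abs_le.1 (bF.bdd t y)
    have := abs_le.1 (bF.bdd t x)
    linarith
  obtain ⟨d, hd, hmod⟩ := bF.modulus (show 0 < σ / 4 by positivity)
  have hsmall : ∀ t x η, 0 ≤ η → η ≤ d → F t (x + η) - F t x ≤ σ / 4 := fun t x η h1 h2 =>
    (abs_le.1 (hmod t t (x + η) x (by simpa using hd.le) (by
      rw [add_sub_cancel_left, abs_of_nonneg h1]; exact h2))).2
  obtain ⟨t₂, ht₂, ht₂₁, ht₂B⟩ : ∃ t₂ > 0, t₂ ≤ t₁ ∧ 2 * M / d ≤ B / t₂ := by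
    refine ⟨min t₁ (B * d / (2 * M)), lt_min ht₁ (by positivity), min_le_left _ _, ?_⟩
    have := min_le_right t₁ (B * d / (2 * M))
    rw [le_div_iff₀ (by positivity)] at this
    rw [div_le_div_iff₀ hd (lt_min ht₁ (by positivity))]
    linarith
  obtain ⟨D, hD⟩ : ∃ D, D = 2 * M * T / B + 1 := ⟨_, rfl⟩
  have hD0 : 0 < D := by rw [hD]; positivity
  have hηD : ∀ t η, 0 < t → t ≤ T → B / t * η ≤ 2 * M → η ≤ D - 1 := fun t η h1 h2 h3 => by
    rw [hD, add_sub_cancel_right, le_div_iff₀ hB]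
    rw [div_mul_eq_mul_div, div_le_iff₀ h1] at h3
    nlinarith
  obtain ⟨c, hcdef⟩ : ∃ c, c = B * d / T ^ 2 := ⟨_, rfl⟩
  have hc0 : 0 < c := by rw [hcdef]; positivity
  obtain ⟨ρ, ⟨⟨⟨⟨hρd, hρ1⟩, hρR⟩, hρc⟩, hρ⟩⟩ :=
    (((((eventually_small (half_pos hd)).and
      (eventually_small (show (0 : ℝ) < 1 / 2 by norm_num))).and
      (eventually_small (show 0 < 2 * M / (B / t₂) by positivity))).and
      (eventually_small_mul (2 * (B / t₂) ^ 3 / M) (show 0 < c / 4 by positivity))).and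
      eventually_pos).exists
  obtain ⟨β, ⟨⟨⟨⟨hβ1, hβσ⟩, hβc⟩, hβc'⟩, hβ⟩⟩ :=
    (((((eventually_small one_pos).and
      (eventually_small (show 0 < σ / 4 by positivity))).and
      (eventually_small_mul ((4 * (B / t₂) + 4 * M) / ρ) (show 0 < c / 4 by positivity))).and
      (eventually_small_mul ((2 * (B / t₂) + 1) * 2) (show 0 < c / 4 by positivity))).and
      eventually_pos).exists
  obtain ⟨t, ht, x, η, hη, m, hm, hmax⟩ := exists_penalized_max
    (Φ := fun t x η => F t (x + η) - F t x - B / t * η) (t₁ := t₂) (t₂ := T) (d₁ := 0)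
    (d₂ := D) (N := 2 * M) (by linarith) hD0.le hβ (by
      have h1 := bF.comp (X := ℝ × ℝ × ℝ) (u := fun w => w.1) (v := fun w => w.2.1 + w.2.2)
        (by fun_prop) (by fun_prop)
      have h2 := bF.comp (X := ℝ × ℝ × ℝ) (u := fun w => w.1) (v := fun w => w.2.1)
        (by fun_prop) (by fun_prop)
      refine (h1.sub h2).continuousOn.sub (ContinuousOn.mul (ContinuousOn.div continuousOn_const
        (by fun_prop) fun w hw => ?_) (by fun_prop))
      exact (ht₂.trans_le hw.1.1).ne') (by
      intro t ht x η hη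
      have := hdiff t (x + η) x
      have : 0 ≤ B / t * η := mul_nonneg (div_nonneg hB.le (ht₂.le.trans ht.1)) hη.1
      linarith)
  have ht0 : 0 < t := ht₂.trans_le ht.1
  have hbig : 3 * σ / 4 ≤ F t (x + η) - F t x - B / t * η := by
    have h1 : y₁ - x₁ ≤ D - 1 := hηD t₁ _ ht₁ ht₁T (by linarith [hdiff t₁ y₁ x₁])
    have := (hmax t₁ ⟨ht₂₁, ht₁T⟩ (x₁ - x) (y₁ - x₁) ⟨by linarith, by linarith⟩).2
    rw [show x + (x₁ - x) = x₁ by ring, show x₁ + (y₁ - x₁) = y₁ by ring] at this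
    linarith
  have hUη : 0 ≤ B / t * η := mul_nonneg (by positivity) hη.1
  have hηd : d < η := by
    by_contra! h
    linarith [hsmall t x η hη.1 h]
  have ht₂t : t₂ < t := by
    refine ht.1.lt_of_ne fun h => ?_
    rw [← h] at hbig
    have h1 := hdiff t₂ (x + η) x
    have h2 : 2 * M ≤ 2 * M / d * η := by
      rw [div_mul_eq_mul_div, le_div_iff₀ hd]
      gcongr
    have h3 : 2 * M / d * η ≤ B / t₂ * η := by gcongr; exact hη.1
    linarith
  have hηD' : η ≤ D - 1 := hηD t η ht0 ht.2 (by linarith [hdiff t (x + η) x])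
  have hU0 : 0 < B / t := by positivity
  have key := hF.two_point_coupled hF' bF bF (t₀ := t) (y₀ := x + η) (x₀ := x)
    (a := -(B / t * η / t)) (p := B / t) (q := B / t - β * m) (C := β)
    (A := B * D / t₂ ^ 3 + B / t₂ ^ 2) (τ := t - t₂) (r := min (d / 2) (1 / 2)) (ρ := ρ) ht.2
    (by linarith) (by linarith) hβ.le (by positivity) hρ (lt_min hρd hρ1)
    (fun t' y' x' h1 h2 h3 h4 => by
      have h3' := abs_le.1 (h3.trans (min_le_left _ _))
      have h4' := abs_le.1 (h4.trans (min_le_left _ _))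
      have h3'' := abs_le.1 (h3.trans (min_le_right _ _))
      have h4'' := abs_le.1 (h4.trans (min_le_right _ _))
      have ht' : t₂ ≤ t' := by linarith
      have ht'0 : 0 < t' := ht₂.trans_le ht'
      have hu : 0 ≤ t - t' := by linarith
      have := (hmax t' ⟨ht', h2.trans ht.2⟩ x' (η + y' - x')
        ⟨by linarith, by linarith⟩).1
      rw [show x + x' + (η + y' - x') = x + η + y' by ring] at this
      have e1 : B / t' = B / t + B / t / t * (t - t') + B * (t - t') ^ 2 / (t ^ 2 * t') := by
        field_simp
        ring
      have e1' : B / t' - B / t = B * (t - t') / (t * t') := by field_simp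
      have e2 : B * (t - t') ^ 2 / (t ^ 2 * t') * η ≤ B * D / t₂ ^ 3 * (t - t') ^ 2 := by
        calc B * (t - t') ^ 2 / (t ^ 2 * t') * η ≤ B * (t - t') ^ 2 / (t₂ ^ 2 * t₂) * D := by
              gcongr <;> linarith
          _ = _ := by field_simp
      have e3 : (B / t' - B / t) * (y' - x') ≤ B / t₂ ^ 2 * (t - t') * (|y'| + |x'|) := by
        have h5 : y' - x' ≤ |y'| + |x'| := by linarith [le_abs_self y', neg_abs_le x']
        have h6 : 0 ≤ |y'| + |x'| := by positivity
        rw [e1']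
        calc B * (t - t') / (t * t') * (y' - x') ≤ B * (t - t') / (t * t') * (|y'| + |x'|) := by
              gcongr
          _ ≤ B * (t - t') / (t₂ * t₂) * (|y'| + |x'|) := by gcongr
          _ = _ := by field_simp
      rw [show |t' - t| = t - t' by rw [abs_sub_comm, abs_of_nonneg hu]]
      have e4 : B / t' * (η + y' - x') = B / t * η + B / t / t * (t - t') * η
          + B * (t - t') ^ 2 / (t ^ 2 * t') * η + B / t * (y' - x')
          + (B / t' - B / t) * (y' - x') := by
        rw [show B / t' * (η + y' - x') = B / t' * η + B / t' * (y' - x') by ring]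
        nth_rewrite 1 [e1]
        ring
      have e5 : B / t * η / t = B / t / t * η := by ring
      have e6 : 0 ≤ B * D / t₂ ^ 3 * (t - t') * (|y'| + |x'|) := by positivity
      have e7 : 0 ≤ B / t₂ ^ 2 * (t - t') ^ 2 := by positivity
      have e8 : 0 ≤ β * y' ^ 2 := by positivity
      rw [e4] at this
      rw [e5]
      generalize B / t / t = b1 at *
      generalize B / t = b2 at *
      generalize B * (t - t') ^ 2 / (t ^ 2 * t') = b3 at *
      generalize B * D / t₂ ^ 3 = b4 at *
      generalize B / t₂ ^ 2 = b5 at *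
      linarith)
  have hRρ : ρ ≤ 2 * M / (B / t) := by
    refine hρR.le.trans ?_
    gcongr
  have hR0 : 0 < 2 * M / (B / t) := by positivity
  have hk1 : Continuous fun z => 2 * F t (x + η) - F t (x + η + z) - F t (x + η - z) :=
    continuous_second_diff (bF.slice t) _
  have hk2 : Continuous fun z => 2 * F t x - F t (x + z) - F t (x - z) :=
    continuous_second_diff (bF.slice t) _
  have hkb1 := abs_second_diff_le (bF.bdd t) (x + η)
  have hkb2 := abs_second_diff_le (bF.bdd t) x
  have hkb : ∀ z, |(2 * F t (x + η) - F t (x + η + z) - F t (x + η - z)) -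
      (2 * F t x - F t (x + z) - F t (x - z))| ≤ 8 * M := fun z =>
    (abs_sub _ _).trans (by linarith [hkb1 z, hkb2 z])
  have hlow : ∀ z, -(2 * β) ≤ (2 * F t (x + η) - F t (x + η + z) - F t (x + η - z)) -
      (2 * F t x - F t (x + z) - F t (x - z)) := fun z => by
    have h1 := (hmax t ht z η hη).2
    have h2 := (hmax t ht (-z) η hη).2
    rw [show x + z + η = x + η + z by ring] at h1
    rw [show x + -z + η = x + η - z by ring, ← sub_eq_add_neg] at h2
    linarith
  have hmid := gain_le_integral_mid (bF.slice t) (x := x) (y := x + η) (A := 2 * M)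
    (K := 8 * M) (e₀ := 2 * β) (e₂ := 0) hρ hRρ (by linarith)
    (fun w _ _ => hdiff t _ _) (by positivity) le_rfl rfl
    (fun z _ _ => (abs_le.1 (hkb z)).2) (fun z _ _ => by linarith [hlow z])
  have hk12 : Continuous fun z => (2 * F t (x + η) - F t (x + η + z) - F t (x + η - z)) -
      (2 * F t x - F t (x + z) - F t (x - z)) := hk1.sub hk2
  have htail := le_tailInt hR0 hk12 hkb (fun z _ => hlow z)
  have hsplit := tailInt_split hρ hRρ hk12 hkb
  have hsub := tailInt_sub hρ hk1 hkb1 hk2 hkb2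
  have hgain : (B / t) ^ 2 * (η - 4 * ρ) / (2 * M) - 4 * β / ρ ≤
      cutOp ρ (F t) (x + η) - cutOp ρ (F t) x := by
    unfold cutOp
    rw [← hsub, hsplit]
    have e1 : -(2 * β) / ρ ≤ -(2 * β) / (2 * M / (B / t)) := by
      rw [neg_div, neg_div, neg_le_neg_iff]
      gcongr
    have e2 : (B / t) ^ 2 * (η - 4 * ρ) / (2 * M) ≤
        (2 * (2 * M / (B / t)) * (F t (x + η) - F t x) - (x + η - x) * (2 * M) - ρ * (8 * M))
          / (2 * M / (B / t)) ^ 2 := by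
      rw [le_div_iff₀ (by positivity)]
      have e3 : (B / t) ^ 2 * (η - 4 * ρ) / (2 * M) * (2 * M / (B / t)) ^ 2
        = 2 * (2 * M / (B / t)) * (B / t * η) - η * (2 * M) - ρ * (8 * M) := by
        field_simp
        ring
      rw [e3, add_sub_cancel_left]
      gcongr
      linarith
    have e3 : 4 * β / ρ = 2 * β / ρ + 2 * β / ρ := by ring
    rw [neg_div] at e1
    linarith
  have hQ : |B / t - max (B / t - β * m) 0| ≤ β := by
    have := abs_max_sub_max_le_abs (B / t) (B / t - β * m) 0
    rw [max_eq_left hU0.le] at this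
    refine this.trans ?_
    rw [show B / t - (B / t - β * m) = β * m by ring, abs_mul, abs_of_pos hβ]
    exact mul_le_of_le_one_right hβ.le hm
  rw [max_eq_left hU0.le] at key
  refine slope_bound_arith hM hU0 (U₁ := B / t₂) (by gcongr) hQ hβ1.le hρ (by linarith)
    (t := t) (η := η) ?_ ht0 (hd.trans hηd) (c := c) ?_ hc0
    (abs_cutOp_le hρ (bF.slice t) (bF.bdd t) x) hgain hρc hβc hβc' key
  · rw [div_pow, div_mul_eq_mul_div, le_div_iff₀ (by positivity)]
    have h1 : t ≤ T := ht.2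
    calc 4 * M * t ^ 2 = 4 * M * t * t := by ring
      _ ≤ 4 * M * T * t := by gcongr
      _ ≤ B ^ 2 * t := by gcongr
  · rw [hcdef, div_mul_eq_mul_div, div_div, ← sq]
    have h1 : t ≤ T := ht.2
    gcongr
    exact mul_nonneg hB.le hη.1

theorem gain_of_max {f : ℝ → ℝ} (hf : Continuous f) {M : ℝ} (hM : ∀ x, |f x| ≤ M)
    {x y N ρ₁ C₁ p δ E R ρ : ℝ} (hC₁ : 0 ≤ C₁) (hN : N * ρ₁ ^ 2 = C₁) (hρ₁ : 0 < ρ₁) (hxy : x < y)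
    (hx : |x| ≤ ρ₁) (hy : |y| ≤ ρ₁) (hδ : 0 < δ) (hE : 0 < E) (hR : R = 2 * E / δ)
    (hRρ : R ≤ ρ₁) (hρ : 0 < ρ) (hρR : ρ ≤ R)
    (hslope : ∀ u v, u ≤ v → f v - f u ≤ C₁ * (v - u))
    (hwin : ∀ u v, |u| ≤ 2 * ρ₁ → |v| ≤ 2 * ρ₁ → f v - f u ≤ p * (v - u) + 2 * E)
    (hrise : (p + δ) * (y - x) ≤ f y - f x) (hpos : 0 ≤ f y - f x)
    (hmax : ∀ z, |z| ≤ ρ₁ → f (y + z) - f (x + z) ≤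
      f y - f x + N * ((y + z) ^ 3 - (x + z) ^ 3 - (y ^ 3 - x ^ 3)) / 3) :
    (y - x) * (δ ^ 2 / (2 * E) - 6 * C₁ / ρ₁) - ρ * (8 * M) / R ^ 2 ≤
      cutOp ρ f y - cutOp ρ f x := by
  have hη : 0 < y - x := sub_pos.2 hxy
  have hR0 : 0 < R := by rw [hR]; positivity
  have hN0 : 0 ≤ N := by
    rw [← eq_div_iff (by positivity)] at hN
    rw [hN]; positivity
  have hk1 := continuous_second_diff hf y
  have hk2 := continuous_second_diff hf x
  have hkb1 := abs_second_diff_le hM y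
  have hkb2 := abs_second_diff_le hM x
  have hk : Continuous fun z => (2 * f y - f (y + z) - f (y - z)) -
      (2 * f x - f (x + z) - f (x - z)) := hk1.sub hk2
  have hkb : ∀ z, |(2 * f y - f (y + z) - f (y - z)) -
      (2 * f x - f (x + z) - f (x - z))| ≤ 8 * M := fun z =>
    (abs_sub _ _).trans (by linarith [hkb1 z, hkb2 z])
  have hlow : ∀ z, 0 < z → z ≤ ρ₁ → -0 - 2 * N * (y - x) * z ^ 2 ≤
      (2 * f y - f (y + z) - f (y - z)) - (2 * f x - f (x + z) - f (x - z)) := fun z h1 h2 => by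
    have h3 := hmax z (by rwa [abs_of_pos h1])
    have h4 := hmax (-z) (by rwa [abs_neg, abs_of_pos h1])
    rw [← sub_eq_add_neg, ← sub_eq_add_neg] at h4
    have : N * ((y + z) ^ 3 - (x + z) ^ 3 - (y ^ 3 - x ^ 3)) / 3
      + N * ((y - z) ^ 3 - (x - z) ^ 3 - (y ^ 3 - x ^ 3)) / 3 = 2 * N * (y - x) * z ^ 2 := by ring
    linarith
  have hlow' : ∀ z, ρ₁ < z → -(2 * C₁ * (y - x)) ≤
      (2 * f y - f (y + z) - f (y - z)) - (2 * f x - f (x + z) - f (x - z)) := fun z _ => by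
    have h3 := hslope (x + z) (y + z) (by linarith)
    have h4 := hslope (x - z) (y - z) (by linarith)
    rw [show y + z - (x + z) = y - x by ring] at h3
    rw [show y - z - (x - z) = y - x by ring] at h4
    linarith
  have hx' := abs_le.1 hx
  have hy' := abs_le.1 hy
  have hmid := gain_le_integral_mid hf (x := x) (y := y) (A := p * (2 * R) + 2 * E)
    (K := 8 * M) (e₀ := 0) (e₂ := 2 * N * (y - x)) hρ hρR hxy.le
    (fun w h1 h2 => by
      have := hwin (w - R) (w + R) (abs_le.2 ⟨by linarith, by linarith⟩)
        (abs_le.2 ⟨by linarith, by linarith⟩)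
      rwa [show w + R - (w - R) = 2 * R by ring] at this) le_rfl (by positivity) rfl
    (fun z _ _ => (abs_le.1 (hkb z)).2) (fun z h1 h2 => hlow z (hρ.trans h1) (h2.trans hRρ))
  have hmid2 := le_integral_mid (r := R) (R := ρ₁) hR0 hRρ hk (b := 0)
    (c := 2 * N * (y - x)) (by positivity) (fun z h1 h2 => hlow z (hR0.trans h1) h2) le_rfl
  have htail := le_tailInt hρ₁ hk hkb hlow'
  have hs1 := tailInt_split hρ hρR hk hkb
  have hs2 := tailInt_split hR0 hRρ hk hkb
  have hsub := tailInt_sub hρ hk1 hkb1 hk2 hkb2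
  unfold cutOp
  rw [← hsub, hs1, hs2]
  have e1 : (y - x) * (δ ^ 2 / (2 * E)) - ρ * (8 * M) / R ^ 2 ≤
      (2 * R * (f y - f x) - (y - x) * (p * (2 * R) + 2 * E) - ρ * (8 * M)) / R ^ 2 := by
    rw [sub_div _ (ρ * (8 * M))]
    refine sub_le_sub_right ?_ _
    rw [le_div_iff₀ (by positivity)]
    have h1 : 2 * R * ((p + δ) * (y - x)) ≤ 2 * R * (f y - f x) := by gcongr
    have h2 : R * δ = 2 * E := by rw [hR]; field_simp
    have h3 : (y - x) * (δ ^ 2 / (2 * E)) * R ^ 2 = (y - x) * (2 * E) := by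
      rw [hR]; field_simp
    have h4 : 2 * R * ((p + δ) * (y - x)) =
      (y - x) * (p * (2 * R)) + 2 * (y - x) * (R * δ) := by ring
    rw [h2] at h4
    linarith
  have e2 : 2 * N * (y - x) * R ≤ 2 * N * (y - x) * ρ₁ := by gcongr
  have e3 : 2 * N * (y - x) * ρ₁ = 2 * C₁ * (y - x) / ρ₁ := by
    rw [← hN]; field_simp
  have e4 : (y - x) * (6 * C₁ / ρ₁) = 3 * (2 * C₁ * (y - x) / ρ₁) := by ring
  rw [neg_div] at htail
  rw [zero_div] at hmid hmid2
  linarith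

theorem flux_diff_lower_bound {u v Iy Ix p L s g W : ℝ} (hp : 0 < p) (hL : 0 ≤ L) (hu : p ≤ u)
    (hv : p ≤ v) (hs : 0 ≤ s) (hIy : u * (Iy - s) ≤ L) (hIx : 0 ≤ L + v * (Ix + s))
    (hW : |u - v| ≤ W) (hg : 0 ≤ g) (hgain : g ≤ Iy - Ix) :
    p * g - W * (L / p + s) ≤ u * Iy - v * Ix := by
  have hW0 : 0 ≤ W := (abs_nonneg _).trans hW
  have hLp : 0 ≤ L / p + s := by positivity
  have hu0 : 0 ≤ u := hp.le.trans hu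
  have hv0 : 0 ≤ v := hp.le.trans hv
  rcases le_total v u with h | h
  · have h1 : -(L / p + s) ≤ Ix := by
      have : -(Ix + s) ≤ L / p := by
        rw [le_div_iff₀ hp]
        rcases le_total 0 (Ix + s) with h' | h'
        · nlinarith
        · nlinarith
      linarith
    rw [abs_of_nonneg (by linarith)] at hW
    have h2 : p * g ≤ u * (Iy - Ix) := by gcongr
    have h3 : (u - v) * (-(L / p + s)) ≤ (u - v) * Ix := by
      apply mul_le_mul_of_nonneg_left h1; linarith
    have h4 : (u - v) * (L / p + s) ≤ W * (L / p + s) := by gcongr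
    linarith
  · have h1 : Iy ≤ L / p + s := by
      have : Iy - s ≤ L / p := by
        rw [le_div_iff₀ hp]
        rcases le_total 0 (Iy - s) with h' | h'
        · nlinarith
        · nlinarith
      linarith
    rw [abs_sub_comm, abs_of_nonneg (by linarith)] at hW
    have h2 : p * g ≤ v * (Iy - Ix) := by gcongr
    have h3 : (v - u) * Iy ≤ (v - u) * (L / p + s) := by
      apply mul_le_mul_of_nonneg_left h1; linarith
    have h4 : (v - u) * (L / p + s) ≤ W * (L / p + s) := by gcongr
    linarith

theorem cube_expansion_le {N ρ₁ y z : ℝ} (hN : 0 ≤ N) (hy : |y| ≤ ρ₁) (hz : |z| ≤ ρ₁) :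
    N * ((y + z) ^ 3 - y ^ 3) / 3 ≤ N * y ^ 2 * z + 2 * N * ρ₁ * z ^ 2 ∧
    N * y ^ 2 * z - 2 * N * ρ₁ * z ^ 2 ≤ N * ((y + z) ^ 3 - y ^ 3) / 3 := by
  have e : N * ((y + z) ^ 3 - y ^ 3) / 3 = N * y ^ 2 * z + N * z ^ 2 * (y + z / 3) := by ring
  have h1 := abs_le.1 hy
  have h2 := abs_le.1 hz
  have h3 : 0 ≤ N * z ^ 2 := by positivity
  rw [e]
  have h4 := mul_le_mul_of_nonneg_left (show y + z / 3 ≤ 2 * ρ₁ by linarith) h3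
  have h5 := mul_le_mul_of_nonneg_left (show -(2 * ρ₁) ≤ y + z / 3 by linarith) h3
  constructor <;> linarith

set_option maxHeartbeats 1000000 in
theorem PastSub.no_steep_max {T M L τ t : ℝ} {F : ℝ → ℝ → ℝ} (hF : PastSub T F)
    (hF' : PastSub T (dual F)) (bF : BddUC M F) (htT : t ≤ T) (hτ : 0 < τ) (hτt : τ ≤ t)
    (hL : 0 ≤ L) (hlip : ∀ s x, t - τ ≤ s → s ≤ t → |F s x - F t x| ≤ L * (t - s))
    {g : ℝ → ℝ} {D : ℝ} (hg : HasDerivAt g D t)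
    {x y N ρ₁ C₁ p E e : ℝ} (hC₁ : 0 ≤ C₁) (hN : N * ρ₁ ^ 2 = C₁) (hρ₁ : 0 < ρ₁) (hxy : x < y)
    (hx : |x| ≤ ρ₁) (hy : |y| ≤ ρ₁) (hp : 0 < p) (hδ : 0 < g t) (hE : 0 < E)
    (hRρ : 2 * E / g t ≤ ρ₁)
    (hslope : ∀ u v, u ≤ v → F t v - F t u ≤ C₁ * (v - u))
    (hwin : ∀ u v, |u| ≤ 2 * ρ₁ → |v| ≤ 2 * ρ₁ → F t v - F t u ≤ p * (v - u) + 2 * E)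
    (hrise : (p + g t) * (y - x) + N * (y ^ 3 - x ^ 3) / 3 ≤ F t y - F t x)
    (hmax : ∀ s z w, t - τ ≤ s → s ≤ t → |z| ≤ ρ₁ → |w| ≤ ρ₁ → x + w ≤ y + z →
      F s (y + z) - F s (x + w)
        - ((p + g s) * (y + z - (x + w)) + N * ((y + z) ^ 3 - (x + w) ^ 3) / 3) ≤
      F t y - F t x - ((p + g t) * (y - x) + N * (y ^ 3 - x ^ 3) / 3))
    (hG : 0 < g t ^ 2 / (2 * E) - 6 * C₁ / ρ₁) (he : 0 < e)
    (hfin : 0 < D - e + p * (g t ^ 2 / (2 * E) - 6 * C₁ / ρ₁) - 2 * C₁ / ρ₁ * (L / p)) :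
    False := by
  obtain ⟨δ, hδdef⟩ : ∃ δ, δ = g t := ⟨_, rfl⟩
  obtain ⟨G, hGdef⟩ : ∃ G, G = g t ^ 2 / (2 * E) - 6 * C₁ / ρ₁ := ⟨_, rfl⟩
  obtain ⟨η, hηdef⟩ : ∃ η, η = y - x := ⟨_, rfl⟩
  have hη : 0 < η := by linarith
  have hN0 : 0 ≤ N := by
    rw [← eq_div_iff (by positivity)] at hN
    rw [hN]; positivity
  have hcube : 0 ≤ N * (y ^ 3 - x ^ 3) / 3 := by
    have : 0 ≤ y ^ 3 - x ^ 3 := by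
      have : y ^ 3 - x ^ 3 = (y - x) * ((y + x / 2) ^ 2 + 3 / 4 * x ^ 2) := by ring
      rw [this]; positivity
    positivity
  have hR0 : 0 < 2 * E / g t := by positivity
  -- the time derivative of `g` controls it on a short past interval
  obtain ⟨τ₁, hτ₁, hgτ⟩ : ∃ τ₁ > 0, ∀ s, t - τ₁ ≤ s → s ≤ t →
      |g s - g t - D * (s - t)| ≤ e * (t - s) := by
    have h1 := (hasDerivAt_iff_isLittleO.1 hg).def he
    obtain ⟨τ₁, hτ₁, h2⟩ := Metric.eventually_nhds_iff.1 h1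
    refine ⟨τ₁ / 2, half_pos hτ₁, fun s h3 h4 => ?_⟩
    have := h2 (y := s) (by rw [Real.dist_eq, abs_of_nonpos (by linarith)]; linarith)
    simp only [Real.norm_eq_abs, smul_eq_mul] at this
    rw [abs_of_nonpos (show s - t ≤ 0 by linarith), mul_comm (s - t)] at this
    simpa using this
  obtain ⟨u, hu⟩ : ∃ u, u = p + δ + N * y ^ 2 := ⟨_, rfl⟩
  obtain ⟨v, hv⟩ : ∃ v, v = p + δ + N * x ^ 2 := ⟨_, rfl⟩
  have hpu : p ≤ u := by
    have : 0 ≤ N * y ^ 2 := by positivity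
    linarith
  have hpv : p ≤ v := by
    have : 0 ≤ N * x ^ 2 := by positivity
    linarith
  obtain ⟨C, hC⟩ : ∃ C, C = 2 * N * ρ₁ := ⟨_, rfl⟩
  have hC0 : 0 ≤ C := by rw [hC]; positivity
  have huv : |u - v| ≤ 2 * C₁ / ρ₁ * η := by
    have h1 : u - v = N * (y + x) * η := by rw [hu, hv, hηdef]; ring
    have h2 : 2 * C₁ / ρ₁ = N * (2 * ρ₁) := by rw [← hN]; field_simp
    rw [h1, h2, abs_mul, abs_mul, abs_of_nonneg hN0, abs_of_pos hη]
    gcongr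
    exact (abs_add_le _ _).trans (by linarith)
  obtain ⟨r, hr⟩ : ∃ r, r = min ρ₁ (η / 2) := ⟨_, rfl⟩
  have hr0 : 0 < r := by rw [hr]; exact lt_min hρ₁ (half_pos hη)
  have hr1 : r ≤ ρ₁ := by rw [hr]; exact min_le_left _ _
  have hr2 : r ≤ η / 2 := by rw [hr]; exact min_le_right _ _
  have single : ∀ ρ, 0 < ρ → ρ < r → u * (cutOp ρ (F t) y - 2 * C * ρ) ≤ L ∧
      0 ≤ L + v * (cutOp ρ (F t) x + 2 * C * ρ) := by
    intro ρ hρ hρρ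
    constructor
    · have := hF t y (-L) u C τ r ρ (hτ.trans_le hτt) htT hτ hτt hC0 hρ hρρ
        (fun s z h1 h2 h3 => by
          have h4 := (abs_le.1 (hlip s (y + z) h1 h2)).2
          have h5 := hmax t z 0 (by linarith) le_rfl (h3.trans hr1)
            (by rw [abs_zero]; exact hρ₁.le) (by linarith [(abs_le.1 h3).1])
          have h6 := (cube_expansion_le hN0 hy (h3.trans hr1)).1
          rw [← hC] at h6
          rw [← hδdef] at h5
          rw [hu]
          simp only [add_zero] at h5
          linarith)
      rw [max_eq_left (by linarith)] at this
      linarith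
    · have := hF'.super (t₀ := t) (x₀ := x) (a := L) (p := v) (C := C) (τ := τ) (r := r)
        (hτ.trans_le hτt) htT hτ hτt hC0 hρ hρρ
        (fun s z h1 h2 h3 => by
          have h4 := (abs_le.1 (hlip s (x + z) h1 h2)).1
          have h5 := hmax t 0 z (by linarith) le_rfl (by rw [abs_zero]; exact hρ₁.le)
            (h3.trans hr1) (by linarith [(abs_le.1 h3).2])
          have h6 := (cube_expansion_le hN0 hx (h3.trans hr1)).2
          rw [← hC] at h6
          rw [← hδdef] at h5
          rw [hv]
          simp only [add_zero] at h5
          linarith)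
      rwa [max_eq_left (by linarith)] at this
  have double : ∀ ρ, 0 < ρ → ρ < r → (D - e) * η + u * (cutOp ρ (F t) y - 2 * C * ρ) -
      v * (cutOp ρ (F t) x + 2 * C * ρ) ≤ 0 := by
    intro ρ hρ hρρ
    have := hF.two_point_coupled hF' bF bF (t₀ := t) (y₀ := y) (x₀ := x) (a := (D - e) * η)
      (p := u) (q := v) (C := C) (A := |D| + e) (τ := min τ τ₁) (r := r) (ρ := ρ) htT
      (lt_min hτ hτ₁) ((min_le_left _ _).trans hτt) hC0 (by positivity) hρ hρρ
      (fun s z w h1 h2 h3 h4 => by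
        have h5 := hmax s z w (by linarith [min_le_left τ τ₁]) h2 (h3.trans hr1) (h4.trans hr1)
          (by linarith [(abs_le.1 h3).1, (abs_le.1 h4).2])
        have h6 := hgτ s (by linarith [min_le_right τ τ₁]) h2
        have h7 := (cube_expansion_le hN0 hy (h3.trans hr1)).1
        have h8 := (cube_expansion_le hN0 hx (h4.trans hr1)).2
        have h9 : (g s - g t) * η ≤ (D - e) * η * (s - t) := by
          have := mul_le_mul_of_nonneg_right (abs_le.1 h6).2 hη.le
          linarith
        have h10 : |g s - g t| ≤ (|D| + e) * |s - t| := by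
          have h11 : |g s - g t| ≤ |g s - g t - D * (s - t)| + |D * (s - t)| := by
            have := abs_add_le (g s - g t - D * (s - t)) (D * (s - t))
            rwa [sub_add_cancel] at this
          rw [abs_mul] at h11
          have : |s - t| = t - s := by rw [abs_of_nonpos (by linarith)]; ring
          rw [this] at h11 ⊢
          linarith
        have h12 : (g s - g t) * (z - w) ≤ (|D| + e) * |s - t| * (|z| + |w|) := by
          calc (g s - g t) * (z - w) ≤ |g s - g t| * |z - w| := by
                rw [← abs_mul]; exact le_abs_self _
            _ ≤ _ := by
              gcongr
              exact abs_sub _ _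
        have h13 : 0 ≤ (|D| + e) * (s - t) ^ 2 := by positivity
        rw [← hC] at h7 h8
        have h14 : (p + g s) * (y + z - (x + w)) = (p + g t) * (y - x) + (g s - g t) * η
          + (g s - g t) * (z - w) + (p + g t) * z - (p + g t) * w := by rw [hηdef]; ring
        rw [hu, hv, hδdef]
        linarith)
    rwa [max_eq_left (by linarith), max_eq_left (by linarith)] at this
  have gain : ∀ ρ, 0 < ρ → ρ ≤ 2 * E / g t → η * G - ρ * (8 * M) / (2 * E / g t) ^ 2 ≤
      cutOp ρ (F t) y - cutOp ρ (F t) x := by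
    intro ρ hρ hρR
    have hr : (p + g t) * (y - x) ≤ F t y - F t x := by linarith
    rw [hηdef, hGdef]
    exact gain_of_max (bF.slice t) (bF.bdd t) hC₁ hN hρ₁ hxy hx hy hδ hE rfl hRρ hρ hρR hslope
      hwin hr (le_trans (by rw [← hηdef]; positivity) hr) (fun z hz => by
        have := hmax t z z (by linarith) le_rfl hz hz (by linarith)
        rw [show y + z - (x + z) = y - x by ring] at this
        linarith)
  rw [← hGdef] at hG hfin
  obtain ⟨k, hk⟩ : ∃ k, k = 8 * M / (2 * E / g t) ^ 2 := ⟨_, rfl⟩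
  obtain ⟨W, hW⟩ : ∃ W, W = 2 * C₁ / ρ₁ := ⟨_, rfl⟩
  rw [← hW] at huv hfin
  have hfin' := mul_pos hη hfin
  obtain ⟨ρ, hρ, hρρ, hρR, hρG, hρf⟩ := (eventually_pos.and ((eventually_small hr0).and
    ((eventually_small hR0).and ((eventually_small_mul k (mul_pos hη hG)).and
    (eventually_small_mul (p * k + W * η * (2 * C) + 2 * C * (u + v)) hfin'))))).exists
  obtain ⟨s1, s2⟩ := single ρ hρ hρρ
  have gg := gain ρ hρ hρR.le
  rw [show ρ * (8 * M) / (2 * E / g t) ^ 2 = k * ρ by rw [hk]; ring] at gg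
  have fl := flux_diff_lower_bound hp hL hpu hpv (by positivity) s1 s2 huv (by linarith) gg
  have db := double ρ hρ hρρ
  linarith

theorem hasDerivAt_slope_profile {c Λ s₀ t : ℝ} (ht : t < s₀) (h : 0 < Λ - Real.log (s₀ - t)) :
    HasDerivAt (fun t => c / (Λ - Real.log (s₀ - t)))
      (-(c / ((Λ - Real.log (s₀ - t)) ^ 2 * (s₀ - t)))) t := by
  have h1 : HasDerivAt (fun t => s₀ - t) (-1) t := by
    simpa using (hasDerivAt_id t).const_sub s₀
  have h2 : HasDerivAt (fun t => Λ - Real.log (s₀ - t)) (-(-1 / (s₀ - t))) t :=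
    (h1.log (by linarith)).const_sub Λ
  refine ((hasDerivAt_const t c).div h2 h.ne').congr_deriv ?_
  rw [neg_div (s₀ - t) 1, neg_neg, zero_mul, zero_sub, mul_one_div, neg_div, div_div,
    mul_comm (s₀ - t)]

theorem exists_si_parameters {p L C₁ δ K : ℝ} (hp : 0 < p) (hL : 0 < L) (hC₁ : 0 < C₁)
    (hδ : 0 < δ) :
    ∃ c Q δ₁ ρ₁ : ℝ, C₁ ≤ c ∧ 6 * L / p ≤ c ∧ 1 < Q ∧ 0 < δ₁ ∧ δ₁ = c / (1 + Real.log Q) ∧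
      δ₁ ≤ δ / 2 ∧ 0 < ρ₁ ∧ K ≤ ρ₁ ∧ C₁ / ρ₁ ^ 2 * K ^ 2 ≤ δ / 2 ∧ 3 * L * Q / δ₁ ≤ ρ₁ ∧
      (6 * p * C₁ + 2 * C₁ * (L / p)) / ρ₁ ≤ p * δ₁ ^ 2 / (6 * L * Q) / 4 := by
  obtain ⟨c, hc⟩ : ∃ c, c = C₁ + 6 * L / p := ⟨_, rfl⟩
  have hc0 : 0 < c := by rw [hc]; positivity
  obtain ⟨Q, hQ⟩ : ∃ Q, Q = Real.exp (2 * c / δ) := ⟨_, rfl⟩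
  have hQ1 : 1 < Q := by rw [hQ]; exact Real.one_lt_exp_iff.2 (by positivity)
  have hlog : Real.log Q = 2 * c / δ := by rw [hQ, Real.log_exp]
  obtain ⟨δ₁, hδ₁⟩ : ∃ δ₁, δ₁ = c / (1 + Real.log Q) := ⟨_, rfl⟩
  have hδ₁0 : 0 < δ₁ := by rw [hδ₁, hlog]; positivity
  have hκ : 0 < p * δ₁ ^ 2 / (6 * L * Q) / 4 := by positivity
  have t1 : Tendsto (fun ρ : ℝ => C₁ / ρ ^ 2 * K ^ 2) atTop (𝓝 (0 * K ^ 2)) :=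
    ((tendsto_const_nhds (x := C₁)).div_atTop (tendsto_pow_atTop two_ne_zero)).mul_const _
  have t2 : Tendsto (fun ρ : ℝ => (6 * p * C₁ + 2 * C₁ * (L / p)) / ρ) atTop (𝓝 0) :=
    tendsto_const_nhds.div_atTop tendsto_id
  rw [zero_mul] at t1
  obtain ⟨ρ₁, h1, h2, h3, h4, h5⟩ := ((t1.eventually (ge_mem_nhds (half_pos hδ))).and
    ((t2.eventually (ge_mem_nhds hκ)).and ((eventually_ge_atTop K).and
    ((eventually_ge_atTop (3 * L * Q / δ₁)).and (eventually_gt_atTop 0))))).exists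
  refine ⟨c, Q, δ₁, ρ₁, ?_, ?_, hQ1, hδ₁0, hδ₁, ?_, h5, h3, h1, h4, h2⟩
  · rw [hc]; have : 0 < 6 * L / p := by positivity
    linarith
  · rw [hc]; linarith
  · rw [hδ₁, hlog, div_le_iff₀ (by positivity)]
    have : δ / 2 * (1 + 2 * c / δ) = δ / 2 + c := by field_simp
    linarith

set_option maxHeartbeats 1000000 in
/-- Slopes at an earlier time are controlled by an almost linear profile at the final time. -/
theorem exists_slope_improvement {p L C₁ δ K : ℝ} (hp : 0 < p) (hL : 0 < L) (hC₁ : 0 < C₁)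
    (hδ : 0 < δ) :
    ∃ Q > 1, ∃ K₃ > 0, ∃ ζ > 0, ∀ (T M s₀ : ℝ) (F : ℝ → ℝ → ℝ), PastSub T F →
      PastSub T (dual F) → BddUC M F → s₀ ≤ T → Q < s₀ →
      (∀ s t x, s₀ - Q ≤ s → s ≤ t → t ≤ s₀ → |F s x - F t x| ≤ L * (t - s)) →
      (∀ t x y, s₀ - Q ≤ t → t ≤ s₀ → x ≤ y → F t y - F t x ≤ C₁ * (y - x)) →
      (∀ y, |y| ≤ K₃ → |F s₀ y - F s₀ 0 - p * y| ≤ ζ) →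
      ∀ y, 0 ≤ y → y ≤ K → F (s₀ - 1) y - F (s₀ - 1) 0 ≤ (p + δ) * y := by
  obtain ⟨c, Q, δ₁, ρ₁, hcC, hcL, hQ, hδ₁, hδ₁def, hδ₁δ, hρ₁, hKρ, hNK, hRρ, hκ⟩ :=
    exists_si_parameters (K := K) hp hL hC₁ hδ
  refine ⟨Q, hQ, 2 * ρ₁, by positivity, L / 2, by positivity, ?_⟩
  intro T M s₀ F hF hF' bF hsT hQs hlip hslope hflat y₁ hy₁ hy₁K
  by_contra! hlt
  have hc0 : 0 < c := hC₁.trans_le hcC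
  obtain ⟨N, hNdef⟩ : ∃ N, N = C₁ / ρ₁ ^ 2 := ⟨_, rfl⟩
  have hN0 : 0 < N := by rw [hNdef]; positivity
  have hN : N * ρ₁ ^ 2 = C₁ := by rw [hNdef]; field_simp
  rw [← hNdef] at hNK
  obtain ⟨g, hg⟩ : ∃ g : ℝ → ℝ, g = fun t => c / (1 + Real.log Q - Real.log (s₀ - t)) := ⟨_, rfl⟩
  have hlogQ : 0 < Real.log Q := Real.log_pos hQ
  have hden : ∀ t, s₀ - Q ≤ t → t ≤ s₀ - 1 → 1 ≤ 1 + Real.log Q - Real.log (s₀ - t) ∧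
      1 + Real.log Q - Real.log (s₀ - t) ≤ 1 + Real.log Q := fun t h1 h2 => by
    have h3 := Real.log_le_log (show 0 < s₀ - t by linarith) (show s₀ - t ≤ Q by linarith)
    have h4 := Real.log_nonneg (show 1 ≤ s₀ - t by linarith)
    constructor <;> linarith
  have hgδ : ∀ t, s₀ - Q ≤ t → t ≤ s₀ - 1 → δ₁ ≤ g t := fun t h1 h2 => by
    obtain ⟨h3, h4⟩ := hden t h1 h2
    rw [hδ₁def, hg]
    exact div_le_div_of_nonneg_left hc0.le (by linarith) h4
  have hgc : ContinuousOn g (Icc (s₀ - Q) (s₀ - 1)) := by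
    intro t ht
    rw [hg]
    exact (hasDerivAt_slope_profile (by linarith [ht.2])
      (by linarith [(hden t ht.1 ht.2).1])).continuousAt.continuousWithinAt
  obtain ⟨Ψ, hΨ⟩ : ∃ Ψ : ℝ × ℝ × ℝ → ℝ, Ψ = fun w => F w.1 w.2.2 - F w.1 w.2.1
      - ((p + g w.1) * (w.2.2 - w.2.1) + N * (w.2.2 ^ 3 - w.2.1 ^ 3) / 3) := ⟨_, rfl⟩
  obtain ⟨S, hS⟩ : ∃ S : Set (ℝ × ℝ × ℝ), S = (Icc (s₀ - Q) (s₀ - 1) ×ˢ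
      (Icc (-(2 * ρ₁)) (2 * ρ₁) ×ˢ Icc (-(2 * ρ₁)) (2 * ρ₁))) ∩ {w | w.2.1 ≤ w.2.2} := ⟨_, rfl⟩
  have hScomp : IsCompact S := by
    rw [hS]
    exact (isCompact_Icc.prod (isCompact_Icc.prod isCompact_Icc)).inter_right
      (isClosed_le (by fun_prop) (by fun_prop))
  have hΨc : ContinuousOn Ψ S := by
    have h1 : ContinuousOn (fun w : ℝ × ℝ × ℝ => g w.1) S :=
      hgc.comp continuous_fst.continuousOn (fun w hw => by rw [hS] at hw; exact hw.1.1)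
    have h2 : Continuous fun w : ℝ × ℝ × ℝ => F w.1 w.2.2 := bF.comp (by fun_prop) (by fun_prop)
    have h3 : Continuous fun w : ℝ × ℝ × ℝ => F w.1 w.2.1 := bF.comp (by fun_prop) (by fun_prop)
    rw [hΨ]
    exact (h2.continuousOn.sub h3.continuousOn).sub
      (((continuousOn_const.add h1).mul (by fun_prop)).add (by fun_prop))
  have hmem : (s₀ - 1, (0 : ℝ), y₁) ∈ S := by
    rw [hS]
    exact ⟨⟨⟨by linarith, le_rfl⟩, ⟨by linarith, by linarith⟩, ⟨by linarith, by linarith⟩⟩, hy₁⟩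
  obtain ⟨⟨t, x, y⟩, hw, hwmax⟩ := hScomp.exists_isMaxOn ⟨_, hmem⟩ hΨc
  have hpos : 0 < Ψ (t, x, y) := by
    refine lt_of_lt_of_le ?_ (hwmax hmem)
    have h1 : g (s₀ - 1) = δ₁ := by rw [hg, hδ₁def]; simp
    have h2 : N * y₁ ^ 3 / 3 ≤ δ / 2 * y₁ := by
      have h4 : N * y₁ ^ 2 ≤ δ / 2 := le_trans (by gcongr) hNK
      have h5 := mul_le_mul_of_nonneg_right h4 hy₁
      have h6 : 0 ≤ N * y₁ ^ 3 := by positivity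
      linarith
    have h3 := mul_le_mul_of_nonneg_right hδ₁δ hy₁
    rw [hΨ]
    simp only [h1]
    linarith
  have hw' : ((s₀ - Q ≤ t ∧ t ≤ s₀ - 1) ∧ (-(2 * ρ₁) ≤ x ∧ x ≤ 2 * ρ₁) ∧
      (-(2 * ρ₁) ≤ y ∧ y ≤ 2 * ρ₁)) ∧ x ≤ y := by rw [hS] at hw; exact hw
  obtain ⟨⟨⟨ht1, ht2⟩, ⟨hx1, hx2⟩, hy1, hy2⟩, hxy'⟩ := hw'
  have hmax : ∀ s x' y', s₀ - Q ≤ s → s ≤ s₀ - 1 → |x'| ≤ 2 * ρ₁ → |y'| ≤ 2 * ρ₁ → x' ≤ y' →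
      F s y' - F s x' - ((p + g s) * (y' - x') + N * (y' ^ 3 - x' ^ 3) / 3) ≤
      F t y - F t x - ((p + g t) * (y - x) + N * (y ^ 3 - x ^ 3) / 3) := by
    intro s x' y' h1 h2 h3 h4 h5
    have : (s, x', y') ∈ S := by
      rw [hS]
      exact ⟨⟨⟨h1, h2⟩, abs_le.1 h3, abs_le.1 h4⟩, h5⟩
    have := hwmax this
    rw [hΨ] at this
    exact this
  rw [hΨ] at hpos
  simp only at hpos
  have hxy : x < y := by
    refine lt_of_le_of_ne hxy' fun h => ?_
    rw [h] at hpos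
    simp at hpos
  have hgt := hgδ t ht1 ht2
  have hgt0 : 0 < g t := hδ₁.trans_le hgt
  have cube_nonneg : ∀ a b : ℝ, a ≤ b → 0 ≤ N * (b ^ 3 - a ^ 3) / 3 := fun a b h => by
    have h1 : b ^ 3 - a ^ 3 = (b - a) * ((b + a / 2) ^ 2 + 3 / 4 * a ^ 2) := by ring
    have h2 : 0 ≤ b - a := sub_nonneg.2 h
    have h3 : 0 ≤ b ^ 3 - a ^ 3 := by rw [h1]; positivity
    positivity
  have htQ : s₀ - Q < t := by
    refine lt_of_le_of_ne ht1 fun h => ?_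
    have h1 : g t = c := by
      rw [hg, ← h]
      simp
    have h2 := hslope t x y ht1 (by linarith) hxy'
    have h3 := cube_nonneg x y hxy'
    have h4 : C₁ * (y - x) ≤ (p + g t) * (y - x) := by
      gcongr
      linarith
    linarith
  -- outside `[-ρ₁, ρ₁]` the profile is steeper than `C₁`
  have steep : ∀ a b : ℝ, a < b → (ρ₁ ≤ a ∨ b ≤ -ρ₁) →
      F t b - F t a < (p + g t) * (b - a) + N * (b ^ 3 - a ^ 3) / 3 := by
    intro a b hab h
    have h1 := hslope t a b ht1 (by linarith) hab.le
    have h2 : 3 * ρ₁ ^ 2 ≤ b ^ 2 + a * b + a ^ 2 := by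
      rcases h with h | h
      · nlinarith
      · nlinarith
    have h3 : N * (b ^ 3 - a ^ 3) / 3 = (b - a) * (N * (b ^ 2 + a * b + a ^ 2) / 3) := by ring
    have h4 : (b - a) * C₁ ≤ (b - a) * (N * (b ^ 2 + a * b + a ^ 2) / 3) := by
      gcongr
      rw [← hN]
      have := mul_le_mul_of_nonneg_left h2 hN0.le
      linarith
    have h5 : 0 < (p + g t) * (b - a) := mul_pos (by linarith) (by linarith)
    linarith
  have hyρ : y ≤ ρ₁ := by
    by_contra! h
    have h1 := steep (max x ρ₁) y (max_lt hxy h) (Or.inl (le_max_right _ _))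
    have h2 := hmax t x (max x ρ₁) ht1 ht2 (abs_le.2 ⟨hx1, hx2⟩)
      (abs_le.2 ⟨by linarith [le_max_right x ρ₁], by
        rcases max_cases x ρ₁ with h | h <;> linarith⟩) (le_max_left _ _)
    linarith
  have hxρ : -ρ₁ ≤ x := by
    by_contra! h
    have h1 := steep x (min y (-ρ₁)) (lt_min hxy h) (Or.inr (min_le_right _ _))
    have h2 := hmax t (min y (-ρ₁)) y ht1 ht2
      (abs_le.2 ⟨by rcases min_cases y (-ρ₁) with h | h <;> linarith,
        by linarith [min_le_right y (-ρ₁)]⟩)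
      (abs_le.2 ⟨hy1, hy2⟩) (min_le_left _ _)
    linarith
  have habx : |x| ≤ ρ₁ := abs_le.2 ⟨hxρ, by linarith⟩
  have haby : |y| ≤ ρ₁ := abs_le.2 ⟨by linarith, hyρ⟩
  have hΔ1 : 1 ≤ s₀ - t := by linarith
  have hΔQ : s₀ - t ≤ Q := by linarith
  obtain ⟨κ, hκdef⟩ : ∃ κ, κ = p * δ₁ ^ 2 / (6 * L * Q) := ⟨_, rfl⟩
  rw [← hκdef] at hκ
  have hκ0 : 0 < κ := by rw [hκdef]; positivity
  obtain ⟨E, hE⟩ : ∃ E, E = L * (s₀ - t) + L / 2 := ⟨_, rfl⟩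
  have hE0 : 0 < E := by rw [hE]; positivity
  have hE1 : 2 * E ≤ 3 * L * (s₀ - t) := by
    rw [hE]
    have := mul_le_mul_of_nonneg_left hΔ1 hL.le
    linarith
  obtain ⟨κ', hκ'⟩ : ∃ κ', κ' = p * g t ^ 2 / (6 * L * (s₀ - t)) := ⟨_, rfl⟩
  have hκκ : κ ≤ κ' := by
    rw [hκdef, hκ']
    have : 0 < s₀ - t := by linarith
    gcongr
  have hgain : 2 * κ' ≤ p * (g t ^ 2 / (2 * E)) := by
    have : 0 < s₀ - t := by linarith
    rw [hκ', show 2 * (p * g t ^ 2 / (6 * L * (s₀ - t))) = p * (g t ^ 2 / (3 * L * (s₀ - t))) by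
      field_simp; norm_num]
    gcongr
  have hD : -κ' ≤ -(c / ((1 + Real.log Q - Real.log (s₀ - t)) ^ 2 * (s₀ - t))) := by
    have h1 : 0 < s₀ - t := by linarith
    have h2 := (hden t ht1 ht2).1
    have h3 : c / ((1 + Real.log Q - Real.log (s₀ - t)) ^ 2 * (s₀ - t))
        = g t ^ 2 / (c * (s₀ - t)) := by
      rw [hg]
      have : 0 < 1 + Real.log Q - Real.log (s₀ - t) := by linarith
      field_simp
    have h4 : κ' = g t ^ 2 / (6 * L / p * (s₀ - t)) := by rw [hκ']; field_simp
    rw [h3, h4, neg_le_neg_iff]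
    gcongr
  have hsplit : (6 * p * C₁ + 2 * C₁ * (L / p)) / ρ₁ =
      p * (6 * C₁ / ρ₁) + 2 * C₁ / ρ₁ * (L / p) := by ring
  rw [hsplit] at hκ
  have hW0 : 0 < 2 * C₁ / ρ₁ * (L / p) := by positivity
  refine hF.no_steep_max hF' bF (t := t) (τ := t - (s₀ - Q)) (L := L) (x := x) (y := y) (N := N)
    (ρ₁ := ρ₁) (C₁ := C₁) (p := p) (E := E) (e := κ / 4) (g := g)
    (D := -(c / ((1 + Real.log Q - Real.log (s₀ - t)) ^ 2 * (s₀ - t))))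
    (by linarith) (by linarith) (by linarith) hL.le
    (fun s z h1 h2 => hlip s t z (by linarith) h2 (by linarith)) ?_ hC₁.le hN hρ₁ hxy habx haby
    hp hgt0 hE0 ?_ (fun u v h => hslope t u v ht1 (by linarith) h) ?_ (by linarith) ?_ ?_
    (by positivity) ?_
  · rw [hg]
    exact hasDerivAt_slope_profile (by linarith) (by linarith [(hden t ht1 ht2).1])
  · refine le_trans ?_ hRρ
    have : 2 * E ≤ 3 * L * Q := hE1.trans (by gcongr)
    gcongr
  · intro u v hu hv
    have h1 := abs_le.1 (hlip t s₀ u ht1 (by linarith) le_rfl)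
    have h2 := abs_le.1 (hlip t s₀ v ht1 (by linarith) le_rfl)
    have h3 := abs_le.1 (hflat u hu)
    have h4 := abs_le.1 (hflat v hv)
    rw [hE]
    linarith [h1.1, h2.2, h3.1, h4.2]
  · intro s z w h1 h2 h3 h4 h5
    refine hmax s (x + w) (y + z) (by linarith) (by linarith) ?_ ?_ h5
    · exact (abs_add_le _ _).trans (by linarith)
    · exact (abs_add_le _ _).trans (by linarith)
  · have h1 : 0 < p * (g t ^ 2 / (2 * E) - 6 * C₁ / ρ₁) := by
      rw [mul_sub]
      linarith
    exact (pos_iff_pos_of_mul_pos h1).1 hp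
  · rw [mul_sub p]
    linarith

theorem log_le_integral_mid {r R γ c : ℝ} (hr : 0 < r) (hR : r ≤ R) {k : ℝ → ℝ}
    (hk : Continuous k) (h : ∀ z, r < z → z ≤ R → γ * z - c * z ^ 2 ≤ k z) :
    γ * Real.log (R / r) - c * (R - r) ≤ ∫ z in Ioc r R, k z / z ^ 2 := by
  have hR0 : 0 < R := hr.trans_le hR
  have hinv : IntervalIntegrable (fun z : ℝ => z⁻¹) volume r R :=
    intervalIntegral.intervalIntegrable_inv (fun x hx => by
      rw [uIcc_of_le hR] at hx
      exact (hr.trans_le hx.1).ne') continuousOn_id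
  have h1 : ∫ z in r..R, (γ * z⁻¹ - c) = γ * Real.log (R / r) - c * (R - r) := by
    rw [intervalIntegral.integral_sub (hinv.const_mul γ) intervalIntegrable_const,
      intervalIntegral.integral_const_mul, integral_inv_of_pos hr hR0,
      intervalIntegral.integral_const, smul_eq_mul, mul_comm c]
  rw [← h1, intervalIntegral.integral_of_le hR]
  refine setIntegral_mono_on ?_ (integrableOn_mid hr hk) measurableSet_Ioc fun z hz => ?_
  · exact ((intervalIntegrable_iff_integrableOn_Ioc_of_le hR).1
      ((hinv.const_mul γ).sub intervalIntegrable_const))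
  · have hz0 : 0 < z := hr.trans hz.1
    rw [le_div_iff₀ (by positivity)]
    have := h z hz.1 hz.2
    have e : (γ * z⁻¹ - c) * z ^ 2 = γ * z - c * z ^ 2 := by field_simp
    linarith

/-- A concave kink is impossible where the profile is touched from above with positive slope. -/
theorem PastSub.no_concave_kink {T M L τ t₀ x₀ q γ C r : ℝ} {F : ℝ → ℝ → ℝ} (hF : PastSub T F)
    (bF : BddUC M F) (htT : t₀ ≤ T) (hτ : 0 < τ) (hτt : τ ≤ t₀)
    (hlip : ∀ s x, t₀ - τ ≤ s → s ≤ t₀ → |F s x - F t₀ x| ≤ L * (t₀ - s)) (hq : 0 < q)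
    (hγ : 0 < γ) (hC : 0 ≤ C) (hr : 0 < r)
    (htouch : ∀ y, |y| ≤ r → F t₀ (x₀ + y) ≤ F t₀ x₀ + q * y + C * y ^ 2)
    (hkink : ∀ y, 0 < y → y ≤ r →
      F t₀ (x₀ + y) + F t₀ (x₀ - y) ≤ 2 * F t₀ x₀ + 2 * C * y ^ 2 - γ * y) : False := by
  have key : ∀ ρ, 0 < ρ → ρ < r →
      q * (γ * Real.log (r / ρ) + (cutOp r (F t₀) x₀ - 2 * C * r)) ≤ L := by
    intro ρ hρ hρr
    have h1 := hF t₀ x₀ (-L) q C τ r ρ (hτ.trans_le hτt) htT hτ hτt hC hρ hρr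
      (fun t y h1 h2 h3 => by
        have h4 := (abs_le.1 (hlip t (x₀ + y) h1 h2)).2
        linarith [htouch y h3])
    rw [max_eq_left hq.le] at h1
    have hk := continuous_second_diff (bF.slice t₀) x₀
    have h2 := log_le_integral_mid hρ hρr.le hk (γ := γ) (c := 2 * C) (fun z h3 h4 => by
      linarith [hkink z (hρ.trans h3) h4])
    have h3 := tailInt_split hρ hρr.le hk (abs_second_diff_le (bF.bdd t₀) x₀)
    have h4 : cutOp ρ (F t₀) x₀ = _ := h3
    rw [show tailInt r _ = cutOp r (F t₀) x₀ from rfl] at h4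
    have h5 : γ * Real.log (r / ρ) + (cutOp r (F t₀) x₀ - 2 * C * r) ≤
      cutOp ρ (F t₀) x₀ - 2 * C * ρ := by linarith
    have := mul_le_mul_of_nonneg_left h5 hq.le
    linarith
  obtain ⟨A, hA⟩ : ∃ A, A = cutOp r (F t₀) x₀ - 2 * C * r := ⟨_, rfl⟩
  rw [← hA] at key
  obtain ⟨X, hX⟩ : ∃ X, X = max 1 ((L / q + 1 - A) / γ) := ⟨_, rfl⟩
  have hX1 : 0 < X := by rw [hX]; exact zero_lt_one.trans_le (le_max_left _ _)
  have hX2 : (L / q + 1 - A) / γ ≤ X := by rw [hX]; exact le_max_right _ _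
  have h1 := key (r * Real.exp (-X)) (by positivity) (by
    have : Real.exp (-X) < 1 := Real.exp_lt_one_iff.2 (by linarith)
    exact mul_lt_of_lt_one_right hr this)
  rw [show r / (r * Real.exp (-X)) = Real.exp X by rw [Real.exp_neg]; field_simp,
    Real.log_exp] at h1
  rw [div_le_iff₀ hγ] at hX2
  have h2 : q * (L / q + 1) ≤ q * (γ * X + A) :=
    mul_le_mul_of_nonneg_left (by linarith) hq.le
  have h3 : q * (L / q + 1) = L + q := by field_simp
  linarith

theorem sq_max_zero_add_le (u v : ℝ) :
    max (u + v) 0 ^ 2 ≤ max u 0 ^ 2 + 2 * max u 0 * v + v ^ 2 := by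
  have h : max u 0 ^ 2 + 2 * max u 0 * v + v ^ 2 = (max u 0 + v) ^ 2 := by ring
  rw [h]
  rcases le_total (u + v) 0 with h1 | h1
  · rw [max_eq_right h1]; simpa using sq_nonneg (max u 0 + v)
  · rw [max_eq_left h1]
    have : u ≤ max u 0 := le_max_left _ _
    gcongr

/-- Bounds from above propagate to the left: information only travels to the right. -/
theorem PastSub.le_of_le_right {T M : ℝ} {F : ℝ → ℝ → ℝ} (hF : PastSub T F) (bF : BddUC M F)
    {t₁ t₂ l x₀ c : ℝ} (ht₁ : 0 ≤ t₁) (ht : t₁ ≤ t₂) (htT : t₂ ≤ T)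
    (h0 : ∀ x, l ≤ x → x ≤ x₀ → F t₁ x ≤ c) (hx₀ : ∀ s, t₁ ≤ s → s ≤ t₂ → F s x₀ ≤ c) :
    ∀ x, l ≤ x → x ≤ x₀ → F t₂ x ≤ c := by
  intro x₁ hlx hx₁
  suffices H : ∀ η > 0, F t₂ x₁ ≤ c + η * (1 + (t₂ - t₁)) by
    have : Tendsto (fun η : ℝ => c + η * (1 + (t₂ - t₁))) (𝓝[>] 0)
        (𝓝 (c + 0 * (1 + (t₂ - t₁)))) := by
      refine Tendsto.mono_left ?_ nhdsWithin_le_nhds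
      exact (Continuous.tendsto (by fun_prop) 0)
    rw [zero_mul, add_zero] at this
    exact ge_of_tendsto this (eventually_nhdsWithin_of_forall fun η hη => H η hη)
  intro η hη
  obtain ⟨d, hd, hmod⟩ := bF.modulus hη
  obtain ⟨e, he⟩ : ∃ e, e = min d 1 := ⟨_, rfl⟩
  have he0 : 0 < e := by rw [he]; exact lt_min hd one_pos
  have hed : e ≤ d := by rw [he]; exact min_le_left _ _
  have he1 : e ≤ 1 := by rw [he]; exact min_le_right _ _
  have hM := bF.nonneg
  obtain ⟨Λ, hΛ⟩ : ∃ Λ, Λ = (M + |c|) / e ^ 2 := ⟨_, rfl⟩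
  have hΛ0 : 0 ≤ Λ := by rw [hΛ]; positivity
  have hΛe : ∀ u, e ≤ u → M - c ≤ Λ * u ^ 2 := fun u hu => by
    have h1 : Λ * e ^ 2 ≤ Λ * u ^ 2 := by gcongr
    have h2 : Λ * e ^ 2 = M + |c| := by rw [hΛ]; field_simp
    linarith [neg_abs_le c]
  obtain ⟨Ψ, hΨ⟩ : ∃ Ψ : ℝ × ℝ → ℝ, Ψ = fun w => F w.1 w.2 -
    (c + η + Λ * max (l - w.2) 0 ^ 2 + η * (w.1 - t₁)) := ⟨_, rfl⟩
  have hΨc : Continuous Ψ := by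
    rw [hΨ]
    exact bF.continuous₂.sub (by fun_prop)
  obtain ⟨⟨t, x⟩, ⟨⟨ht1, ht2⟩, hx1, hx2⟩, hmax⟩ :=
    (isCompact_Icc.prod isCompact_Icc : IsCompact (Icc t₁ t₂ ×ˢ Icc (l - 1) x₀)).exists_isMaxOn
    ⟨(t₂, x₁), ⟨ht, le_rfl⟩, by linarith, hx₁⟩ hΨc.continuousOn
  simp only at ht1 ht2 hx1 hx2
  by_contra! hlt
  have hpos : 0 < Ψ (t, x) := by
    refine lt_of_lt_of_le ?_ (hmax (show (t₂, x₁) ∈ _ from ⟨⟨ht, le_rfl⟩, by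
      simp only; linarith, hx₁⟩))
    rw [hΨ]
    simp only
    rw [max_eq_right (by linarith)]
    linarith
  have hmax' : ∀ s z, t₁ ≤ s → s ≤ t₂ → l - 1 ≤ z → z ≤ x₀ →
      F s z - (c + η + Λ * max (l - z) 0 ^ 2 + η * (s - t₁)) ≤
      F t x - (c + η + Λ * max (l - x) 0 ^ 2 + η * (t - t₁)) := fun s z h1 h2 h3 h4 => by
    have := hmax (show (s, z) ∈ _ from ⟨⟨h1, h2⟩, h3, h4⟩)
    rw [hΨ] at this
    exact this
  rw [hΨ] at hpos
  simp only at hpos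
  have hηt : 0 ≤ η * (t - t₁) := mul_nonneg hη.le (by linarith)
  have hfar : x ≤ l - e → False := fun h => by
    have h1 := hΛe (max (l - x) 0) (le_trans (by linarith) (le_max_left _ _))
    linarith [(abs_le.1 (bF.bdd t x)).2]
  have hxl : l - 1 < x := by
    by_contra! h
    exact hfar (by linarith)
  have hxx : x < x₀ := by
    refine lt_of_le_of_ne hx2 fun h => ?_
    rw [h] at hpos
    have : 0 ≤ Λ * max (l - x₀) 0 ^ 2 := by positivity
    linarith [hx₀ t ht1 ht2]
  have htt : t₁ < t := by
    refine lt_of_le_of_ne ht1 fun h => ?_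
    rw [← h] at hpos
    have h2 : 0 ≤ Λ * max (l - x) 0 ^ 2 := by positivity
    rcases le_total l x with h1 | h1
    · linarith [h0 x h1 hx2]
    · have h3 : l - e < x := by
        by_contra! h
        exact hfar h
      have h4 := (abs_le.1 (hmod t₁ t₁ x l (by simpa using hd.le)
        (abs_le.2 ⟨by linarith, by linarith⟩))).2
      linarith [h0 l le_rfl (by linarith)]
  obtain ⟨r, hr, hr1, hr2⟩ : ∃ r > 0, r ≤ x - (l - 1) ∧ r ≤ x₀ - x :=
    ⟨min (x - (l - 1)) (x₀ - x), lt_min (by linarith) (by linarith), min_le_left _ _,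
      min_le_right _ _⟩
  have := hF t x η (-(2 * Λ * max (l - x) 0)) Λ (t - t₁) r (r / 2) (by linarith)
    (by linarith) (by linarith) (by linarith) hΛ0 (by linarith) (by linarith)
    (fun s y h1 h2 h3 => by
      have h4 := abs_le.1 h3
      have h5 := hmax' s (x + y) (by linarith) (by linarith) (by linarith) (by linarith)
      have h6 := mul_le_mul_of_nonneg_left (sq_max_zero_add_le (l - x) (-y)) hΛ0
      rw [show l - x + -y = l - (x + y) by ring] at h6
      linarith)
  rw [max_eq_right (by
    have : 0 ≤ 2 * Λ * max (l - x) 0 := by positivity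
    linarith)] at this
  linarith

theorem mul_lower_bound {θ p J I m : ℝ} (hp : 0 ≤ p) (hθ : |θ - p| ≤ m) (hI : J - m ≤ I) :
    p * J - (m * |J| + (p + m) * m) ≤ max θ 0 * I := by
  have h := abs_le.1 hθ
  obtain ⟨q, hq⟩ : ∃ q, q = max θ 0 := ⟨_, rfl⟩
  rw [← hq]
  have hm : 0 ≤ m := (abs_nonneg _).trans hθ
  have hq0 : 0 ≤ q := by rw [hq]; exact le_max_right _ _
  have h1 : q ≤ p + m := by rw [hq]; exact max_le (by linarith) (by linarith)
  have h2 : p - m ≤ q := by rw [hq]; exact le_trans (by linarith) (le_max_left _ _)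
  have h3 : q * (J - m) ≤ q * I := mul_le_mul_of_nonneg_left hI hq0
  have h4 : q * m ≤ (p + m) * m := mul_le_mul_of_nonneg_right h1 hm
  have h5 : |(p - q) * J| ≤ m * |J| := by
    rw [abs_mul]
    exact mul_le_mul_of_nonneg_right (abs_le.2 ⟨by linarith, by linarith⟩) (abs_nonneg _)
  have := (abs_le.1 h5).2
  linarith

set_option maxHeartbeats 1000000 in
theorem PastSub.barrier_core {T M L t₀ x₀ a p C r r' ε m ϱ Δ yc b h : ℝ} {F : ℝ → ℝ → ℝ}
    (hF : PastSub T F) (bF : BddUC M F) (htT : t₀ ≤ T) (hΔ : 0 < Δ) (hΔt : Δ ≤ t₀) (hp : 0 ≤ p)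
    (hC : 0 ≤ C) (hε : 0 < ε) (hϱ0 : 0 < ϱ) (hL : 0 ≤ L) (hr : ϱ < r) (hr' : r + ϱ ≤ r')
    (htouch : ∀ y, |y| ≤ r' → F t₀ (x₀ + y) ≤ h + p * y + C * y ^ 2)
    (hlip : ∀ t x, t₀ - Δ ≤ t → t ≤ t₀ → F t x ≤ F t₀ x + L * Δ)
    (hstep : 2 * ε ≤ a + p * (cutOp r (F t₀) x₀ - 2 * C * r))
    (hm : m * |cutOp r (F t₀) x₀ - 2 * C * r| + (p + m) * m < ε)
    (hcont : ∀ t y, t₀ - Δ ≤ t → t ≤ t₀ → |y| ≤ ϱ →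
      cutOp r (F t₀) x₀ - m / 4 ≤ cutOp r (F t) (x₀ + y))
    (hCm : 2 * C * ϱ ≤ m / 4)
    (hb : b * ϱ ^ 2 = 4 * ((L + |a| + |a - ε|) * Δ)) (hbm : 5 / 2 * (b * ϱ) ≤ m / 2)
    (hCε : C * ϱ ^ 2 ≤ ε * Δ) (hyc : |yc| = ϱ / 2)
    (hstart : ∀ y, |y - yc| ≤ ϱ / 2 →
      F (t₀ - Δ) (x₀ + y) ≤ h - a * Δ + p * y + ε / 4 * Δ) :
    F t₀ (x₀ + yc) ≤ h + p * yc - ε / 2 * Δ := by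
  have hb0 : 0 ≤ b := by
    have : 0 ≤ b * ϱ ^ 2 := by rw [hb]; positivity
    by_contra! hneg
    have : b * ϱ ^ 2 < 0 := mul_neg_of_neg_of_pos hneg (by positivity)
    linarith
  have haΔ : |a| * Δ + a * Δ ≥ 0 := by
    have := mul_nonneg (show 0 ≤ |a| + a by linarith [neg_abs_le a]) hΔ.le
    linarith
  have haΔ' : |a| * Δ - a * Δ ≥ 0 := by
    have := mul_nonneg (show 0 ≤ |a| - a by linarith [le_abs_self a]) hΔ.le
    linarith
  have hεΔ : 0 < ε * Δ := by positivity
  have hrate : ∀ t, t₀ - Δ ≤ t → t ≤ t₀ → -(|a - ε| * Δ) ≤ (a - ε) * (t - t₀ + Δ) :=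
    fun t h1 h2 => by
      have h3 : |(a - ε) * (t - t₀ + Δ)| ≤ |a - ε| * Δ := by
        rw [abs_mul]
        gcongr
        exact abs_le.2 ⟨by linarith, by linarith⟩
      exact (abs_le.1 h3).1
  obtain ⟨Ψ, hΨ⟩ : ∃ Ψ : ℝ → ℝ → ℝ, ∀ t y, Ψ t y = h + p * y + C * y ^ 2 - a * Δ + ε / 4 * Δ +
    b * (y - yc) ^ 2 + (a - ε) * (t - t₀ + Δ) := ⟨_, fun _ _ => rfl⟩
  have hΨlow : ∀ t y, t₀ - Δ ≤ t → t ≤ t₀ →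
      h + p * y + C * y ^ 2 - (|a| + |a - ε|) * Δ ≤ Ψ t y := fun t y h1 h2 => by
    rw [hΨ]
    have := mul_nonneg hb0 (sq_nonneg (y - yc))
    linarith [hrate t h1 h2]
  have hFup : ∀ t y, t₀ - Δ ≤ t → t ≤ t₀ → |y| ≤ r' →
      F t (x₀ + y) ≤ h + p * y + C * y ^ 2 + L * Δ := fun t y h1 h2 h3 =>
    (hlip t _ h1 h2).trans (by linarith [htouch y h3])
  have hout : ∀ t y, t₀ - Δ ≤ t → t ≤ t₀ → |y| ≤ r' → ϱ / 2 ≤ |y - yc| →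
      F t (x₀ + y) ≤ Ψ t y := fun t y h1 h2 h3 h4 => by
    have h5 := hFup t y h1 h2 h3
    have h6 : (ϱ / 2) ^ 2 ≤ (y - yc) ^ 2 := by
      rw [← sq_abs (y - yc)]
      gcongr
    have h7 := mul_le_mul_of_nonneg_left h6 hb0
    rw [hΨ]
    linarith [hrate t h1 h2, mul_nonneg hL hΔ.le]
  have hgoal : F t₀ (x₀ + yc) ≤ Ψ t₀ yc → F t₀ (x₀ + yc) ≤ h + p * yc - ε / 2 * Δ := fun h1 => by
    rw [hΨ] at h1
    have h2 : yc ^ 2 = (ϱ / 2) ^ 2 := by rw [← sq_abs yc, hyc]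
    have h3 : C * yc ^ 2 ≤ ε * Δ / 4 := by rw [h2]; linarith
    rw [sub_self yc] at h1
    linarith
  refine hgoal ?_
  by_contra! hlt
  obtain ⟨Φ, hΦ⟩ : ∃ Φ : ℝ × ℝ → ℝ, Φ = fun w => F w.1 (x₀ + w.2) - Ψ w.1 w.2 := ⟨_, rfl⟩
  have hΦc : Continuous Φ := by
    rw [hΦ]
    simp only [hΨ]
    exact (bF.comp (by fun_prop) (by fun_prop)).sub (by fun_prop)
  obtain ⟨⟨t, y⟩, ⟨⟨ht1, ht2⟩, hy1, hy2⟩, hmax⟩ :=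
    (isCompact_Icc.prod isCompact_Icc :
      IsCompact (Icc (t₀ - Δ) t₀ ×ˢ Icc (yc - ϱ / 2) (yc + ϱ / 2))).exists_isMaxOn
    ⟨(t₀, yc), ⟨by linarith, le_rfl⟩, by simp only; linarith, by simp only; linarith⟩
    hΦc.continuousOn
  simp only at ht1 ht2 hy1 hy2
  have hmax' : ∀ s z, t₀ - Δ ≤ s → s ≤ t₀ → |z - yc| ≤ ϱ / 2 →
      F s (x₀ + z) - Ψ s z ≤ F t (x₀ + y) - Ψ t y := fun s z h1 h2 h3 => by
    have h4 := abs_le.1 h3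
    have := hmax (show (s, z) ∈ _ from ⟨⟨h1, h2⟩, by simp only; linarith, by simp only; linarith⟩)
    rw [hΦ] at this
    exact this
  have hpos : 0 < F t (x₀ + y) - Ψ t y := by
    have := hmax' t₀ yc (by linarith) le_rfl (by rw [sub_self, abs_zero]; linarith)
    linarith
  have hyϱ : |y| ≤ ϱ := by
    have := abs_le.1 hyc.le
    exact abs_le.2 ⟨by linarith, by linarith⟩
  have hyyc : |y - yc| ≤ ϱ / 2 := abs_le.2 ⟨by linarith, by linarith⟩
  have htt : t₀ - Δ < t := by
    refine lt_of_le_of_ne ht1 fun h1 => ?_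
    have h2 := hstart y hyyc
    rw [← h1, hΨ, show t₀ - Δ - t₀ + Δ = 0 by ring] at hpos
    have h3 := mul_nonneg hb0 (sq_nonneg (y - yc))
    have h4 := mul_nonneg hC (sq_nonneg y)
    linarith
  have hrange : ∀ z, |z| ≤ r → |y + z| ≤ r' := fun z hz =>
    (abs_add_le _ _).trans (by linarith)
  have key := hF t (x₀ + y) (a - ε) (p + 2 * C * y + 2 * b * (y - yc)) (C + b)
    (t - (t₀ - Δ)) r ϱ (by linarith) (by linarith) (by linarith) (by linarith)
    (by positivity) hϱ0 hr (fun s z h1 h2 h3 => by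
      have h4 : F s (x₀ + (y + z)) - Ψ s (y + z) ≤ F t (x₀ + y) - Ψ t y := by
        rcases le_total (|y + z - yc|) (ϱ / 2) with h5 | h5
        · exact hmax' s (y + z) (by linarith) (by linarith) h5
        · linarith [hout s (y + z) (by linarith) (by linarith) (hrange z h3) h5]
      rw [hΨ, hΨ] at h4
      rw [add_assoc x₀]
      linarith)
  have hk := continuous_second_diff (bF.slice t) (x₀ + y)
  have h1 := tailInt_split hϱ0 hr.le hk (abs_second_diff_le (bF.bdd t) (x₀ + y))
  have h2 := le_integral_mid hϱ0 hr.le hk (b := 2 * ((L + |a| + |a - ε|) * Δ)) (c := 2 * C)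
    (by positivity) (fun z h3 h4 => by
      have h5 := hFup t (y + z) ht1 ht2 (hrange z (by rw [abs_of_pos (hϱ0.trans h3)]; exact h4))
      have h6 := hFup t (y + -z) ht1 ht2
        (hrange (-z) (by rw [abs_neg, abs_of_pos (hϱ0.trans h3)]; exact h4))
      have h7 := hΨlow t y ht1 ht2
      rw [← add_assoc] at h5 h6
      rw [← sub_eq_add_neg] at h6
      linarith) (by positivity)
  have h3 : 2 * ((L + |a| + |a - ε|) * Δ) / ϱ = b * ϱ / 2 := by
    rw [div_eq_iff hϱ0.ne']
    linarith
  have h4 : cutOp ϱ (F t) (x₀ + y) = _ := h1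
  rw [show tailInt r _ = cutOp r (F t) (x₀ + y) from rfl] at h4
  rw [h3] at h2
  have h5 := hcont t y ht1 ht2 hyϱ
  have hθ : |p + 2 * C * y + 2 * b * (y - yc) - p| ≤ m := by
    have e1 : |2 * C * y| ≤ 2 * C * ϱ := by
      rw [abs_mul, abs_of_nonneg (by positivity)]; gcongr
    have e2 : |2 * b * (y - yc)| ≤ b * ϱ := by
      rw [abs_mul, abs_of_nonneg (by positivity)]
      have : 2 * b * |y - yc| ≤ 2 * b * (ϱ / 2) := by gcongr
      linarith
    have e3 : 0 ≤ b * ϱ := by positivity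
    have e4 : 0 ≤ 2 * C * ϱ := by positivity
    rw [add_assoc, add_sub_cancel_left]
    exact (abs_add_le _ _).trans (by linarith)
  have h6 := mul_lower_bound (J := cutOp r (F t₀) x₀ - 2 * C * r)
    (I := cutOp ϱ (F t) (x₀ + y) - 2 * (C + b) * ϱ) hp hθ (by linarith)
  linarith

/-- If touching from above at `(t₀, x₀)` violates the subsolution inequality, then the profile
at time `t₀` lies strictly below the touching parabola at linear rate. -/
theorem PastSub.barrier {T M L τ t₀ x₀ a p C r r' ε h : ℝ} {F : ℝ → ℝ → ℝ}
    (hF : PastSub T F) (bF : BddUC M F) (htT : t₀ ≤ T) (hτ : 0 < τ) (hτt : τ ≤ t₀) (hp : 0 ≤ p)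
    (hC : 0 ≤ C) (hε : 0 < ε) (hL : 0 ≤ L) (hr : 0 < r) (hr' : r < r')
    (htouch : ∀ y, |y| ≤ r' → F t₀ (x₀ + y) ≤ h + p * y + C * y ^ 2)
    (hlip : ∀ t x, t₀ - τ ≤ t → t ≤ t₀ → F t x ≤ F t₀ x + L * (t₀ - t))
    (hstep : 2 * ε ≤ a + p * (cutOp r (F t₀) x₀ - 2 * C * r)) :
    ∃ K > 0, ∀ᶠ Δ in 𝓝[>] 0, ∀ yc, |yc| = K * Δ / 2 →
      (∀ y, |y - yc| ≤ K * Δ / 2 →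
        F (t₀ - Δ) (x₀ + y) ≤ h - a * Δ + p * y + ε / 4 * Δ) →
      F t₀ (x₀ + yc) ≤ h + p * yc - ε / 2 * Δ := by
  obtain ⟨J, hJ⟩ : ∃ J, J = cutOp r (F t₀) x₀ - 2 * C * r := ⟨_, rfl⟩
  obtain ⟨m, hm0, hm⟩ : ∃ m > 0, m * |J| + (p + m) * m < ε := by
    have h1 : Tendsto (fun m : ℝ => m * |J| + (p + m) * m) (𝓝[>] 0)
        (𝓝 (0 * |J| + (p + 0) * 0)) :=
      Tendsto.mono_left (Continuous.tendsto (by fun_prop) 0) nhdsWithin_le_nhds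
    have h2 := (h1.eventually_lt_const (show 0 * |J| + (p + 0) * 0 < ε by simpa using hε)).and
      eventually_pos
    obtain ⟨m, h3, h4⟩ := h2.exists
    exact ⟨m, h4, h3⟩
  obtain ⟨L', hL'⟩ : ∃ L', L' = L + |a| + |a - ε| := ⟨_, rfl⟩
  have hL'0 : 0 ≤ L' := by rw [hL']; positivity
  obtain ⟨K, hK⟩ : ∃ K, K = 20 * L' / m + 1 := ⟨_, rfl⟩
  have hK0 : 0 < K := by rw [hK]; positivity
  have hKm : 20 * L' ≤ m * K := by
    have : m * K = 20 * L' + m := by rw [hK]; field_simp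
    linarith
  refine ⟨K, hK0, ?_⟩
  obtain ⟨d, hd, hcont⟩ := Metric.continuous_iff.1 (bF.continuous_cutOp hr) (t₀, x₀) (m / 4)
    (by positivity)
  filter_upwards [eventually_pos, eventually_small hτ, eventually_small hd,
    eventually_small_mul K hd, eventually_small_mul K hr, eventually_small_mul K (sub_pos.2 hr'),
    eventually_small_mul (2 * C * K) (show 0 < m / 4 by positivity),
    eventually_small_mul (C * K ^ 2) hε] with Δ hΔ h1 h2 h3 h4 h5 h6 h7 yc hyc hstart
  refine hF.barrier_core (b := 4 * L' / (K ^ 2 * Δ)) (m := m) (ϱ := K * Δ) (L := L) (a := a) (C := C)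
    (r := r) (r' := r') bF htT hΔ (by linarith) hp hC hε (by positivity) hL h4 (by linarith) htouch
    (fun t x g1 g2 => (hlip t x (by linarith) g2).trans ?_) hstep (by rw [← hJ]; exact hm)
    (fun t y g1 g2 g3 => ?_) (by linarith) (by rw [← hL']; field_simp) ?_ ?_ hyc hstart
  · have : L * (t₀ - t) ≤ L * Δ := by gcongr; linarith
    linarith
  · have := hcont (t, x₀ + y) (by
      rw [Prod.dist_eq, Real.dist_eq, Real.dist_eq]
      refine max_lt ?_ ?_
      · exact (abs_le.2 ⟨by linarith, by linarith⟩ :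
          |t - t₀| ≤ Δ).trans_lt h2
      · simp only [add_sub_cancel_left]
        linarith)
    rw [Real.dist_eq] at this
    have := (abs_lt.1 this).1
    simp only at this
    linarith
  · rw [show 4 * L' / (K ^ 2 * Δ) * (K * Δ) = 4 * L' / K by field_simp]
    have : 4 * L' / K ≤ m / 5 := by
      rw [div_le_iff₀ hK0]; linarith
    linarith
  · have := mul_le_mul_of_nonneg_right h7.le hΔ.le
    linarith

theorem mul_le_integral_mid {α β G : ℝ} (hα : 0 < α) (hαβ : α ≤ β) (hG : 0 ≤ G) {g : ℝ → ℝ}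
    (hg : Continuous g) (h : ∀ z, α < z → z ≤ β → G ≤ g z) :
    G * (β - α) / β ^ 2 ≤ ∫ z in Ioc α β, g z / z ^ 2 := by
  have h1 : ∫ _ in Ioc α β, G / β ^ 2 = G * (β - α) / β ^ 2 := by
    rw [setIntegral_const, Measure.real, Real.volume_Ioc, ENNReal.toReal_ofReal (by linarith),
      smul_eq_mul]
    ring
  rw [← h1]
  refine setIntegral_mono_on (by simp) (integrableOn_mid hα hg) measurableSet_Ioc fun z hz => ?_
  have hz0 : 0 < z := hα.trans hz.1
  have := h z hz.1 hz.2
  have h2 := hz.2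
  have h3 : 0 ≤ g z := hG.trans this
  gcongr

theorem exists_integral_mid_small {g : ℝ → ℝ} (hg : Continuous g) {r B : ℝ} (hr : 0 < r)
    (hg0 : ∀ z, 0 < z → z ≤ r → 0 ≤ g z)
    (hB : ∀ ρ, 0 < ρ → ρ < r → ∫ z in Ioc ρ r, g z / z ^ 2 ≤ B) {e : ℝ} (he : 0 < e) :
    ∃ ρ₀ > 0, ρ₀ < r ∧ ∀ α β, 0 < α → α ≤ β → β ≤ ρ₀ → ∫ z in Ioc α β, g z / z ^ 2 < e := by
  obtain ⟨S, hS⟩ : ∃ S : Set ℝ, S = (fun ρ => ∫ z in Ioc ρ r, g z / z ^ 2) '' Ioo 0 r := ⟨_, rfl⟩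
  have hne : S.Nonempty := by
    rw [hS]; exact ⟨_, r / 2, ⟨by linarith, by linarith⟩, rfl⟩
  have hbd : BddAbove S := ⟨B, by
    rw [hS]; rintro _ ⟨ρ, hρ, rfl⟩; exact hB ρ hρ.1 hρ.2⟩
  obtain ⟨w, hw, hlt⟩ := exists_lt_of_lt_csSup hne (sub_lt_self (sSup S) he)
  rw [hS] at hw
  obtain ⟨ρ₀, ⟨h0, h1⟩, rfl⟩ := hw
  refine ⟨ρ₀, h0, h1, fun α β hα hαβ hβ => ?_⟩
  have h2 : ∫ z in Ioc α r, g z / z ^ 2 ≤ sSup S := le_csSup hbd (by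
    rw [hS]; exact ⟨α, ⟨hα, by linarith⟩, rfl⟩)
  have hsplit : ∀ u v w : ℝ, 0 < u → u ≤ v → v ≤ w → ∫ z in Ioc u w, g z / z ^ 2 =
      (∫ z in Ioc u v, g z / z ^ 2) + ∫ z in Ioc v w, g z / z ^ 2 := fun u v w h3 h4 h5 => by
    rw [← setIntegral_union (Ioc_disjoint_Ioc_of_le le_rfl) measurableSet_Ioc
      (integrableOn_mid h3 hg) (integrableOn_mid (h3.trans_le h4) hg), Ioc_union_Ioc_eq_Ioc h4 h5]
  have h3 := hsplit α β r hα hαβ (by linarith)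
  have h4 := hsplit β ρ₀ r (by linarith) hβ h1.le
  have h5 : 0 ≤ ∫ z in Ioc β ρ₀, g z / z ^ 2 :=
    setIntegral_nonneg measurableSet_Ioc fun z hz =>
      div_nonneg (hg0 z (by linarith [hz.1]) (by linarith [hz.2])) (sq_nonneg z)
  simp only at hlt
  linarith

/-- A nonnegative function with one-sided Lipschitz bound and finite energy near `0`
vanishes to first order. -/
theorem littleO_of_integral_le {D : ℝ → ℝ} (hD : Continuous D) {r B C₂ : ℝ} (hr : 0 < r)
    (hC₂ : 0 < C₂) (hD0 : ∀ z, |z| ≤ r → 0 ≤ D z)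
    (hslope : ∀ u v, -r ≤ u → u ≤ v → v ≤ r → D u - C₂ * (v - u) ≤ D v)
    (hB : ∀ ρ, 0 < ρ → ρ < r → ∫ z in Ioc ρ r, (D z + D (-z)) / z ^ 2 ≤ B) {ζ : ℝ} (hζ : 0 < ζ) :
    ∃ y₀ > 0, ∀ y, |y| ≤ y₀ → D y ≤ ζ * |y| := by
  wlog hζC : ζ ≤ C₂ generalizing ζ
  · obtain ⟨y₀, h0, h⟩ := this hC₂ le_rfl
    exact ⟨y₀, h0, fun y hy => (h y hy).trans (by
      have := abs_nonneg y
      gcongr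
      linarith)⟩
  have hg : Continuous fun z => D z + D (-z) := by fun_prop
  obtain ⟨m, hm⟩ : ∃ m, m = ζ / (2 * C₂) := ⟨_, rfl⟩
  have hm0 : 0 < m := by rw [hm]; positivity
  have hm1 : m ≤ 1 / 2 := by rw [hm, div_le_iff₀ (by positivity)]; linarith
  have hmC : C₂ * m = ζ / 2 := by rw [hm]; field_simp
  obtain ⟨ρ₀, h0, h1, hsmall⟩ := exists_integral_mid_small hg hr (fun z h1 h2 =>
    add_nonneg (hD0 z (by rwa [abs_of_pos h1])) (hD0 (-z) (by rwa [abs_neg, abs_of_pos h1]))) hB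
    (show 0 < ζ * m / 8 by positivity)
  have hD00 : ∀ z, 0 < z → z ≤ r → 0 ≤ D z ∧ 0 ≤ D (-z) := fun z h1 h2 =>
    ⟨hD0 z (by rwa [abs_of_pos h1]), hD0 (-z) (by rwa [abs_neg, abs_of_pos h1])⟩
  have hpos : ∀ u, 0 < u → u ≤ ρ₀ / 2 → D u ≤ ζ * u ∧ D (-u) ≤ ζ * u := by
    intro u hu hu2
    have hmu : 0 < m * u := by positivity
    have hmu2 : m * u ≤ 1 / 2 * u := by gcongr
    have hCmu : C₂ * (m * u) = ζ / 2 * u := by rw [← mul_assoc, hmC]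
    have e1 : ζ * m / 8 ≤ ζ / 2 * u * (m * u) / (2 * u) ^ 2 := by
      rw [le_div_iff₀ (by positivity)]
      exact le_of_eq (by ring)
    constructor
    · by_contra! hlt
      have h2 := hsmall u (u + m * u) hu (by linarith) (by linarith)
      have h3 := mul_le_integral_mid (β := u + m * u) (G := ζ / 2 * u) hu (by linarith)
        (by positivity) hg (fun z h4 h5 => by
          have h6 := hslope u z (by linarith) h4.le (by linarith)
          have h7 : C₂ * (z - u) ≤ C₂ * (m * u) := by gcongr; linarith
          linarith [(hD00 z (by linarith) (by linarith)).2])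
      rw [add_sub_cancel_left] at h3
      have h8 : ζ / 2 * u * (m * u) / (2 * u) ^ 2 ≤ ζ / 2 * u * (m * u) / (u + m * u) ^ 2 := by
        gcongr
        linarith
      linarith
    · by_contra! hlt
      have h2 := hsmall (u - m * u) u (by linarith) (by linarith) (by linarith)
      have h3 := mul_le_integral_mid (α := u - m * u) (β := u) (G := ζ / 2 * u) (by linarith)
        (by linarith) (by positivity) hg (fun z h4 h5 => by
          have h6 := hslope (-u) (-z) (by linarith) (by linarith) (by linarith)
          have h7 : C₂ * (-z - -u) ≤ C₂ * (m * u) := by gcongr; linarith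
          linarith [(hD00 z (by linarith) (by linarith)).1])
      rw [sub_sub_cancel] at h3
      have h8 : ζ / 2 * u * (m * u) / (2 * u) ^ 2 ≤ ζ / 2 * u * (m * u) / u ^ 2 := by
        gcongr
        linarith
      linarith
  have hzero : D 0 ≤ 0 := by
    have h2 : Tendsto (fun u : ℝ => D u - ζ * u) (𝓝[>] 0) (𝓝 (D 0 - ζ * 0)) :=
      Tendsto.mono_left (Continuous.tendsto (by fun_prop) 0) nhdsWithin_le_nhds
    rw [mul_zero, sub_zero] at h2
    refine le_of_tendsto h2 ?_
    filter_upwards [eventually_pos, eventually_small (show 0 < ρ₀ / 2 by positivity)] with u h3 h4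
    linarith [(hpos u h3 h4.le).1]
  refine ⟨ρ₀ / 2, by positivity, fun y hy => ?_⟩
  rcases lt_trichotomy y 0 with h | h | h
  · rw [abs_of_neg h] at hy ⊢
    simpa using (hpos (-y) (by linarith) hy).2
  · rw [h, abs_zero, mul_zero]; exact hzero
  · rw [abs_of_pos h] at hy ⊢
    exact (hpos y h hy).1

theorem PastSub.differentiable_touch {T M L C₁ τ t₀ x₀ p C r : ℝ} {F : ℝ → ℝ → ℝ}
    (hF : PastSub T F) (bF : BddUC M F) (htT : t₀ ≤ T) (hτ : 0 < τ) (hτt : τ ≤ t₀) (hp : 0 < p)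
    (hC : 0 ≤ C) (hC₁ : 0 < C₁) (hr : 0 < r)
    (htouch : ∀ y, |y| ≤ r → F t₀ (x₀ + y) ≤ F t₀ x₀ + p * y + C * y ^ 2)
    (hlip : ∀ t x, t₀ - τ ≤ t → t ≤ t₀ → F t x ≤ F t₀ x + L * (t₀ - t))
    (hslope : ∀ x y, x ≤ y → F t₀ y - F t₀ x ≤ C₁ * (y - x)) {ζ : ℝ} (hζ : 0 < ζ) :
    ∃ y₀ > 0, ∀ y, |y| ≤ y₀ → |F t₀ (x₀ + y) - F t₀ x₀ - p * y| ≤ ζ * |y| := by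
  have hsl := bF.slice t₀
  have hcut : ∀ ρ, 0 < ρ → ρ < r → p * (cutOp ρ (F t₀) x₀ - 2 * C * ρ) ≤ L := fun ρ h1 h2 => by
    have := hF t₀ x₀ (-L) p C τ r ρ (hτ.trans_le hτt) htT hτ hτt hC h1 h2 (fun t y h3 h4 h5 => by
      linarith [hlip t (x₀ + y) h3 h4, htouch y h5])
    rw [max_eq_left hp.le] at this
    linarith
  have hD : Continuous fun y => F t₀ x₀ + p * y + C * y ^ 2 - F t₀ (x₀ + y) := by fun_prop
  obtain ⟨y₀, h0, h1⟩ := littleO_of_integral_le hD (C₂ := C₁ + 2 * C * r)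
    (B := L / p + 4 * C * r + 4 * M / r) hr (by positivity)
    (fun z hz => by linarith [htouch z hz]) (fun u v h1 h2 h3 => by
      have h4 := hslope (x₀ + u) (x₀ + v) (by linarith)
      have h5 : 0 ≤ p * (v - u) := mul_nonneg hp.le (by linarith)
      have h6 : 0 ≤ C * ((v - u) * (v + u + 2 * r)) :=
        mul_nonneg hC (mul_nonneg (by linarith) (by linarith))
      linarith) (fun ρ h1 h2 => by
      have h3 := continuous_second_diff hsl x₀
      have h4 := tailInt_split h1 h2.le h3 (abs_second_diff_le (bF.bdd t₀) x₀)
      have h5 : cutOp ρ (F t₀) x₀ = (∫ z in Ioc ρ r, (2 * F t₀ x₀ - F t₀ (x₀ + z) -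
        F t₀ (x₀ - z)) / z ^ 2) + cutOp r (F t₀) x₀ := h4
      have h6 : ∫ z in Ioc ρ r, (F t₀ x₀ + p * z + C * z ^ 2 - F t₀ (x₀ + z) +
          (F t₀ x₀ + p * -z + C * (-z) ^ 2 - F t₀ (x₀ + -z))) / z ^ 2 =
          (∫ z in Ioc ρ r, (2 * F t₀ x₀ - F t₀ (x₀ + z) - F t₀ (x₀ - z)) / z ^ 2) +
          ∫ z in Ioc ρ r, 2 * C := by
        rw [← integral_add (integrableOn_mid h1 h3) continuous_const.integrableOn_Ioc]
        refine setIntegral_congr_fun measurableSet_Ioc fun z hz => ?_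
        have : z ≠ 0 := (h1.trans hz.1).ne'
        rw [← sub_eq_add_neg x₀ z]
        field_simp
        ring
      have h7 : ∫ _ in Ioc ρ r, 2 * C = 2 * C * (r - ρ) := by
        rw [setIntegral_const, Measure.real, Real.volume_Ioc,
          ENNReal.toReal_ofReal (by linarith), smul_eq_mul]
        ring
      have h8 := (abs_le.1 (abs_cutOp_le hr hsl (bF.bdd t₀) x₀)).1
      have h9 : cutOp ρ (F t₀) x₀ - 2 * C * ρ ≤ L / p := by
        rw [le_div_iff₀ hp]
        linarith [hcut ρ h1 h2]
      have h10 : C * ρ ≤ C * r := by gcongr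
      have h11 : 0 ≤ C * r := by positivity
      rw [h6, h7]
      linarith) (half_pos hζ)
  refine ⟨min y₀ (min r (ζ / 2 / (C + 1))), by positivity, fun y hy => ?_⟩
  have h2 := h1 y (hy.trans (min_le_left _ _))
  have h3 := htouch y (hy.trans ((min_le_right _ _).trans (min_le_left _ _)))
  have h4 : |y| * (C + 1) ≤ ζ / 2 := by
    rw [← le_div_iff₀ (by positivity)]
    exact hy.trans ((min_le_right _ _).trans (min_le_right _ _))
  have h5 : C * y ^ 2 ≤ ζ / 2 * |y| := by
    rw [← sq_abs]
    have h6 := mul_le_mul_of_nonneg_right h4 (abs_nonneg y)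
    linarith [sq_nonneg (|y|)]
  have h6 : 0 ≤ C * y ^ 2 := by positivity
  have h7 := abs_nonneg y
  have h8 : 0 ≤ ζ * |y| := by positivity
  rw [abs_le]
  constructor <;> linarith

theorem PastSub.slope_before {T M L C₁ t₁ t₀ x₀ p : ℝ} {F : ℝ → ℝ → ℝ} (hF : PastSub T F)
    (hF' : PastSub T (dual F)) (bF : BddUC M F) (ht₁ : 0 ≤ t₁) (ht : t₁ < t₀) (htT : t₀ ≤ T)
    (hp : 0 < p) (hL : 0 < L) (hC₁ : 0 < C₁)
    (hlip : ∀ s t x, t₁ ≤ s → s ≤ t → t ≤ t₀ → |F s x - F t x| ≤ L * (t - s))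
    (hslope : ∀ t x y, t₁ ≤ t → t ≤ t₀ → x ≤ y → F t y - F t x ≤ C₁ * (y - x))
    (ho : ∀ ζ > 0, ∃ y₀ > 0, ∀ y, |y| ≤ y₀ → |F t₀ (x₀ + y) - F t₀ x₀ - p * y| ≤ ζ * |y|)
    {K δ : ℝ} (hδ : 0 < δ) :
    ∀ᶠ Δ in 𝓝[>] 0, ∀ y, 0 ≤ y → y ≤ K * Δ →
      F (t₀ - Δ) (x₀ + y) - F (t₀ - Δ) x₀ ≤ (p + δ) * y := by
  obtain ⟨Q, hQ, K₃, hK₃, ζ, hζ, H⟩ := exists_slope_improvement hp hL hC₁ hδ (K := K)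
  obtain ⟨y₀, hy₀, ho⟩ := ho (ζ / K₃) (by positivity)
  filter_upwards [eventually_pos, eventually_small_mul Q (sub_pos.2 ht),
    eventually_small_mul K₃ hy₀] with Δ hΔ h1 h2 y hy0 hyK
  have ht₀ : t₀ / Δ * Δ = t₀ := by field_simp
  have hscale : Δ = 1 / Δ * Δ ^ 2 := by field_simp
  have hF2 := hF.scale (l := 1 / Δ) (m := Δ) (by positivity) hΔ x₀ 0 hscale
  have hF3 := hF'.dual_scale (l := 1 / Δ) (m := Δ) (by positivity) hΔ x₀ 0 hscale
  have bF2 := bF.scale (l := 1 / Δ) (by positivity) Δ x₀ 0 Δ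
  have hlow : ∀ s, t₀ / Δ - Q ≤ s → t₁ ≤ Δ * s := fun s hs => by
    have := mul_le_mul_of_nonneg_right hs hΔ.le
    linarith
  have hupp : ∀ s, s ≤ t₀ / Δ → Δ * s ≤ t₀ := fun s hs => by
    have := mul_le_mul_of_nonneg_right hs hΔ.le
    linarith
  have key := H (T / Δ) _ (t₀ / Δ) _ hF2 hF3 bF2 (by gcongr)
    (by rw [lt_div_iff₀ hΔ]; linarith)
    (fun s t x g1 g2 g3 => by
      have g4 := hlip (Δ * s) (Δ * t) (x₀ + Δ * x) (hlow s g1) (by gcongr) (hupp t g3)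
      rw [show 1 / Δ * F (Δ * s) (x₀ + Δ * x) + 0 - (1 / Δ * F (Δ * t) (x₀ + Δ * x) + 0) =
        1 / Δ * (F (Δ * s) (x₀ + Δ * x) - F (Δ * t) (x₀ + Δ * x)) by ring, abs_mul,
        abs_of_pos (by positivity), one_div_mul_eq_div, div_le_iff₀ hΔ]
      linarith)
    (fun t u v g1 g2 g3 => by
      have g4 := hslope (Δ * t) (x₀ + Δ * u) (x₀ + Δ * v) (hlow t g1) (hupp t g2)
        (by gcongr)
      rw [show 1 / Δ * F (Δ * t) (x₀ + Δ * v) + 0 - (1 / Δ * F (Δ * t) (x₀ + Δ * u) + 0) =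
        1 / Δ * (F (Δ * t) (x₀ + Δ * v) - F (Δ * t) (x₀ + Δ * u)) by ring, one_div_mul_eq_div,
        div_le_iff₀ hΔ]
      linarith)
    (fun z hz => by
      have g1 : |Δ * z| ≤ Δ * K₃ := by
        rw [abs_mul, abs_of_pos hΔ]; gcongr
      have g2 := ho (Δ * z) (by linarith)
      have g3 : ζ / K₃ * |Δ * z| ≤ ζ / K₃ * (Δ * K₃) := by gcongr
      have g4 : ζ / K₃ * (Δ * K₃) = ζ * Δ := by field_simp
      rw [mul_div_cancel₀ _ hΔ.ne', mul_zero, add_zero x₀,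
        show 1 / Δ * F t₀ (x₀ + Δ * z) + 0 - (1 / Δ * F t₀ x₀ + 0) - p * z =
        1 / Δ * (F t₀ (x₀ + Δ * z) - F t₀ x₀ - p * (Δ * z)) by field_simp; ring, abs_mul,
        abs_of_pos (show 0 < 1 / Δ by positivity), one_div_mul_eq_div, div_le_iff₀ hΔ]
      linarith)
    (y / Δ) (by positivity) (by rwa [div_le_iff₀ hΔ])
  rw [mul_div_cancel₀ _ hΔ.ne', mul_zero, add_zero x₀, show Δ * (t₀ / Δ - 1) = t₀ - Δ by
      field_simp, show 1 / Δ * F (t₀ - Δ) (x₀ + y) + 0 - (1 / Δ * F (t₀ - Δ) x₀ + 0) =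
      1 / Δ * (F (t₀ - Δ) (x₀ + y) - F (t₀ - Δ) x₀) by ring, one_div_mul_eq_div, div_le_iff₀ hΔ,
      mul_assoc, div_mul_cancel₀ _ hΔ.ne'] at key
  exact key

theorem BddUC.mono {M M' : ℝ} {F : ℝ → ℝ → ℝ} (h : BddUC M F) (hM : M ≤ M') : BddUC M' F :=
  ⟨fun t x => (h.bdd t x).trans hM, h.uc⟩

theorem PastSub.separate_nonpos {T M L τ t₀ x₀ a p C r : ℝ} {F : ℝ → ℝ → ℝ}
    (hF : PastSub T F) (bF : BddUC M F) (htT : t₀ ≤ T) (hτ : 0 < τ) (hτt : τ ≤ t₀) (hp : p ≤ 0)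
    (hC : 0 ≤ C) (hL : 0 ≤ L) (hr : 0 < r)
    (hlip : ∀ t x, t₀ - τ ≤ t → t ≤ t₀ → |F t x - F t₀ x| ≤ L * (t₀ - t))
    (ht : ∀ t, t₀ - τ ≤ t → t ≤ t₀ → F t x₀ ≤ F t₀ x₀ + a * (t - t₀))
    (hx : ∀ y, |y| ≤ r → F t₀ (x₀ + y) ≤ F t₀ x₀ + p * y + C * y ^ 2) : a ≤ 0 := by
  by_contra! ha
  obtain ⟨d, hd, hmod⟩ := bF.modulus (show 0 < a * τ / 2 by positivity)
  obtain ⟨e, he⟩ : ∃ e, e = min d r := ⟨_, rfl⟩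
  have he0 : 0 < e := by rw [he]; exact lt_min hd hr
  have hed : e ≤ d := by rw [he]; exact min_le_left _ _
  have her : e ≤ r := by rw [he]; exact min_le_right _ _
  have hstart : ∀ x, x₀ - e ≤ x → x ≤ x₀ → F (t₀ - τ) x ≤ F t₀ x₀ - a * τ / 2 :=
    fun x h1 h2 => by
      have h3 := (abs_le.1 (hmod (t₀ - τ) (t₀ - τ) x x₀ (by simpa using hd.le)
        (abs_le.2 ⟨by linarith, by linarith⟩))).2
      linarith [ht (t₀ - τ) le_rfl (by linarith)]
  have hback : ∀ Δ, 0 ≤ Δ → Δ ≤ τ / 2 → ∀ x, x₀ - e ≤ x → x ≤ x₀ →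
      F (t₀ - Δ) x ≤ F t₀ x₀ - a * Δ := fun Δ h1 h2 => by
    have h3 : a * Δ ≤ a * (τ / 2) := by gcongr
    refine hF.le_of_le_right bF (t₁ := t₀ - τ) (by linarith) (by linarith) (by linarith)
      (fun x h4 h5 => by linarith [hstart x h4 h5]) (fun s h4 h5 => ?_)
    have h6 : a * (s - t₀) ≤ a * (-Δ) := by gcongr; linarith
    linarith [ht s h4 (by linarith)]
  have htouch : ∀ y, |y| ≤ e → F t₀ (x₀ + y) ≤ F t₀ x₀ + 0 * y + C * y ^ 2 := fun y hy => by
    have h0 : 0 ≤ C * y ^ 2 := by positivity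
    rcases le_total y 0 with h | h
    · have h1 := abs_le.1 hy
      have := hback 0 le_rfl (by positivity) (x₀ + y) (by linarith) (by linarith)
      rw [sub_zero] at this
      linarith
    · have h1 := hx y (hy.trans her)
      have h2 : 0 ≤ -p * y := mul_nonneg (by linarith) h
      linarith
  obtain ⟨K, hK, hev⟩ := hF.barrier bF htT hτ hτt le_rfl hC (half_pos ha) hL (half_pos he0)
    (half_lt_self he0) htouch (fun t x h1 h2 => by linarith [(abs_le.1 (hlip t x h1 h2)).2])
    (a := a) (by linarith)
  have hdrop : ∀ᶠ y in 𝓝[>] (0 : ℝ), F t₀ (x₀ - y) ≤ F t₀ x₀ - a / 2 / K * y := by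
    have htend : Tendsto (fun y : ℝ => 2 / K * y) (𝓝[>] 0) (𝓝[>] 0) := by
      refine tendsto_nhdsWithin_iff.2 ⟨?_, ?_⟩
      · have : Tendsto (fun y : ℝ => 2 / K * y) (𝓝[>] 0) (𝓝 (2 / K * 0)) :=
          Tendsto.mono_left (Continuous.tendsto (by fun_prop) 0) nhdsWithin_le_nhds
        rwa [mul_zero] at this
      · filter_upwards [eventually_pos] with y hy
        exact mul_pos (by positivity) hy
    filter_upwards [htend.eventually hev, eventually_pos, eventually_small he0,
      eventually_small_mul 4 hτ, eventually_small_mul (4 / K) hτ, eventually_small_mul 2 he0]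
      with y h1 hy0 hye _ hyτ hye2
    have hKy : K * (2 / K * y) / 2 = y := by field_simp
    have h2 := h1 (-y) (by rw [hKy, abs_neg, abs_of_pos hy0]) (fun z hz => by
      rw [hKy] at hz
      have h3 := abs_le.1 hz
      have h4 := hback (2 / K * y) (by positivity) (by
        rw [show 4 / K * y = 2 * (2 / K * y) by ring] at hyτ
        linarith) (x₀ + z) (by linarith) (by linarith)
      have : 0 ≤ a / 2 / 4 * (2 / K * y) := by positivity
      linarith)
    rw [← sub_eq_add_neg] at h2
    have h5 : a / 2 / 2 * (2 / K * y) = a / 2 / K * y := by field_simp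
    linarith
  obtain ⟨y₀, hy₀, hdrop⟩ := mem_nhdsGT_iff_exists_Ioc_subset.1 hdrop
  have hγ : 0 < a / 2 / K := by positivity
  have hneg : ∀ y, 0 < y → y ≤ min y₀ e → F t₀ (x₀ - y) ≤ F t₀ x₀ - a / 2 / K * y :=
    fun y h1 h2 => hdrop ⟨h1, h2.trans (min_le_left _ _)⟩
  refine hF.no_concave_kink (x₀ := x₀) bF htT hτ hτt hlip hγ hγ hC (lt_min hy₀ he0) (fun y hy => ?_)
    (fun y h1 h2 => ?_)
  · have h0 : 0 ≤ C * y ^ 2 := by positivity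
    rcases lt_or_ge y 0 with h | h
    · rw [abs_of_neg h] at hy
      have := hneg (-y) (by linarith) hy
      rw [sub_neg_eq_add] at this
      linarith
    · have := htouch y (hy.trans (min_le_right _ _))
      have h2 : 0 ≤ a / 2 / K * y := by positivity
      linarith
  · have h3 := htouch y (by rw [abs_of_pos h1]; exact h2.trans (min_le_right _ _))
    have h0 : 0 ≤ C * y ^ 2 := by positivity
    linarith [hneg y h1 h2]

/-- The subsolution inequality holds when touching from above takes place separately in the
past of the time variable and in the space variable. -/
theorem PastSub.separate {T M τ t₀ x₀ a p C r ρ : ℝ} {F : ℝ → ℝ → ℝ} (hF : PastSub T F)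
    (hF' : PastSub T (dual F)) (bF : BddUC M F) (ht₀ : 0 < t₀) (htT : t₀ ≤ T) (hτ : 0 < τ)
    (hC : 0 ≤ C) (hρ : 0 < ρ) (hρr : ρ < r)
    (ht : ∀ t, t₀ - τ ≤ t → t ≤ t₀ → F t x₀ ≤ F t₀ x₀ + a * (t - t₀))
    (hx : ∀ y, |y| ≤ r → F t₀ (x₀ + y) ≤ F t₀ x₀ + p * y + C * y ^ 2) :
    a + max p 0 * (cutOp ρ (F t₀) x₀ - 2 * C * ρ) ≤ 0 := by
  wlog hτt : τ ≤ t₀ / 2 generalizing τ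
  · exact this (half_pos ht₀) (fun t h1 h2 => ht t (by linarith) h2) le_rfl
  have hM := bF.nonneg
  have bF' : BddUC (M + 1) F := bF.mono (by linarith)
  obtain ⟨L, hL⟩ : ∃ L, L = 2 * (M + 1) / (t₀ / 2) := ⟨_, rfl⟩
  have hL0 : 0 < L := by rw [hL]; positivity
  have hlip : ∀ s t x, t₀ / 2 ≤ s → s ≤ t → t ≤ t₀ → |F s x - F t x| ≤ L * (t - s) :=
    fun s t x h1 h2 h3 => by
      have h4 := hF.time_lip hF' bF' (by linarith) h2 (h3.trans htT) x
      rw [abs_sub_comm]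
      refine h4.trans ?_
      rw [hL]
      have := sub_nonneg.2 h2
      gcongr
  have hlip' : ∀ t x, t₀ - τ ≤ t → t ≤ t₀ → |F t x - F t₀ x| ≤ L * (t₀ - t) :=
    fun t x h1 h2 => hlip t t₀ x (by linarith) h2 le_rfl
  rcases le_or_gt p 0 with hp | hp
  · rw [max_eq_right hp, zero_mul, add_zero]
    exact hF.separate_nonpos bF htT hτ (by linarith) hp hC hL0.le (hρ.trans hρr) hlip' ht hx
  rw [max_eq_left hp.le]
  by_contra! hpos
  obtain ⟨ε, hε⟩ : ∃ ε, a + p * (cutOp ρ (F t₀) x₀ - 2 * C * ρ) = 2 * ε :=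
    ⟨(a + p * (cutOp ρ (F t₀) x₀ - 2 * C * ρ)) / 2, by ring⟩
  have hε0 : 0 < ε := by linarith
  obtain ⟨B, hB⟩ : ∃ B, B = Real.sqrt (4 * (M + 1) * T) := ⟨_, rfl⟩
  have hT0 : 0 < T := ht₀.trans_le htT
  have hB0 : 0 < B := by rw [hB]; positivity
  have hB2 : 4 * (M + 1) * T ≤ B ^ 2 := by rw [hB, Real.sq_sqrt (by positivity)]
  have hslope : ∀ t x y, t₀ / 2 ≤ t → t ≤ t₀ → x ≤ y → F t y - F t x ≤ B / (t₀ / 2) * (y - x) :=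
    fun t x y h1 h2 h3 => by
      have h4 := hF.slope_bound hF' bF' (by linarith) hT0 hB0 hB2 (t₁ := t) (by linarith)
        (h2.trans htT) h3
      refine h4.trans ?_
      have := sub_nonneg.2 h3
      gcongr
  have hlip'' : ∀ t x, t₀ - τ ≤ t → t ≤ t₀ → F t x ≤ F t₀ x + L * (t₀ - t) :=
    fun t x h1 h2 => by linarith [(abs_le.1 (hlip' t x h1 h2)).2]
  have ho : ∀ ζ > 0, ∃ y₀ > 0, ∀ y, |y| ≤ y₀ → |F t₀ (x₀ + y) - F t₀ x₀ - p * y| ≤ ζ * |y| :=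
    fun ζ hζ => hF.differentiable_touch bF htT hτ (by linarith) hp hC
      (C₁ := B / (t₀ / 2)) (by positivity) (hρ.trans hρr) hx hlip''
      (fun x y h => hslope t₀ x y (by linarith) le_rfl h) hζ
  obtain ⟨K, hK, hev⟩ := hF.barrier bF htT hτ (by linarith) hp.le hC hε0 hL0.le hρ hρr hx hlip''
    hε.ge
  have hev2 := hF.slope_before hF' bF (by linarith) (half_lt_self ht₀) htT hp hL0
    (C₁ := B / (t₀ / 2)) (by positivity) hlip hslope ho (K := K) (δ := ε / 4 / K) (by positivity)
  have hdrop : ∀ᶠ y in 𝓝[>] (0 : ℝ), F t₀ (x₀ + y) ≤ F t₀ x₀ + p * y - ε / K * y := by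
    have htend : Tendsto (fun y : ℝ => 2 / K * y) (𝓝[>] 0) (𝓝[>] 0) := by
      refine tendsto_nhdsWithin_iff.2 ⟨?_, ?_⟩
      · have : Tendsto (fun y : ℝ => 2 / K * y) (𝓝[>] 0) (𝓝 (2 / K * 0)) :=
          Tendsto.mono_left (Continuous.tendsto (by fun_prop) 0) nhdsWithin_le_nhds
        rwa [mul_zero] at this
      · filter_upwards [eventually_pos] with y hy
        exact mul_pos (by positivity) hy
    filter_upwards [htend.eventually hev, htend.eventually hev2, eventually_pos,
      eventually_small_mul (2 / K) hτ] with y h1 h2 hy0 hyτ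
    have hKy : K * (2 / K * y) = 2 * y := by field_simp
    have hΔ0 : 0 < 2 / K * y := by positivity
    have h5 : ε / 2 * (2 / K * y) = ε / K * y := by field_simp
    have h6 : ε / 4 / K * (2 * y) = ε / 4 * (2 / K * y) := by field_simp
    rw [hKy] at h1 h2
    rw [mul_div_cancel_left₀ y two_ne_zero] at h1
    have h3 := h1 y (abs_of_pos hy0) (fun z hz => by
      have h7 := abs_le.1 hz
      have h8 := h2 z (by linarith) (by linarith)
      have h9 := ht (t₀ - 2 / K * y) (by linarith) (by linarith)
      have h10 : ε / 4 / K * z ≤ ε / 4 / K * (2 * y) := by gcongr; linarith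
      linarith)
    linarith
  obtain ⟨y₀, hy₀, hdrop⟩ := mem_nhdsGT_iff_exists_Ioc_subset.1 hdrop
  refine hF.no_concave_kink (x₀ := x₀) bF htT hτ (by linarith) hlip' hp (show 0 < ε / K by positivity) hC
    (lt_min hy₀ (hρ.trans hρr)) (fun y hy => hx y (hy.trans (min_le_right _ _)))
    (fun y h1 h2 => ?_)
  have h3 : F t₀ (x₀ + y) ≤ F t₀ x₀ + p * y - ε / K * y :=
    hdrop ⟨h1, h2.trans (min_le_left _ _)⟩
  have h4 := hx (-y) (by rw [abs_neg, abs_of_pos h1]; exact h2.trans (min_le_right _ _))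
  rw [← sub_eq_add_neg] at h4
  have h0 : 0 ≤ C * y ^ 2 := by positivity
  linarith

theorem setIntegral_eq_cutOp {M ε : ℝ} (hε : 0 < ε) {f : ℝ → ℝ} (hf : Continuous f)
    (hM : ∀ x, |f x| ≤ M) (x : ℝ) :
    ∫ y in {y : ℝ | ε ≤ |x - y|}, (f x - f y) / (x - y) ^ 2 = cutOp ε f x := by
  have hset : ∀ x : ℝ, MeasurableSet {y : ℝ | ε ≤ |x - y|} := fun x =>
    (isClosed_le continuous_const (by fun_prop)).measurableSet
  have hset' : MeasurableSet {z : ℝ | ε ≤ |z|} :=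
    (isClosed_le continuous_const (by fun_prop)).measurableSet
  have h1 : ∫ y in {y : ℝ | ε ≤ |x - y|}, (f x - f y) / (x - y) ^ 2 =
      ∫ z in {z : ℝ | ε ≤ |z|}, (f x - f (x - z)) / z ^ 2 := by
    rw [← integral_indicator (hset x), ← integral_indicator hset',
      ← integral_sub_left_eq_self (indicator {z : ℝ | ε ≤ |z|} _) volume x]
    congr 1
    funext y
    by_cases hy : ε ≤ |x - y|
    · rw [indicator_of_mem (by exact hy), indicator_of_mem (by exact hy), sub_sub_cancel]
    · rw [indicator_of_notMem (by exact hy), indicator_of_notMem (by exact hy)]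
  have h2 : {z : ℝ | ε ≤ |z|} = Iic (-ε) ∪ Ici ε := by
    ext z
    simp only [mem_ofPred_eq, mem_union, mem_Iic, mem_Ici, le_abs]
    constructor
    · rintro (h | h)
      · exact Or.inr h
      · exact Or.inl (by linarith)
    · rintro (h | h)
      · exact Or.inr (by linarith)
      · exact Or.inl h
  have hb : ∀ s : ℝ, ∀ z, |f x - f (x + s * z)| ≤ 2 * M := fun s z => by
    have h1 := abs_le.1 (hM x)
    have h2 := abs_le.1 (hM (x + s * z))
    exact abs_le.2 ⟨by linarith, by linarith⟩
  have hI : ∀ s : ℝ, IntegrableOn (fun z => (f x - f (x + s * z)) / z ^ 2) (Ioi ε) := fun s =>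
    integrableOn_tail hε (by fun_prop) (hb s)
  have hR : IntegrableOn (fun z => (f x - f (x - z)) / z ^ 2) (Ici ε) := by
    rw [integrableOn_Ici_iff_integrableOn_Ioi]
    refine (hI (-1)).congr_fun (fun z _ => ?_) measurableSet_Ioi
    simp only [neg_mul, one_mul, ← sub_eq_add_neg]
  have hL : IntegrableOn (fun z => (f x - f (x - z)) / z ^ 2) (Iic (-ε)) := by
    have h4 : IntegrableOn (fun z => (f x - f (x + 1 * z)) / z ^ 2) (Ici (-(-ε))) := by
      rw [neg_neg, integrableOn_Ici_iff_integrableOn_Ioi]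
      exact hI 1
    refine h4.comp_neg_Iic.congr_fun (fun z _ => ?_) measurableSet_Iic
    simp only [one_mul, neg_sq, ← sub_eq_add_neg]
  rw [h1, h2, setIntegral_union (Set.disjoint_left.2 fun z hz1 hz2 => by
      rw [mem_Iic] at hz1; rw [mem_Ici] at hz2; linarith) measurableSet_Ici hL hR,
    integral_Ici_eq_integral_Ioi, ← integral_comp_neg_Ioi]
  have h3 : cutOp ε f x = (∫ z in Ioi ε, (f x - f (x + 1 * z)) / z ^ 2) +
      ∫ z in Ioi ε, (f x - f (x + -1 * z)) / z ^ 2 := by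
    rw [← integral_add (hI 1) (hI (-1))]
    unfold cutOp tailInt
    refine setIntegral_congr_fun measurableSet_Ioi fun z _ => ?_
    simp only [one_mul, neg_mul, ← sub_eq_add_neg]
    rw [← add_div]
    congr 1
    ring
  rw [h3]
  simp only [one_mul, neg_mul, ← sub_eq_add_neg, neg_sq, sub_neg_eq_add]

theorem cutOp_sub_cutOp_mem {M C r R : ℝ} {f : ℝ → ℝ} (hf : Continuous f)
    (hM : ∀ x, |f x| ≤ M) {x : ℝ} (hC : 0 ≤ C)
    (h : ∀ z, |2 * f x - f (x + z) - f (x - z)| ≤ 2 * C * z ^ 2) (hr : 0 < r) (hR : r ≤ R) :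
    cutOp r f x - cutOp R f x ≤ 2 * C * (R - r) ∧ -(2 * C * R) ≤ cutOp r f x - cutOp R f x := by
  have hk := continuous_second_diff hf x
  have h2 : cutOp r f x = _ + cutOp R f x := tailInt_split hr hR hk (abs_second_diff_le hM x)
  have h3 : ∫ z in Ioc r R, (2 * f x - f (x + z) - f (x - z)) / z ^ 2 ≤
      ∫ _ in Ioc r R, 2 * C := by
    refine setIntegral_mono_on (integrableOn_mid hr hk) continuous_const.integrableOn_Ioc
      measurableSet_Ioc fun z hz => ?_
    have : 0 < z := hr.trans hz.1
    rw [div_le_iff₀ (by positivity)]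
    exact (abs_le.1 (h z)).2
  rw [setIntegral_const, Measure.real, Real.volume_Ioc, ENNReal.toReal_ofReal (by linarith),
    smul_eq_mul] at h3
  have h4 := le_integral_mid hr hR hk (b := 0) (c := 2 * C) (by positivity)
    (fun z _ _ => by linarith [(abs_le.1 (h z)).1]) le_rfl
  rw [zero_div] at h4
  constructor <;> linarith

theorem exists_tendsto_cutOp {M C : ℝ} {f : ℝ → ℝ} (hf : Continuous f)
    (hM : ∀ x, |f x| ≤ M) {x : ℝ} (hC : 0 ≤ C)
    (h : ∀ z, |2 * f x - f (x + z) - f (x - z)| ≤ 2 * C * z ^ 2) :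
    ∃ ℓ, Tendsto (fun ρ => cutOp ρ f x) (𝓝[>] 0) (𝓝 ℓ) := by
  have hup : ∀ r R, 0 < r → r ≤ R → cutOp r f x - cutOp R f x ≤ 2 * C * (R - r) ∧
      -(2 * C * R) ≤ cutOp r f x - cutOp R f x := fun r R hr hR =>
    cutOp_sub_cutOp_mem hf hM hC h hr hR
  have hmono : MonotoneOn (fun ρ => cutOp ρ f x + 2 * C * ρ) (Ioo 0 1) := fun r hr R _ hrR => by
    have := (hup r R hr.1 hrR).1
    simp only
    linarith
  have hbd : BddBelow ((fun ρ => cutOp ρ f x + 2 * C * ρ) '' Ioo 0 1) :=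
    ⟨cutOp 1 f x - 2 * C, by
      rintro _ ⟨ρ, hρ, rfl⟩
      have h1 := (hup ρ 1 hρ.1 hρ.2.le).2
      have h2 : 0 ≤ C * ρ := mul_nonneg hC hρ.1.le
      simp only
      linarith⟩
  have h1 := hmono.tendsto_nhdsWithin_Ioo_right (by norm_num) hbd
  have h2 : Tendsto (fun ρ : ℝ => 2 * C * ρ) (𝓝[>] 0) (𝓝 (2 * C * 0)) :=
    Tendsto.mono_left (Continuous.tendsto (by fun_prop) 0) nhdsWithin_le_nhds
  exact ⟨_, (h1.sub h2).congr fun ρ => by ring⟩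

theorem abs_taylor_le {f : ℝ → ℝ} (hf : Differentiable ℝ f) (hf' : Differentiable ℝ (deriv f))
    {K : ℝ} (hK : ∀ x, |deriv (deriv f) x| ≤ K) (x y : ℝ) :
    |f (x + y) - f x - deriv f x * y| ≤ K * y ^ 2 := by
  have hK0 : 0 ≤ K := (abs_nonneg _).trans (hK 0)
  have h1 : ∀ w ∈ uIcc x (x + y), |deriv f w - deriv f x| ≤ K * |y| := fun w hw => by
    have h2 := convex_univ.norm_image_sub_le_of_norm_deriv_le (f := deriv f) (C := K)
      (fun z _ => hf' z) (fun z _ => hK z) (mem_univ x) (mem_univ w)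
    refine h2.trans ?_
    have h3 := abs_sub_left_of_mem_uIcc hw
    rw [add_sub_cancel_left] at h3
    exact mul_le_mul_of_nonneg_left h3 hK0
  have h2 := (convex_uIcc x (x + y)).norm_image_sub_le_of_norm_hasDerivWithin_le
    (f := fun w => f w - deriv f x * w) (f' := fun w => deriv f w - deriv f x) (C := K * |y|)
    (fun w _ => by
      have := ((hf w).hasDerivAt.sub ((hasDerivAt_id w).const_mul (deriv f x))).hasDerivWithinAt
        (s := uIcc x (x + y))
      rw [mul_one] at this
      exact this) h1 left_mem_uIcc right_mem_uIcc
  rw [Real.norm_eq_abs, Real.norm_eq_abs, add_sub_cancel_left, mul_assoc, abs_mul_abs_self] at h2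
  rw [sq]
  refine le_trans (le_of_eq ?_) h2
  congr 1
  ring

theorem second_diff_le_of_taylor {f : ℝ → ℝ} {x p K : ℝ}
    (h : ∀ y, |f (x + y) - f x - p * y| ≤ K * y ^ 2) (z : ℝ) :
    |2 * f x - f (x + z) - f (x - z)| ≤ 2 * K * z ^ 2 := by
  have h1 := abs_le.1 (h z)
  have h2 := abs_le.1 (h (-z))
  rw [← sub_eq_add_neg] at h2
  exact abs_le.2 ⟨by linarith, by linarith⟩

theorem TestFun.continuous {φ : ℝ → ℝ → ℝ} (h : TestFun φ) (t : ℝ) : Continuous (φ t) :=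
  (show Differentiable ℝ (φ t) from (h.2 t).2.1).continuous

theorem TestFun.taylor {φ : ℝ → ℝ → ℝ} (h : TestFun φ) (t : ℝ) :
    ∃ K, 0 ≤ K ∧ ∀ x y, |φ t (x + y) - φ t x - deriv (φ t) x * y| ≤ K * y ^ 2 := by
  obtain ⟨-, h1, h2, K, hK⟩ := h.2 t
  exact ⟨K, (abs_nonneg _).trans (hK 0), abs_taylor_le h1 h2 hK⟩

theorem TestFun.tendsto_cutOp {φ : ℝ → ℝ → ℝ} (h : TestFun φ) (t x : ℝ) :
    Tendsto (fun ρ => cutOp ρ (φ t) x) (𝓝[>] 0) (𝓝 (HTilde (φ t) x)) := by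
  obtain ⟨K, hK0, hK⟩ := h.taylor t
  obtain ⟨M, hM⟩ := (h.2 t).1
  obtain ⟨ℓ, hℓ⟩ := exists_tendsto_cutOp (h.continuous t) hM hK0
    (second_diff_le_of_taylor (hK x))
  have h1 : HTilde (φ t) x = ℓ := by
    refine Tendsto.limUnder_eq (hℓ.congr' ?_)
    filter_upwards [eventually_pos] with ρ hρ
    exact (setIntegral_eq_cutOp hρ (h.continuous t) hM x).symm
  rwa [h1]

theorem deriv_dual (φ : ℝ → ℝ → ℝ) (t x : ℝ) : deriv (dual φ t) x = deriv (φ t) (-x) := by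
  unfold dual
  rw [deriv.fun_neg, deriv_comp_neg, neg_neg]

theorem TestFun.dual {φ : ℝ → ℝ → ℝ} (h : TestFun φ) : TestFun (dual φ) := by
  have hd : ∀ t, deriv (_root_.dual φ t) = fun x => deriv (φ t) (-x) := fun t =>
    funext fun x => deriv_dual φ t x
  refine ⟨fun x => (h.1 (-x)).neg, fun t => ?_⟩
  obtain ⟨⟨M, hM⟩, h1, h2, K, hK⟩ := h.2 t
  refine ⟨⟨M, fun x => by simpa [_root_.dual] using hM (-x)⟩, fun x => ?_, fun x => ?_,
    K, fun x => ?_⟩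
  · exact ((h1 (-x)).comp x differentiableAt_id.neg).neg
  · rw [hd]
    exact (h2 (-x)).comp x differentiableAt_id.neg
  · rw [hd, deriv_comp_neg, abs_neg]
    exact hK (-x)

theorem TestFun.hTilde_dual {φ : ℝ → ℝ → ℝ} (h : TestFun φ) (t x : ℝ) :
    HTilde (_root_.dual φ t) x = -HTilde (φ t) (-x) := by
  refine tendsto_nhds_unique (h.dual.tendsto_cutOp t x) ?_
  exact (h.tendsto_cutOp t (-x)).neg.congr fun ρ => (cutOp_dual φ ρ t x).symm

theorem IsSubsolution.dual {F : ℝ → ℝ → ℝ} (h : IsSubsolution HTilde F)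
    (hF : ContinuousOn (fun p : ℝ × ℝ => F p.1 p.2) (Ici 0 ×ˢ univ)) :
    IsSupersolution HTilde (dual F) := by
  refine ⟨ContinuousOn.lowerSemicontinuousOn ?_, fun φ hφ t₀ x₀ ht₀ hmin => ?_⟩
  · exact (hF.comp (f := fun p : ℝ × ℝ => (p.1, -p.2)) (by fun_prop)
      fun p hp => ⟨hp.1, mem_univ _⟩).neg
  have := h.2 _ hφ.dual t₀ (-x₀) ht₀ (fun t x ht hne => by
    have := hmin t (-x) ht (fun h => hne (by
      simp only [Prod.mk.injEq] at h ⊢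
      exact ⟨h.1, by linarith [h.2]⟩))
    simp only [_root_.dual, neg_neg] at this ⊢
    linarith)
  rw [deriv_dual, hφ.hTilde_dual, neg_neg] at this
  simp only [_root_.dual, neg_neg, deriv.fun_neg] at this
  linarith

theorem IsSupersolution.dual {F : ℝ → ℝ → ℝ} (h : IsSupersolution HTilde F)
    (hF : ContinuousOn (fun p : ℝ × ℝ => F p.1 p.2) (Ici 0 ×ˢ univ)) :
    IsSubsolution HTilde (dual F) := by
  refine ⟨ContinuousOn.upperSemicontinuousOn ?_, fun φ hφ t₀ x₀ ht₀ hmax => ?_⟩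
  · exact (hF.comp (f := fun p : ℝ × ℝ => (p.1, -p.2)) (by fun_prop)
      fun p hp => ⟨hp.1, mem_univ _⟩).neg
  have := h.2 _ hφ.dual t₀ (-x₀) ht₀ (fun t x ht hne => by
    have := hmax t (-x) ht (fun h => hne (by
      simp only [Prod.mk.injEq] at h ⊢
      exact ⟨h.1, by linarith [h.2]⟩))
    simp only [_root_.dual, neg_neg] at this ⊢
    linarith)
  rw [deriv_dual, hφ.hTilde_dual, neg_neg] at this
  simp only [_root_.dual, neg_neg, deriv.fun_neg] at this
  linarith

theorem IsSupersolution.congr {Op : (ℝ → ℝ) → ℝ → ℝ} {F G : ℝ → ℝ → ℝ}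
    (h : IsSupersolution Op F) (hFG : ∀ t x, 0 ≤ t → F t x = G t x) : IsSupersolution Op G := by
  refine ⟨fun q hq => LowerSemicontinuousWithinAt.congr_of_eventuallyEq (h.1 q hq) hq
    (eventually_mem_nhdsWithin.mono fun w hw => hFG w.1 w.2 hw.1), fun φ hφ t₀ x₀ ht₀ hmin => ?_⟩
  refine h.2 φ hφ t₀ x₀ ht₀ fun t x ht hne => ?_
  rw [hFG t x ht, hFG t₀ x₀ ht₀.le]
  exact hmin t x ht hne

theorem lscEnv_eq {F : ℝ → ℝ → ℝ}
    (hF : ContinuousOn (fun p : ℝ × ℝ => F p.1 p.2) (Ici 0 ×ˢ univ)) {t : ℝ} (ht : 0 ≤ t) (x : ℝ) :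
    lscEnv F t x = F t x := by
  have hm : (t, x) ∈ (Ici 0 ×ˢ univ : Set (ℝ × ℝ)) := ⟨ht, mem_univ _⟩
  have : (𝓝[Ici 0 ×ˢ univ] (t, x)).NeBot := mem_closure_iff_nhdsWithin_neBot.1 (subset_closure hm)
  exact (hF (t, x) hm).liminf_eq

/-- Past subsolutions satisfy the viscosity inequality for test functions which are merely
separately regular in time and space. -/
theorem PastSub.isSubsolution {M : ℝ} {F : ℝ → ℝ → ℝ} (hF : ∀ T, PastSub T F)
    (hF' : ∀ T, PastSub T (dual F)) (bF : BddUC M F) : IsSubsolution HTilde F := by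
  refine ⟨bF.continuous₂.continuousOn.upperSemicontinuousOn, fun φ hφ t₀ x₀ ht₀ hmax => ?_⟩
  have hmax' : ∀ t x, 0 ≤ t → F t x - φ t x ≤ F t₀ x₀ - φ t₀ x₀ := fun t x ht => by
    by_cases h : (t, x) = (t₀, x₀)
    · rw [Prod.mk.injEq] at h
      rw [h.1, h.2]
    · exact (hmax t x ht h).le
  obtain ⟨K, hK0, hK⟩ := hφ.taylor t₀
  obtain ⟨Mφ, hM⟩ := (hφ.2 t₀).1
  have htime : HasDerivAt (fun t => φ t x₀) (deriv (fun t => φ t x₀) t₀) t₀ :=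
    ((hφ.1 x₀).differentiable (by norm_num) t₀).hasDerivAt
  generalize deriv (fun t => φ t x₀) t₀ = a at htime ⊢
  obtain ⟨p, hp⟩ : ∃ p, p = deriv (φ t₀) x₀ := ⟨_, rfl⟩
  rw [← hp]
  have hlim := hφ.tendsto_cutOp t₀ x₀
  suffices H : ∀ ζ > 0, a + max p 0 * HTilde (φ t₀) x₀ ≤ ζ from
    le_of_forall_pos_le_add fun ζ hζ => by simpa using H ζ hζ
  intro ζ hζ
  have h1 : Tendsto (fun ρ => a + max p 0 * (cutOp ρ (φ t₀) x₀ - 2 * K * ρ)) (𝓝[>] 0)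
      (𝓝 (a + max p 0 * (HTilde (φ t₀) x₀ - 2 * K * 0))) :=
    ((hlim.sub (Tendsto.mono_left (Continuous.tendsto (by fun_prop) 0)
      nhdsWithin_le_nhds)).const_mul _).const_add _
  rw [mul_zero, sub_zero] at h1
  refine le_of_tendsto h1 ?_
  obtain ⟨d, hd, hd'⟩ := Metric.eventually_nhds_iff.1
    ((hasDerivAt_iff_isLittleO.1 htime).def hζ)
  filter_upwards [eventually_pos, eventually_small one_pos] with ρ hρ hρ1
  have h2 := (hF t₀).separate (hF' t₀) bF ht₀ le_rfl (τ := min (d / 2) t₀) (a := a - ζ) (p := p)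
    (x₀ := x₀) (r := 1) (by positivity) hK0 hρ hρ1 (fun t h3 h4 => by
      have h5 := min_le_left (d / 2) t₀
      have h6 := min_le_right (d / 2) t₀
      have h7 := hd' (show dist t t₀ < d by
        rw [Real.dist_eq]; exact abs_lt.2 ⟨by linarith, by linarith⟩)
      rw [Real.norm_eq_abs, Real.norm_eq_abs, smul_eq_mul,
        abs_of_nonpos (show t - t₀ ≤ 0 by linarith)] at h7
      linarith [(abs_le.1 h7).2, hmax' t x₀ (by linarith)]) (fun y _ => by
      have h5 := (abs_le.1 (hK x₀ y)).2
      rw [← hp] at h5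
      linarith [hmax' t₀ (x₀ + y) ht₀.le])
  have h3 : cutOp ρ (φ t₀) x₀ ≤ cutOp ρ (F t₀) x₀ := by
    refine tailInt_mono hρ (continuous_second_diff (hφ.continuous t₀) x₀)
      (abs_second_diff_le hM x₀) (continuous_second_diff (bF.slice t₀) x₀)
      (abs_second_diff_le (bF.bdd t₀) x₀) fun z _ => ?_
    linarith [hmax' t₀ (x₀ + z) ht₀.le, hmax' t₀ (x₀ - z) ht₀.le]
  have h4 : max p 0 * (cutOp ρ (φ t₀) x₀ - 2 * K * ρ) ≤
      max p 0 * (cutOp ρ (F t₀) x₀ - 2 * K * ρ) := by gcongr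
  linarith

open Manifold in
theorem exists_contDiff_ge {m : ℝ → ℝ} (h : ∀ T, ∃ B, ∀ t, 0 ≤ t → t ≤ T → m t ≤ B) :
    ∃ N : ℝ → ℝ, ContDiff ℝ 1 N ∧ ∀ t, 0 ≤ t → m t ≤ N t := by
  obtain ⟨g, hg⟩ := exists_contMDiffMap_forall_mem_convex_of_local_const (n := 1) 𝓘(ℝ, ℝ)
    (t := fun x => {y : ℝ | 0 ≤ x → m x ≤ y})
    (fun x => by
      by_cases hx : 0 ≤ x
      · simp only [hx, forall_const]
        exact convex_Ici (m x)
      · simpa [hx] using convex_univ) (fun x => by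
      obtain ⟨B, hB⟩ := h (x + 1)
      exact ⟨B, (gt_mem_nhds (show x < x + 1 by linarith)).mono fun y hy hy0 => hB y hy0 hy.le⟩)
  exact ⟨g, g.contMDiff.contDiff, fun t ht => hg t ht⟩

theorem contDiff_two_of_hasDerivAt {g g' g'' : ℝ → ℝ} (h1 : ∀ x, HasDerivAt g (g' x) x)
    (h2 : ∀ x, HasDerivAt g' (g'' x) x) (h3 : Continuous g'') : ContDiff ℝ 2 g := by
  have e1 : deriv g = g' := funext fun x => (h1 x).deriv
  have e2 : deriv g' = g'' := funext fun x => (h2 x).deriv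
  rw [show (2 : WithTop ℕ∞) = 1 + 1 by norm_num, contDiff_succ_iff_deriv]
  refine ⟨fun x => (h1 x).differentiableAt, by simp, ?_⟩
  rw [e1, contDiff_one_iff_deriv, e2]
  exact ⟨fun x => (h2 x).differentiableAt, h3⟩

/-- Approximation by double Steklov averages. -/
theorem exists_contDiff_approx {M e : ℝ} {f : ℝ → ℝ} (hf : UniformContinuous f)
    (hM : ∀ x, |f x| ≤ M) (he : 0 < e) :
    ∃ g : ℝ → ℝ, ContDiff ℝ 2 g ∧ (∀ x, |g x - f x| ≤ e) ∧
      ∃ K, ∀ x, |deriv (deriv g) x| ≤ K := by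
  obtain ⟨d, hd, H⟩ := Metric.uniformContinuous_iff.1 hf e he
  obtain ⟨δ, hδ, hδd⟩ : ∃ δ > 0, 2 * δ < d := ⟨d / 4, by positivity, by linarith⟩
  have hfc := hf.continuous
  obtain ⟨P, hP⟩ : ∃ P : ℝ → ℝ, ∀ x, HasDerivAt P (f x) x :=
    ⟨fun x => ∫ y in (0 : ℝ)..x, f y, fun x => hfc.integral_hasStrictDerivAt 0 x |>.hasDerivAt⟩
  have hPc : Continuous P := continuous_iff_continuousAt.2 fun x => (hP x).continuousAt
  obtain ⟨Q, hQ⟩ : ∃ Q : ℝ → ℝ, ∀ x, HasDerivAt Q (P x) x :=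
    ⟨fun x => ∫ y in (0 : ℝ)..x, P y, fun x => hPc.integral_hasStrictDerivAt 0 x |>.hasDerivAt⟩
  have step : ∀ {R R' : ℝ → ℝ}, (∀ x, HasDerivAt R (R' x) x) → ∀ x,
      HasDerivAt (fun x => (R (x + 2 * δ) - 2 * R (x + δ) + R x) / δ ^ 2)
        ((R' (x + 2 * δ) - 2 * R' (x + δ) + R' x) / δ ^ 2) x := fun hR x =>
    ((((hR (x + 2 * δ)).comp_add_const x (2 * δ)).sub
      (((hR (x + δ)).comp_add_const x δ).const_mul 2)).add (hR x)).div_const _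
  have h1 := step hQ
  have h2 := step hP
  refine ⟨_, contDiff_two_of_hasDerivAt h1 h2 (by fun_prop), fun x => ?_, 4 * M / δ ^ 2,
    fun x => ?_⟩
  · have hmod : ∀ s ∈ Icc 0 (2 * δ), |f (x + s) - f x| ≤ e := fun s hs => by
      have := H (a := x + s) (b := x) (by
        rw [Real.dist_eq, add_sub_cancel_left, abs_of_nonneg hs.1]
        linarith [hs.2])
      exact this.le
    have hA : ∀ s ∈ Icc 0 δ, |(P (x + (s + δ)) - P (x + s)) - f x * δ| ≤ e * δ := fun s hs => by
      have := (convex_Icc s (s + δ)).norm_image_sub_le_of_norm_hasDerivWithin_le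
        (f := fun w => P (x + w) - f x * w) (f' := fun w => f (x + w) - f x * 1) (C := e)
        (fun w _ => (((hP (x + w)).comp_const_add x w).sub
          ((hasDerivAt_id w).const_mul (f x))).hasDerivWithinAt)
        (fun w hw => by
          rw [mul_one]
          exact hmod w ⟨hs.1.trans hw.1, by linarith [hw.2, hs.2]⟩)
        (left_mem_Icc.2 (by linarith)) (right_mem_Icc.2 (by linarith))
      rw [Real.norm_eq_abs, Real.norm_eq_abs, add_sub_cancel_left, abs_of_pos hδ] at this
      refine le_trans (le_of_eq ?_) this
      congr 1
      ring
    have hB := (convex_Icc 0 δ).norm_image_sub_le_of_norm_hasDerivWithin_le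
      (f := fun s => Q (x + δ + s) - Q (x + s) - f x * δ * s)
      (f' := fun s => P (x + δ + s) - P (x + s) - f x * δ * 1) (C := e * δ)
      (fun s _ => ((((hQ (x + δ + s)).comp_const_add (x + δ) s).sub
        ((hQ (x + s)).comp_const_add x s)).sub
          ((hasDerivAt_id s).const_mul (f x * δ))).hasDerivWithinAt)
      (fun s hs => by
        have := hA s hs
        rw [mul_one, Real.norm_eq_abs, show x + δ + s = x + (s + δ) by ring]
        exact this)
      (left_mem_Icc.2 hδ.le) (right_mem_Icc.2 hδ.le)
    rw [Real.norm_eq_abs, Real.norm_eq_abs, sub_zero, abs_of_pos hδ] at hB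
    rw [← sub_eq_zero.1 (show (Q (x + 2 * δ) - 2 * Q (x + δ) + Q x - f x * δ ^ 2) / δ ^ 2 -
      ((Q (x + 2 * δ) - 2 * Q (x + δ) + Q x) / δ ^ 2 - f x) = 0 by field_simp; ring), abs_div,
      abs_of_pos (show 0 < δ ^ 2 by positivity), div_le_iff₀ (by positivity)]
    rw [show x + 2 * δ = x + δ + δ by ring]
    refine le_trans (le_of_eq ?_) (hB.trans (le_of_eq (by ring)))
    congr 1
    rw [add_zero, add_zero]
    ring
  · rw [show deriv (fun x => (Q (x + 2 * δ) - 2 * Q (x + δ) + Q x) / δ ^ 2) = _ from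
      funext fun y => (h1 y).deriv, (h2 x).deriv, abs_div,
      abs_of_pos (show 0 < δ ^ 2 by positivity)]
    gcongr
    have a1 := abs_le.1 (hM (x + 2 * δ))
    have a2 := abs_le.1 (hM (x + δ))
    have a3 := abs_le.1 (hM x)
    exact abs_le.2 ⟨by linarith, by linarith⟩

/-- Comparison of the truncated operator of a function with that of a function touching it
from above up to a small error. -/
theorem cutOp_le_of_touch {M M' ρ σ p C e : ℝ} {f g : ℝ → ℝ} (hf : Continuous f)
    (hM : ∀ x, |f x| ≤ M) (hg : Continuous g) (hM' : ∀ x, |g x| ≤ M') {x : ℝ} (hσ : 0 < σ)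
    (hσρ : σ ≤ ρ) (hC : 0 ≤ C) (hx : g x = f x)
    (h1 : ∀ y, |y| ≤ ρ → g (x + y) ≤ f x + p * y + C * y ^ 2)
    (h2 : ∀ y, ρ < |y| → g (x + y) ≤ f (x + y) + e) :
    cutOp ρ f x - 2 * e / ρ - 2 * C * ρ ≤ cutOp σ g x := by
  have hρ : 0 < ρ := hσ.trans_le hσρ
  have hgk := continuous_second_diff hg x
  have h3 : cutOp σ g x = _ + cutOp ρ g x := tailInt_split hσ hσρ hgk (abs_second_diff_le hM' x)
  have h4 := le_integral_mid hσ hσρ hgk (b := 0) (c := 2 * C) (by positivity) (fun z hz hzρ => by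
    have a1 := h1 z (abs_le.2 ⟨by linarith, hzρ⟩)
    have a2 := h1 (-z) (abs_le.2 ⟨by linarith, by linarith⟩)
    rw [← sub_eq_add_neg] at a2
    linarith) le_rfl
  have h5 : cutOp ρ f x - 2 * e / ρ ≤ cutOp ρ g x := by
    rw [← tailInt_const hρ (2 * e)]
    unfold cutOp
    rw [← tailInt_sub hρ (continuous_second_diff hf x) (abs_second_diff_le hM x) continuous_const
      (M' := |2 * e|) fun _ => le_rfl]
    refine tailInt_mono hρ ((continuous_second_diff hf x).sub continuous_const)
      (M := 4 * M + |2 * e|)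
      (fun z => (abs_sub _ _).trans (add_le_add (abs_second_diff_le hM x z) le_rfl)) hgk
      (abs_second_diff_le hM' x) fun z hz => ?_
    have a1 := h2 z (by rwa [abs_of_pos (hρ.trans hz)])
    have a2 := h2 (-z) (by rwa [abs_neg, abs_of_pos (hρ.trans hz)])
    rw [← sub_eq_add_neg] at a2
    linarith
  rw [zero_div] at h4
  linarith

/-- A bounded `C²` function with bounded second derivative, equal to its prescribed quadratic
expansion near `x₀` and close to `f` away from `x₀`. -/
theorem exists_spatial_test {M ρ p C ε : ℝ} {f : ℝ → ℝ} (hf : UniformContinuous f)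
    (hM : ∀ x, |f x| ≤ M) (x₀ : ℝ) (hρ : 0 < ρ) (hε : 0 < ε)
    (h : ∀ y, |y| ≤ ρ → f (x₀ + y) ≤ f x₀ + p * y + C * y ^ 2) :
    ∃ χ : ℝ → ℝ, ContDiff ℝ 2 χ ∧ (∃ B, ∀ x, |χ x| ≤ B) ∧ (∃ K, ∀ x, |deriv (deriv χ) x| ≤ K) ∧
      χ x₀ = f x₀ ∧ deriv χ x₀ = p ∧
      (∀ y, |y| ≤ ρ → χ (x₀ + y) ≤ f x₀ + p * y + (C + ε + 12 * ε / ρ ^ 2) * y ^ 2) ∧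
      (∀ y, ρ < |y| → χ (x₀ + y) ≤ f (x₀ + y) + 3 * ε ∧ f (x₀ + y) + ε ≤ χ (x₀ + y)) ∧
      ∀ y, ∀ w, |y| ≤ ρ → y ≠ 0 → w ≤ f x₀ + p * y + C * y ^ 2 → w < f (x₀ + y) + ε →
        w < χ (x₀ + y) := by
  obtain ⟨g, hg, hgf, K, hK⟩ := exists_contDiff_approx (f := fun x => f x + 2 * ε) (M := M + 2 * ε)
    (hf.add uniformContinuous_const) (fun x => (abs_add_le _ _).trans (add_le_add (hM x)
      (abs_of_pos (by positivity)).le)) hε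
  have hg1 : ∀ x, f x + ε ≤ g x := fun x => by linarith [(abs_le.1 (hgf x)).1]
  have hg2 : ∀ x, g x ≤ f x + 3 * ε := fun x => by linarith [(abs_le.1 (hgf x)).2]
  let κ : ContDiffBump x₀ := ⟨ρ / 2, ρ, by positivity, by linarith⟩
  obtain ⟨Q, hQ⟩ : ∃ Q : ℝ → ℝ, Q = fun x => f x₀ + p * (x - x₀) + (C + ε) * (x - x₀) ^ 2 :=
    ⟨_, rfl⟩
  have hQc : ContDiff ℝ 2 Q := by
    rw [hQ]
    fun_prop
  obtain ⟨u, hu⟩ : ∃ u : ℝ → ℝ, u = fun x => κ x * (Q x - g x) := ⟨_, rfl⟩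
  have huc : ContDiff ℝ 2 u := by
    rw [hu]
    exact κ.contDiff.mul (hQc.sub hg)
  have hus : HasCompactSupport u := by
    rw [hu]
    exact κ.hasCompactSupport.mul_right
  have hu1 : ContDiff ℝ 1 (deriv u) := by
    have : ContDiff ℝ (1 + 1) u := huc.of_le (by norm_num)
    exact (contDiff_succ_iff_deriv.1 this).2.2
  have hg11 : ContDiff ℝ 1 (deriv g) := by
    have : ContDiff ℝ (1 + 1) g := hg.of_le (by norm_num)
    exact (contDiff_succ_iff_deriv.1 this).2.2
  have hud := huc.differentiable (by norm_num)
  have hgd := hg.differentiable (by norm_num)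
  have hud1 := hu1.differentiable (by norm_num)
  have hgd1 := hg11.differentiable (by norm_num)
  obtain ⟨B₁, hB₁⟩ := huc.continuous.bounded_above_of_compact_support hus
  obtain ⟨B₂, hB₂⟩ := (hu1.continuous_deriv le_rfl).bounded_above_of_compact_support hus.deriv.deriv
  have hin : ∀ y, |y| ≤ ρ / 2 → κ (x₀ + y) = 1 := fun y hy =>
    κ.one_of_mem_closedBall (by rw [Metric.mem_closedBall, Real.dist_eq, add_sub_cancel_left]; exact hy)
  have hout : ∀ y, ρ ≤ |y| → κ (x₀ + y) = 0 := fun y hy =>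
    κ.zero_of_le_dist (by rw [Real.dist_eq, add_sub_cancel_left]; exact hy)
  have hval : ∀ y, u (x₀ + y) + g (x₀ + y) = κ (x₀ + y) *
      (f x₀ + p * y + (C + ε) * y ^ 2) + (1 - κ (x₀ + y)) * g (x₀ + y) := fun y => by
    rw [hu, hQ]
    simp only [add_sub_cancel_left]
    ring
  have hκ0 : ∀ y, 0 ≤ κ (x₀ + y) := fun y => κ.nonneg
  have hκ1 : ∀ y, κ (x₀ + y) ≤ 1 := fun y => κ.le_one
  refine ⟨fun x => u x + g x, huc.add hg, ⟨B₁ + (M + 3 * ε), fun x => ?_⟩, ⟨B₂ + K, fun x => ?_⟩,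
    ?_, ?_, fun y hy => ?_, fun y hy => ?_, fun y w hy hy0 hw1 hw2 => ?_⟩
  · have h1 := hB₁ x
    rw [Real.norm_eq_abs] at h1
    refine (abs_add_le _ _).trans (add_le_add h1 ?_)
    have := abs_le.1 (hM x)
    exact abs_le.2 ⟨by linarith [hg1 x], by linarith [hg2 x]⟩
  · have h1 : deriv (fun x => u x + g x) = fun x => deriv u x + deriv g x :=
      funext fun x => deriv_fun_add (hud x) (hgd x)
    rw [h1, deriv_fun_add (hud1 x) (hgd1 x)]
    exact (abs_add_le _ _).trans (add_le_add (hB₂ x) (hK x))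
  · have := hval 0
    rw [hin 0 (by rw [abs_zero]; positivity)] at this
    simpa using this
  · have h1 : (fun x => u x + g x) =ᶠ[𝓝 x₀] Q := by
      filter_upwards [Metric.closedBall_mem_nhds x₀ (show 0 < ρ / 2 by positivity)] with x hx
      rw [Metric.mem_closedBall, Real.dist_eq] at hx
      have h2 := hin (x - x₀) hx
      rw [add_sub_cancel] at h2
      rw [hu]
      simp only [h2]
      ring
    rw [h1.deriv_eq, hQ]
    have h2 : HasDerivAt (fun x => f x₀ + p * (x - x₀) + (C + ε) * (x - x₀) ^ 2)
        (p * 1 + (C + ε) * ((2 : ℕ) * (x₀ - x₀) ^ (2 - 1) * 1)) x₀ := by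
      have h3 := (hasDerivAt_id x₀).sub_const x₀
      exact ((h3.const_mul p).const_add (f x₀)).add ((h3.pow 2).const_mul (C + ε))
    rw [h2.deriv]
    simp
  · simp only
    rw [hval]
    have h1 := hg2 (x₀ + y)
    have h2 := h y hy
    rcases le_or_gt |y| (ρ / 2) with h3 | h3
    · rw [hin y h3]
      have : 0 ≤ 12 * ε / ρ ^ 2 * y ^ 2 := by positivity
      linarith
    · have h4 : 3 * ε ≤ 12 * ε / ρ ^ 2 * y ^ 2 := by
        have h5 : (ρ / 2) ^ 2 ≤ y ^ 2 := by
          rw [← sq_abs y]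
          gcongr
        rw [div_mul_eq_mul_div, le_div_iff₀ (by positivity)]
        linarith [mul_le_mul_of_nonneg_left h5 (show 0 ≤ 12 * ε by positivity)]
      have h6 := mul_le_mul_of_nonneg_left (show g (x₀ + y) ≤ f x₀ + p * y + C * y ^ 2 + 3 * ε by
        linarith) (sub_nonneg.2 (hκ1 y))
      have h7 : 0 ≤ (1 - κ (x₀ + y)) * (ε * y ^ 2) :=
        mul_nonneg (sub_nonneg.2 (hκ1 y)) (by positivity)
      have h8 : 0 ≤ κ (x₀ + y) * (3 * ε) := mul_nonneg (hκ0 y) (by positivity)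
      linarith
  · simp only
    rw [hval, hout y hy.le]
    constructor <;> linarith [hg1 (x₀ + y), hg2 (x₀ + y)]
  · simp only
    rw [hval]
    have h1 : w < f x₀ + p * y + (C + ε) * y ^ 2 := by
      have : 0 < ε * y ^ 2 := by positivity
      linarith
    have h2 : w < g (x₀ + y) := hw2.trans_le (hg1 _)
    have h3 : w = κ (x₀ + y) * w + (1 - κ (x₀ + y)) * w := by ring
    rw [h3]
    rcases (hκ0 y).eq_or_lt with h4 | h4
    · rw [← h4]
      linarith
    · exact add_lt_add_of_lt_of_le (mul_lt_mul_of_pos_left h1 h4)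
        (mul_le_mul_of_nonneg_left h2.le (sub_nonneg.2 (hκ1 y)))

/-- A viscosity subsolution satisfies the inequality at points where it is touched from above,
locally, by a quadratic polynomial. -/
theorem IsSubsolution.quad {F : ℝ → ℝ → ℝ} (hF : IsSubsolution HTilde F)
    (hb : ∀ T, ∃ B, ∀ t x, 0 ≤ t → t ≤ T → |F t x| ≤ B) {t₀ x₀ a p A C τ ρ : ℝ}
    (ht₀ : 0 < t₀) (huc : UniformContinuous (F t₀))
    (ht : ∀ e > 0, ∃ d > 0, ∀ t x, 0 ≤ t → |t - t₀| ≤ d → F t x ≤ F t₀ x + e)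
    (hτ : 0 < τ) (hA : 0 ≤ A) (hC : 0 ≤ C) (hρ : 0 < ρ)
    (H : ∀ t y, 0 ≤ t → |t - t₀| ≤ τ → |y| ≤ ρ →
      F t (x₀ + y) ≤ F t₀ x₀ + a * (t - t₀) + A * (t - t₀) ^ 2 + p * y + C * y ^ 2) :
    a + max p 0 * (cutOp ρ (F t₀) x₀ - 2 * C * ρ) ≤ 0 := by
  obtain ⟨M, hM⟩ := hb t₀
  have hM' : ∀ x, |F t₀ x| ≤ M := fun x => hM t₀ x ht₀.le le_rfl
  have main : ∀ ε > 0, a + max p 0 * (cutOp ρ (F t₀) x₀ - 2 * (3 * ε) / ρ -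
      2 * (C + ε + 12 * ε / ρ ^ 2) * ρ) ≤ 0 := by
    intro ε hε
    obtain ⟨χ, hχ, ⟨B, hB⟩, hχ2, hχ0, hχp, hχ3, hχ4, hχ5⟩ :=
      exists_spatial_test (p := p) (C := C) huc hM' x₀ hρ hε (fun y hy => by
        have := H t₀ y ht₀.le (by rw [sub_self, abs_zero]; exact hτ.le) hy
        rw [sub_self] at this
        linarith)
    obtain ⟨d, hd, hd'⟩ := ht (ε / 4) (by positivity)
    obtain ⟨η, hη, hη1, hη2, hη3⟩ : ∃ η > 0, η ≤ τ ∧ η ≤ d ∧ |a| * η ≤ ε / 4 :=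
      ⟨min (min τ d) (ε / 4 / (|a| + 1)), by positivity, (min_le_left _ _).trans (min_le_left _ _),
        (min_le_left _ _).trans (min_le_right _ _), by
          calc |a| * _ ≤ |a| * (ε / 4 / (|a| + 1)) := by gcongr; exact min_le_right _ _
            _ ≤ ε / 4 := by
              rw [mul_div_assoc', div_le_iff₀ (by positivity)]
              linarith⟩
    obtain ⟨N, hN, hN'⟩ := exists_contDiff_ge
      (m := fun t => (A + 1) + (sSup (range fun x => |F t x|) + B + |a| * |t - t₀| + 1) / η ^ 2)
      (fun T => by
        obtain ⟨B', hB'⟩ := hb T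
        refine ⟨(A + 1) + (B' + B + |a| * (|T| + |t₀|) + 1) / η ^ 2, fun t h0 hT => ?_⟩
        have h1 : sSup (range fun x => |F t x|) ≤ B' :=
          csSup_le (range_nonempty _) (by rintro _ ⟨x, rfl⟩; exact hB' t x h0 hT)
        have h2 : |t - t₀| ≤ |T| + |t₀| := by
          refine (abs_sub _ _).trans (add_le_add ?_ le_rfl)
          rw [abs_of_nonneg h0]
          exact hT.trans (le_abs_self T)
        gcongr)
    have hN1 : ∀ t, 0 ≤ t → A < N t := fun t h0 => by
      refine lt_of_lt_of_le ?_ (hN' t h0)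
      have h1 : 0 ≤ sSup (range fun x => |F t x|) :=
        Real.sSup_nonneg (by rintro _ ⟨x, rfl⟩; exact abs_nonneg _)
      have h2 : 0 ≤ B := (abs_nonneg _).trans (hB 0)
      have : 0 ≤ (sSup (range fun x => |F t x|) + B + |a| * |t - t₀| + 1) / η ^ 2 := by positivity
      linarith
    have hN2 : ∀ t x, 0 ≤ t → |F t x| + B + |a| * |t - t₀| + 1 ≤ η ^ 2 * N t := fun t x h0 => by
      have h1 := hN' t h0
      obtain ⟨B', hB'⟩ := hb t
      have h2 : |F t x| ≤ sSup (range fun x => |F t x|) :=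
        le_csSup ⟨B', by rintro _ ⟨x, rfl⟩; exact hB' t x h0 le_rfl⟩ ⟨x, rfl⟩
      have h3 : (sSup (range fun x => |F t x|) + B + |a| * |t - t₀| + 1) / η ^ 2 ≤ N t := by
        linarith
      rw [div_le_iff₀ (by positivity)] at h3
      linarith
    have htest : TestFun fun t x => χ x + a * (t - t₀) + (t - t₀) ^ 2 * N t := by
      have hχd : ∀ t, deriv (fun x => χ x + a * (t - t₀) + (t - t₀) ^ 2 * N t) = deriv χ :=
        fun t => funext fun x => by rw [deriv_add_const, deriv_add_const]
      have hχ1 : ContDiff ℝ 1 (deriv χ) := by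
        have : ContDiff ℝ (1 + 1) χ := hχ.of_le (by norm_num)
        exact (contDiff_succ_iff_deriv.1 this).2.2
      refine ⟨fun x => by fun_prop, fun t => ⟨⟨B + |a * (t - t₀) + (t - t₀) ^ 2 * N t|,
        fun x => ?_⟩, fun x => ?_, fun x => ?_, ?_⟩⟩
      · simp only
        rw [add_assoc]
        exact (abs_add_le _ _).trans (add_le_add (hB x) le_rfl)
      · exact ((hχ.differentiable (by norm_num) x).add_const _).add_const _
      · rw [hχd]
        exact hχ1.differentiable (by norm_num) x
      · rw [hχd]
        exact hχ2
    have key := hF.2 _ htest t₀ x₀ ht₀ (fun t x h0 hne => by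
      obtain ⟨y, rfl⟩ : ∃ y, x = x₀ + y := ⟨x - x₀, by ring⟩
      obtain ⟨s, hs⟩ : ∃ s, s = t - t₀ := ⟨_, rfl⟩
      rw [hχ0, sub_self]
      simp only [← hs]
      suffices F t (x₀ + y) < χ (x₀ + y) + a * s + s ^ 2 * N t by linarith
      rcases lt_or_ge η |s| with h1 | h1
      · have h2 := hN2 t (x₀ + y) h0
        have h3 : η ^ 2 * N t ≤ s ^ 2 * N t := by
          have : 0 ≤ N t := hA.trans (hN1 t h0).le
          rw [← sq_abs s]
          gcongr
        have h4 := (abs_le.1 (hB (x₀ + y))).1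
        have h5 := le_abs_self (F t (x₀ + y))
        have h6 := (abs_le.1 (abs_mul a s).le).1
        rw [← hs] at h2
        linarith
      · have h2 : A * s ^ 2 ≤ s ^ 2 * N t := by
          rw [mul_comm]
          exact mul_le_mul_of_nonneg_left (hN1 t h0).le (sq_nonneg s)
        have h3 := hd' t (x₀ + y) h0 (by rw [← hs]; linarith)
        have h4 : |a * s| ≤ ε / 4 := by
          rw [abs_mul]
          exact le_trans (by gcongr) hη3
        have h5 := (abs_le.1 h4).1
        have h6 : 0 ≤ A * s ^ 2 := by positivity
        rcases lt_or_ge ρ |y| with h7 | h7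
        · linarith [(hχ4 y h7).2]
        · have h8 := H t y h0 (by rw [← hs]; linarith) h7
          rw [← hs] at h8
          rcases eq_or_ne y 0 with rfl | hy
          · have hs0 : s ≠ 0 := by
              rintro rfl
              exact hne (by rw [add_zero, Prod.mk.injEq]; exact ⟨by linarith, rfl⟩)
            have h9 : A * s ^ 2 < s ^ 2 * N t := by
              rw [mul_comm]
              exact mul_lt_mul_of_pos_left (hN1 t h0) (by positivity)
            rw [add_zero x₀] at h8 ⊢
            rw [hχ0]
            linarith
          · have h9 := hχ5 y (F t (x₀ + y) - a * s - A * s ^ 2) h7 hy (by linarith) (by linarith)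
            linarith)
    have e1 : deriv (fun t => χ x₀ + a * (t - t₀) + (t - t₀) ^ 2 * N t) t₀ = a := by
      have h1 := (hasDerivAt_id t₀).sub_const t₀
      have h2 : HasDerivAt (fun t => χ x₀ + a * (t - t₀) + (t - t₀) ^ 2 * N t)
          (a * 1 + ((2 : ℕ) * (t₀ - t₀) ^ (2 - 1) * 1 * N t₀ + (t₀ - t₀) ^ 2 * deriv N t₀)) t₀ :=
        ((h1.const_mul a).const_add _).add
          ((h1.pow 2).mul (hN.differentiable (by norm_num) t₀).hasDerivAt)
      rw [h2.deriv]
      simp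
    have e2 : (fun x => χ x + a * (t₀ - t₀) + (t₀ - t₀) ^ 2 * N t₀) = χ := by
      funext x
      simp
    have hlim := htest.tendsto_cutOp t₀ x₀
    simp only [e2] at key hlim
    rw [e1, hχp] at key
    have h3 : cutOp ρ (F t₀) x₀ - 2 * (3 * ε) / ρ - 2 * (C + ε + 12 * ε / ρ ^ 2) * ρ ≤
        HTilde χ x₀ := by
      refine ge_of_tendsto hlim ?_
      filter_upwards [eventually_pos, eventually_small hρ] with σ hσ hσρ
      exact cutOp_le_of_touch huc.continuous hM' hχ.continuous hB hσ hσρ.le (by positivity) hχ0 hχ3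
        fun y hy => (hχ4 y hy).1
    have h4 := mul_le_mul_of_nonneg_left h3 (le_max_right p 0)
    linarith
  have hlim : Tendsto (fun ε : ℝ => a + max p 0 * (cutOp ρ (F t₀) x₀ - 2 * (3 * ε) / ρ -
      2 * (C + ε + 12 * ε / ρ ^ 2) * ρ)) (𝓝[>] 0) (𝓝 (a + max p 0 * (cutOp ρ (F t₀) x₀ -
      2 * (3 * 0) / ρ - 2 * (C + 0 + 12 * 0 / ρ ^ 2) * ρ))) :=
    Tendsto.mono_left (Continuous.tendsto (by fun_prop) 0) nhdsWithin_le_nhds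
  have := le_of_tendsto hlim (eventually_pos.mono main)
  simpa using this

set_option maxHeartbeats 1000000 in
theorem IsSubsolution.pastSub_of_eq {M T : ℝ} {F G : ℝ → ℝ → ℝ} (hF : IsSubsolution HTilde F)
    (hb : ∀ T, ∃ B, ∀ t x, 0 ≤ t → t ≤ T → |F t x| ≤ B) (bG : BddUC M G)
    (hFG : ∀ t, 0 ≤ t → t ≤ T + 1 → F t = G t) : PastSub T G := by
  intro t₀ x₀ a p C τ₀ r ρ ht₀ ht₀T hτ₀ hτt₀ hC hρ hρr H₀
  obtain ⟨τ, hτ, hττ, hτ1⟩ : ∃ τ > 0, τ ≤ τ₀ ∧ τ ≤ 1 :=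
    ⟨min τ₀ 1, by positivity, min_le_left _ _, min_le_right _ _⟩
  have H : ∀ t y, t₀ - τ ≤ t → t ≤ t₀ → |y| ≤ r →
      G t (x₀ + y) ≤ G t₀ x₀ + a * (t - t₀) + p * y + C * y ^ 2 :=
    fun t y h1 h2 h3 => H₀ t y (by linarith) h2 h3
  have hcont : Continuous fun w : ℝ × ℝ × ℝ => (a - w.1) + max (p + 2 * (C + w.1) * w.2.2) 0 *
      (cutOp ρ (G w.2.1) (x₀ + w.2.2) - 2 * (C + w.1) * ρ) := by
    have h1 : Continuous fun w : ℝ × ℝ × ℝ => cutOp ρ (G w.2.1) (x₀ + w.2.2) :=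
      (bG.continuous_cutOp hρ).comp (by fun_prop : Continuous fun w : ℝ × ℝ × ℝ =>
        (w.2.1, x₀ + w.2.2))
    fun_prop
  have key := nonpos_of_approx (x₀ := ((0 : ℝ), t₀, (0 : ℝ))) hcont.continuousAt ?_
  · simpa using key
  intro ε hε
  obtain ⟨ζ, hζ, hζε⟩ : ∃ ζ > 0, ζ < ε := ⟨ε / 2, by positivity, by linarith⟩
  obtain ⟨ω, hω, hωε, hωτ, hωr⟩ : ∃ ω > 0, ω < ε ∧ ω ≤ τ / 2 ∧ ω ≤ r - ρ :=
    ⟨min (min (ε / 2) (τ / 2)) (r - ρ), lt_min (by positivity) (by linarith),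
      by linarith [min_le_left (min (ε / 2) (τ / 2)) (r - ρ), min_le_left (ε / 2) (τ / 2)],
      (min_le_left _ _).trans (min_le_right _ _), min_le_right _ _⟩
  obtain ⟨e, he, heζ⟩ : ∃ e > 0, 2 * e = ζ * ω ^ 2 := ⟨ζ * ω ^ 2 / 2, by positivity, by ring⟩
  obtain ⟨d₀, hd₀, hmod⟩ := bG.modulus he
  obtain ⟨d, hd, hdd, hdω, hda⟩ : ∃ d > 0, d ≤ d₀ ∧ d ≤ ω ∧ |a - ζ| * d ≤ e :=
    ⟨min (min d₀ ω) (e / (|a - ζ| + 1)), by positivity, (min_le_left _ _).trans (min_le_left _ _),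
      (min_le_left _ _).trans (min_le_right _ _), by
        calc |a - ζ| * _ ≤ |a - ζ| * (e / (|a - ζ| + 1)) := by gcongr; exact min_le_right _ _
          _ ≤ e := by
            rw [mul_div_assoc', div_le_iff₀ (by positivity)]
            linarith⟩
  have hM0 := bG.nonneg
  obtain ⟨n, hn, hnd⟩ : ∃ n > 0, n * d ^ 2 = 2 * M + |a - ζ| * τ + 1 :=
    ⟨(2 * M + |a - ζ| * τ + 1) / d ^ 2, by positivity, by field_simp⟩
  have hr : 0 < r := hρ.trans hρr
  obtain ⟨Ψ, hΨ⟩ : ∃ Ψ : ℝ × ℝ → ℝ, Ψ = fun w => G w.1 (x₀ + w.2) - ((a - ζ) * (w.1 - t₀) +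
    p * w.2 + (C + ζ) * w.2 ^ 2 + n * max (w.1 - t₀) 0 ^ 2) := ⟨_, rfl⟩
  have hΨc : Continuous Ψ := by
    rw [hΨ]
    exact (bG.comp (by fun_prop) (by fun_prop)).sub (by fun_prop)
  obtain ⟨⟨t, y⟩, ⟨ht, hy⟩, hmax⟩ := (isCompact_Icc.prod isCompact_Icc).exists_isMaxOn
    (s := Icc (t₀ - τ) (t₀ + τ) ×ˢ Icc (-r) r)
    ⟨(t₀, 0), ⟨by linarith, by linarith⟩, ⟨by linarith, hr.le⟩⟩ hΨc.continuousOn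
  have hmax' : ∀ t' y', |t' - t₀| ≤ τ → |y'| ≤ r → Ψ (t', y') ≤ Ψ (t, y) := fun t' y' h1 h2 =>
    hmax ⟨⟨by linarith [(abs_le.1 h1).1], by linarith [(abs_le.1 h1).2]⟩, abs_le.1 h2⟩
  simp only at ht hy
  rw [hΨ] at hmax'
  simp only at hmax'
  have h00 := hmax' t₀ 0 (by rw [sub_self, abs_zero]; exact hτ.le) (by rw [abs_zero]; exact hr.le)
  rw [sub_self, max_self, add_zero x₀] at h00
  have hloc : |t - t₀| ≤ ω ∧ |y| ≤ ω := by
    rcases le_or_gt t t₀ with h1 | h1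
    · have h2 := H t y ht.1 h1 (abs_le.2 hy)
      rw [max_eq_right (by linarith)] at h00
      have h3 : ζ * (t₀ - t) + ζ * y ^ 2 ≤ 0 := by linarith
      have h4 : 0 ≤ ζ * (t₀ - t) := mul_nonneg hζ.le (by linarith)
      have h5 : 0 ≤ ζ * y ^ 2 := by positivity
      have h6 : t₀ - t = 0 := by
        have : ζ * (t₀ - t) = 0 := by linarith
        simpa [hζ.ne'] using this
      have h7 : y = 0 := by
        have : ζ * y ^ 2 = 0 := by linarith
        simpa [hζ.ne'] using this
      rw [h7, abs_zero, abs_sub_comm, h6, abs_zero]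
      exact ⟨hω.le, hω.le⟩
    · obtain ⟨s, hs⟩ : ∃ s, s = t - t₀ := ⟨_, rfl⟩
      have hs0 : 0 < s := by linarith
      have h2 := H t₀ y (by linarith) le_rfl (abs_le.2 hy)
      rw [← hs, max_eq_left hs0.le] at h00
      rw [sub_self] at h2
      have h3 : (a - ζ) * s + ζ * y ^ 2 + n * s ^ 2 ≤ G t (x₀ + y) - G t₀ (x₀ + y) := by linarith
      have h4 : -(|a - ζ| * s) ≤ (a - ζ) * s := by
        have := mul_le_mul_of_nonneg_right (neg_abs_le (a - ζ)) hs0.le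
        linarith
      have h5 : 0 ≤ ζ * y ^ 2 := by positivity
      have h6 : 0 ≤ n * s ^ 2 := by positivity
      have hsd : s ≤ d := by
        by_contra! h7
        have h8 := abs_le.1 (bG.bdd t (x₀ + y))
        have h9 := abs_le.1 (bG.bdd t₀ (x₀ + y))
        have h10 : n * d ^ 2 ≤ n * s ^ 2 := by gcongr
        have h11 : |a - ζ| * s ≤ |a - ζ| * τ := by
          gcongr
          linarith [ht.2]
        linarith
      have h7 := hmod t t₀ (x₀ + y) (x₀ + y) (by rw [← hs, abs_of_pos hs0]; linarith)
        (by rw [sub_self, abs_zero]; exact hd₀.le)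
      have h8 : |a - ζ| * s ≤ |a - ζ| * d := by gcongr
      have h9 : ζ * y ^ 2 ≤ ζ * ω ^ 2 := by linarith [(abs_le.1 h7).2]
      have h10 : y ^ 2 ≤ ω ^ 2 := le_of_mul_le_mul_left h9 hζ
      refine ⟨by rw [← hs, abs_of_pos hs0]; linarith, ?_⟩
      exact abs_le_of_sq_le_sq h10 hω.le
  obtain ⟨hlt, hly⟩ := hloc
  have ht0 : 0 < t := by linarith [(abs_le.1 hlt).1]
  have htT : t ≤ T + 1 / 2 := by linarith [(abs_le.1 hlt).2]
  have hFt : F t = G t := hFG t ht0.le (by linarith)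
  have fin := hF.quad hb (t₀ := t) (x₀ := x₀ + y) (a := a - ζ + 2 * n * max (t - t₀) 0)
    (p := p + 2 * (C + ζ) * y) (A := n) (C := C + ζ) (τ := τ / 2) (ρ := ρ) ht0
    (by
      rw [hFt]
      refine Metric.uniformContinuous_iff.2 fun e' he' => ?_
      obtain ⟨d', hd', hm⟩ := bG.modulus (half_pos he')
      refine ⟨d', hd', fun {u v} huv => ?_⟩
      have := hm t t u v (by rw [sub_self, abs_zero]; exact hd'.le) huv.le
      rw [Real.dist_eq]
      linarith)
    (fun e' he' => by
      obtain ⟨d', hd', hm⟩ := bG.modulus he'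
      refine ⟨min d' (1 / 2), by positivity, fun t' x h1 h2 => ?_⟩
      have h3 := hm t' t x x (h2.trans (min_le_left _ _)) (by rw [sub_self, abs_zero]; exact hd'.le)
      have h4 := (abs_le.1 (h2.trans (min_le_right _ _))).2
      rw [hFG t' h1 (by linarith), hFt]
      linarith [(abs_le.1 h3).2])
    (by positivity) hn.le (by positivity) hρ
    (fun t' y' h1 h2 h3 => by
      have h4 := abs_le.1 h2
      have h5 := abs_le.1 hlt
      rw [hFG t' h1 (by linarith), hFt]
      have h6 := hmax' t' (y + y') (abs_le.2 ⟨by linarith, by linarith⟩)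
        ((abs_add_le _ _).trans (by linarith))
      have h7 := sq_max_zero_add_le (t - t₀) (t' - t)
      rw [show t - t₀ + (t' - t) = t' - t₀ by ring] at h7
      have h8 := mul_le_mul_of_nonneg_left h7 hn.le
      rw [add_assoc x₀]
      linarith)
  refine ⟨(ζ, t, y), ?_, ?_⟩
  · simp only [Prod.dist_eq, Real.dist_eq, sub_zero, abs_of_pos hζ]
    exact max_lt hζε (max_lt (by linarith) (by linarith))
  · simp only
    rw [← hFt]
    have : 0 ≤ 2 * n * max (t - t₀) 0 := by positivity
    linarith

theorem BUCOn.exists_bddUC {T : ℝ} (hT : 0 ≤ T) {F : ℝ → ℝ → ℝ}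
    (h : BUCOn (fun p => F p.1 p.2) (Icc 0 T ×ˢ univ)) :
    ∃ M, BddUC M fun t x => F (max 0 (min t T)) x := by
  obtain ⟨⟨M, hM⟩, huc⟩ := h
  have hm : ∀ t, max 0 (min t T) ∈ Icc 0 T := fun t =>
    ⟨le_max_left _ _, max_le hT (min_le_right _ _)⟩
  refine ⟨M, fun t x => hM (max 0 (min t T), x) ⟨hm t, mem_univ _⟩, ?_⟩
  have h1 : UniformContinuous fun p : ℝ × ℝ => (max 0 (min p.1 T), p.2) := by
    have h2 : LipschitzWith 1 fun t : ℝ => max 0 (min t T) :=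
      (LipschitzWith.id.min_const T).const_max 0
    exact (h2.uniformContinuous.comp uniformContinuous_fst).prodMk uniformContinuous_snd
  refine Metric.uniformContinuous_iff.2 fun e he => ?_
  obtain ⟨d, hd, H⟩ := Metric.uniformContinuousOn_iff.1 huc e he
  obtain ⟨d', hd', H'⟩ := Metric.uniformContinuous_iff.1 h1 d hd
  exact ⟨d', hd', fun {p q} hpq => H _ ⟨hm p.1, mem_univ _⟩ _ ⟨hm q.1, mem_univ _⟩ (H' hpq)⟩

theorem BUCOn.continuousOn_Ici {F : ℝ → ℝ → ℝ}
    (h : ∀ T > (0 : ℝ), BUCOn (fun p => F p.1 p.2) (Icc 0 T ×ˢ univ)) :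
    ContinuousOn (fun p : ℝ × ℝ => F p.1 p.2) (Ici 0 ×ˢ univ) := by
  rintro ⟨t, x⟩ ⟨ht, -⟩
  have ht' : (0 : ℝ) ≤ t := ht
  have h1 := (h (t + 1) (by linarith)).2.continuousOn (t, x) ⟨⟨ht', by simp⟩, mem_univ _⟩
  refine h1.mono_of_mem_nhdsWithin ?_
  have h2 : (Iio (t + 1) ×ˢ univ : Set (ℝ × ℝ)) ∈ 𝓝 (t, x) :=
    (isOpen_Iio.prod isOpen_univ).mem_nhds ⟨by simp, mem_univ _⟩
  filter_upwards [self_mem_nhdsWithin, nhdsWithin_le_nhds h2] with p hp1 hp2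
  exact ⟨⟨hp1.1, hp2.1.le⟩, mem_univ _⟩

theorem IsSolution.isSubsolution_dual {F : ℝ → ℝ → ℝ} (h : IsSolution HTilde F)
    (hF : ContinuousOn (fun p : ℝ × ℝ => F p.1 p.2) (Ici 0 ×ˢ univ)) :
    IsSubsolution HTilde (dual F) :=
  (h.2.congr fun _ x ht => lscEnv_eq hF ht x).dual hF

/-- Solutions in the sense of the definition, once clamped in time, are past sub- and
supersolutions. -/
theorem IsSolution.pastSub {F : ℝ → ℝ → ℝ} (h : IsSolution HTilde F)
    (hb : ∀ T > (0 : ℝ), BUCOn (fun p => F p.1 p.2) (Icc 0 T ×ˢ univ)) {T : ℝ} (hT : 0 < T) :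
    ∃ M G, BddUC M G ∧ PastSub T G ∧ PastSub T (dual G) ∧ ∀ t, 0 ≤ t → t ≤ T → G t = F t := by
  obtain ⟨M, hM⟩ := (hb (T + 1) (by linarith)).exists_bddUC (by linarith)
  have heq : ∀ t, 0 ≤ t → t ≤ T + 1 → max 0 (min t (T + 1)) = t := fun t h1 h2 => by
    rw [min_eq_left h2, max_eq_right h1]
  have hbd : ∀ T, ∃ B, ∀ t x, 0 ≤ t → t ≤ T → |F t x| ≤ B := fun T => by
    obtain ⟨⟨B, hB⟩, -⟩ := hb (|T| + 1) (by positivity)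
    exact ⟨B, fun t x h1 h2 => hB (t, x)
      ⟨⟨h1, by simp only; linarith [le_abs_self T]⟩, mem_univ _⟩⟩
  refine ⟨M, _, hM, h.1.pastSub_of_eq hbd hM fun t h1 h2 => ?_,
    (h.isSubsolution_dual (BUCOn.continuousOn_Ici hb)).pastSub_of_eq (fun T => ?_) hM.dual
      fun t h1 h2 => ?_, fun t h1 h2 => ?_⟩
  · funext x
    simp only [heq t h1 h2]
  · obtain ⟨B, hB⟩ := hbd T
    exact ⟨B, fun t x h1 h2 => by simpa [dual] using hB t (-x) h1 h2⟩
  · funext x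
    simp only [dual, heq t h1 h2]
  · funext x
    simp only [heq t h1 (by linarith)]

/-- One step of an explicit upwind scheme with time step `h` and mesh size `k`. -/
noncomputable def step (h k : ℝ) (f : ℝ → ℝ) (x : ℝ) : ℝ :=
  f x - h * ((max (cutOp k f x) 0 * max (f x - f (x - k)) 0 -
    max (-cutOp k f x) 0 * max (f (x + k) - f x) 0) / k)

/-- Continuous functions bounded by `M`. -/
structure BddCont (M : ℝ) (f : ℝ → ℝ) : Prop where
  cont : Continuous f
  bdd : ∀ x, |f x| ≤ M

theorem BddCont.nonneg {M : ℝ} {f : ℝ → ℝ} (hf : BddCont M f) : 0 ≤ M :=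
  (abs_nonneg _).trans (hf.bdd 0)

theorem BddCont.mono {M M' : ℝ} {f : ℝ → ℝ} (hf : BddCont M f) (h : M ≤ M') : BddCont M' f :=
  ⟨hf.cont, fun x => (hf.bdd x).trans h⟩

theorem BddCont.translate {M : ℝ} {f : ℝ → ℝ} (hf : BddCont M f) (y : ℝ) :
    BddCont M fun x => f (x + y) :=
  ⟨hf.cont.comp (by fun_prop), fun x => hf.bdd _⟩

theorem BddCont.continuous_cutOp {M k : ℝ} {f : ℝ → ℝ} (hf : BddCont M f) (hk : 0 < k) :
    Continuous (cutOp k f) := by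
  unfold cutOp tailInt
  refine continuous_of_dominated (bound := fun z => 4 * M / z ^ 2) (fun x => ?_) (fun x => ?_)
    (integrableOn_inv_sq hk _) ?_
  · exact (integrableOn_tail hk (continuous_second_diff hf.cont x)
      (abs_second_diff_le hf.bdd x)).aestronglyMeasurable
  · refine Eventually.of_forall fun z => ?_
    rw [Real.norm_eq_abs, abs_div, abs_of_nonneg (sq_nonneg z)]
    gcongr
    exact abs_second_diff_le hf.bdd x z
  · refine Eventually.of_forall fun z => ?_
    have := hf.cont
    fun_prop

theorem step_add_const (h k c : ℝ) (f : ℝ → ℝ) (x : ℝ) :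
    step h k (fun x => f x + c) x = step h k f x + c := by
  have h1 : cutOp k (fun x => f x + c) x = cutOp k f x := by
    unfold cutOp
    congr 1
    funext z
    ring
  unfold step
  rw [h1]
  simp only [add_sub_add_right_eq_sub]
  ring

theorem step_translate (h k : ℝ) (f : ℝ → ℝ) (y x : ℝ) :
    step h k (fun x => f (x + y)) x = step h k f (x + y) := by
  have h1 : cutOp k (fun x => f (x + y)) x = cutOp k f (x + y) := by
    unfold cutOp
    congr 1
    funext z
    beta_reduce
    rw [show x + z + y = x + y + z by ring, show x - z + y = x + y - z by ring]
  unfold step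
  rw [h1]
  beta_reduce
  rw [show x - k + y = x + y - k by ring, show x + k + y = x + y + k by ring]

theorem step_reflect (h k : ℝ) (f : ℝ → ℝ) (x : ℝ) :
    step h k (fun x => -f (-x)) x = -step h k f (-x) := by
  have h1 : cutOp k (fun x => -f (-x)) x = -cutOp k f (-x) := cutOp_dual (fun _ => f) k 0 x
  unfold step
  rw [h1]
  beta_reduce
  rw [show -(x - k) = -x + k by ring, show -(x + k) = -x - k by ring, neg_neg,
    show -f (-x) - -f (-x + k) = f (-x + k) - f (-x) by ring,
    show -f (-x - k) - -f (-x) = f (-x) - f (-x - k) by ring]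
  ring

theorem step_const (h k c x : ℝ) : step h k (fun _ => c) x = c := by
  simp [step]

theorem upwind_le {v w a b a' b' D k M : ℝ} (hk : 0 < k) (hD : 0 ≤ D)
    (hw : w ≤ v + 2 * D / k) (ha : a' ≤ a + D) (hb : b - D ≤ b') (hv : |v| ≤ 4 * M / k)
    (hw' : |w| ≤ 4 * M / k) (haM : a' ≤ 2 * M) (hbM : b ≤ 2 * M) (hM : 0 ≤ M) :
    max w 0 * max a' 0 - max (-w) 0 * max b' 0 ≤
      max v 0 * max a 0 - max (-v) 0 * max b 0 + 16 * M * D / k := by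
  have e1 : max w 0 ≤ max v 0 + 2 * D / k := max_le
    (hw.trans (add_le_add (le_max_left _ _) le_rfl)) (by positivity)
  have e2 : max a' 0 ≤ max a 0 + D :=
    max_le (ha.trans (add_le_add (le_max_left _ _) le_rfl)) (by positivity)
  have e3 : max (-v) 0 ≤ max (-w) 0 + 2 * D / k := max_le
    (by linarith [le_max_left (-w) 0]) (by positivity)
  have e4 : max b 0 ≤ max b' 0 + D := max_le (by linarith [le_max_left b' 0]) (by positivity)
  have e5 : max v 0 ≤ 4 * M / k := max_le ((le_abs_self v).trans hv) (by positivity)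
  have e6 : max (-w) 0 ≤ 4 * M / k := max_le ((neg_le_abs w).trans hw') (by positivity)
  have e7 : max a' 0 ≤ 2 * M := max_le haM (by positivity)
  have e8 : max b 0 ≤ 2 * M := max_le hbM (by positivity)
  have f1 : max w 0 * max a' 0 ≤ (max v 0 + 2 * D / k) * max a' 0 :=
    mul_le_mul_of_nonneg_right e1 (le_max_right _ _)
  have f2 : max v 0 * max a' 0 ≤ max v 0 * (max a 0 + D) :=
    mul_le_mul_of_nonneg_left e2 (le_max_right _ _)
  have f3 : 2 * D / k * max a' 0 ≤ 2 * D / k * (2 * M) :=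
    mul_le_mul_of_nonneg_left e7 (by positivity)
  have f4 : max v 0 * D ≤ 4 * M / k * D := mul_le_mul_of_nonneg_right e5 hD
  have g1 : max (-v) 0 * max b 0 ≤ (max (-w) 0 + 2 * D / k) * max b 0 :=
    mul_le_mul_of_nonneg_right e3 (le_max_right _ _)
  have g2 : max (-w) 0 * max b 0 ≤ max (-w) 0 * (max b' 0 + D) :=
    mul_le_mul_of_nonneg_left e4 (le_max_right _ _)
  have g3 : 2 * D / k * max b 0 ≤ 2 * D / k * (2 * M) :=
    mul_le_mul_of_nonneg_left e8 (by positivity)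
  have g4 : max (-w) 0 * D ≤ 4 * M / k * D := mul_le_mul_of_nonneg_right e6 hD
  have e9 : 16 * M * D / k = 2 * (2 * D / k * (2 * M)) + 2 * (4 * M / k * D) := by ring
  rw [e9]
  linarith

theorem step_mono {M h k : ℝ} (hk : 0 < k) (hh : 0 ≤ h) (hcfl : 16 * M * h ≤ k ^ 2)
    {f g : ℝ → ℝ} (hf : BddCont M f) (hg : BddCont M g) (hfg : ∀ x, f x ≤ g x) (x : ℝ) :
    step h k f x ≤ step h k g x := by
  obtain ⟨D, hD⟩ : ∃ D, D = g x - f x := ⟨_, rfl⟩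
  have hD0 : 0 ≤ D := by linarith [hfg x]
  have hv : cutOp k g x ≤ cutOp k f x + 2 * D / k := by
    rw [← sub_le_iff_le_add']
    unfold cutOp
    rw [← tailInt_sub hk (continuous_second_diff hg.cont x) (abs_second_diff_le hg.bdd x)
      (continuous_second_diff hf.cont x) (abs_second_diff_le hf.bdd x)]
    refine tailInt_le hk ((continuous_second_diff hg.cont x).sub
      (continuous_second_diff hf.cont x)) (M := 4 * M + 4 * M) (fun z => (abs_sub _ _).trans
        (add_le_add (abs_second_diff_le hg.bdd x z) (abs_second_diff_le hf.bdd x z)))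
        fun z _ => ?_
    linarith [hfg (x + z), hfg (x - z)]
  have g1 := abs_le.1 (hg.bdd x)
  have g2 := abs_le.1 (hg.bdd (x - k))
  have f1 := abs_le.1 (hf.bdd x)
  have f2 := abs_le.1 (hf.bdd (x + k))
  have key := upwind_le (a := f x - f (x - k)) (a' := g x - g (x - k)) (b := f (x + k) - f x)
    (b' := g (x + k) - g x) hk hD0 hv (by linarith [hfg (x - k)])
    (by linarith [hfg (x + k)]) (abs_cutOp_le hk hf.cont hf.bdd x)
    (abs_cutOp_le hk hg.cont hg.bdd x) (by linarith) (by linarith) hf.nonneg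
  unfold step
  have h1 := mul_le_mul_of_nonneg_left (div_le_div_of_nonneg_right key hk.le) hh
  have h2 : h * (16 * M * D / k / k) ≤ D := by
    have : h * (16 * M * D / k / k) = 16 * M * h * D / k ^ 2 := by
      field_simp
    rw [this, div_le_iff₀ (by positivity), mul_comm D]
    exact mul_le_mul_of_nonneg_right hcfl hD0
  rw [add_div, mul_add] at h1
  linarith

theorem BddCont.step {M h k : ℝ} (hk : 0 < k) (hh : 0 ≤ h) (hcfl : 16 * M * h ≤ k ^ 2)
    {f : ℝ → ℝ} (hf : BddCont M f) : BddCont M (step h k f) := by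
  refine ⟨?_, fun x => abs_le.2 ⟨?_, ?_⟩⟩
  · unfold _root_.step
    have h1 := hf.continuous_cutOp hk
    have h2 := hf.cont
    fun_prop
  · have := step_mono hk hh hcfl (f := fun _ => -M) ⟨continuous_const, fun _ => by
      rw [abs_neg, abs_of_nonneg hf.nonneg]⟩ hf (fun x => (abs_le.1 (hf.bdd x)).1) x
    rwa [step_const] at this
  · have := step_mono hk hh hcfl (g := fun _ => M) hf ⟨continuous_const, fun _ => by
      rw [abs_of_nonneg hf.nonneg]⟩ (fun x => (abs_le.1 (hf.bdd x)).2) x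
    rwa [step_const] at this

theorem step_le_add {M h k c : ℝ} (hk : 0 < k) (hh : 0 ≤ h) (hcfl : 48 * M * h ≤ k ^ 2)
    {f g : ℝ → ℝ} (hf : BddCont M f) (hg : BddCont M g) (hc : 0 ≤ c) (hfg : ∀ x, f x ≤ g x + c)
    (x : ℝ) : step h k f x ≤ step h k g x + c := by
  have hM := hf.nonneg
  rcases le_total c (2 * M) with h1 | h1
  · rw [← step_add_const]
    refine step_mono (M := 3 * M) hk hh (by linarith) (hf.mono (by linarith))
      ⟨hg.cont.add continuous_const, fun x => ?_⟩ hfg x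
    refine (abs_add_le _ _).trans ?_
    rw [abs_of_nonneg hc]
    linarith [hg.bdd x]
  · have hcfl' : 16 * M * h ≤ k ^ 2 := by
      have : 0 ≤ M * h := mul_nonneg hM hh
      linarith
    have a1 := abs_le.1 ((hf.step hk hh hcfl').bdd x)
    have a2 := abs_le.1 ((hg.step hk hh hcfl').bdd x)
    linarith

theorem BddCont.iterate_step {M h k : ℝ} (hk : 0 < k) (hh : 0 ≤ h) (hcfl : 48 * M * h ≤ k ^ 2)
    {f : ℝ → ℝ} (hf : BddCont M f) (n : ℕ) : BddCont M ((_root_.step h k)^[n] f) := by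
  induction n with
  | zero => exact hf
  | succ n ih =>
    rw [Function.iterate_succ_apply']
    have : 0 ≤ M * h := mul_nonneg hf.nonneg hh
    exact ih.step hk hh (by linarith)

theorem iterate_step_le_add {M h k c : ℝ} (hk : 0 < k) (hh : 0 ≤ h) (hcfl : 48 * M * h ≤ k ^ 2)
    {f g : ℝ → ℝ} (hf : BddCont M f) (hg : BddCont M g) (hc : 0 ≤ c) (hfg : ∀ x, f x ≤ g x + c)
    (n : ℕ) (x : ℝ) : (step h k)^[n] f x ≤ (step h k)^[n] g x + c := by
  induction n generalizing x with
  | zero => exact hfg x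
  | succ n ih =>
    rw [Function.iterate_succ_apply', Function.iterate_succ_apply']
    exact step_le_add hk hh hcfl (hf.iterate_step hk hh hcfl n) (hg.iterate_step hk hh hcfl n)
      hc ih x

theorem iterate_step_translate (h k : ℝ) (f : ℝ → ℝ) (y : ℝ) (n : ℕ) :
    (step h k)^[n] (fun x => f (x + y)) = fun x => (step h k)^[n] f (x + y) := by
  induction n with
  | zero => rfl
  | succ n ih =>
    rw [Function.iterate_succ_apply', Function.iterate_succ_apply', ih]
    exact funext fun x => step_translate h k _ y x

theorem iterate_step_reflect (h k : ℝ) (f : ℝ → ℝ) (n : ℕ) :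
    (step h k)^[n] (fun x => -f (-x)) = fun x => -(step h k)^[n] f (-x) := by
  induction n with
  | zero => rfl
  | succ n ih =>
    rw [Function.iterate_succ_apply', Function.iterate_succ_apply', ih]
    exact funext fun x => step_reflect h k _ x

theorem abs_iterate_step_sub_le {M h k c : ℝ} (hk : 0 < k) (hh : 0 ≤ h)
    (hcfl : 48 * M * h ≤ k ^ 2) {f g : ℝ → ℝ} (hf : BddCont M f) (hg : BddCont M g)
    (hfg : ∀ x, |f x - g x| ≤ c) (n : ℕ) (x : ℝ) :
    |(step h k)^[n] f x - (step h k)^[n] g x| ≤ c := by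
  have hc : 0 ≤ c := (abs_nonneg _).trans (hfg 0)
  have h1 := iterate_step_le_add hk hh hcfl hf hg hc
    (fun x => by linarith [(abs_le.1 (hfg x)).2]) n x
  have h2 := iterate_step_le_add hk hh hcfl hg hf hc
    (fun x => by linarith [(abs_le.1 (hfg x)).1]) n x
  exact abs_le.2 ⟨by linarith, by linarith⟩

/-- Moduli of continuity in space are preserved by the scheme. -/
theorem abs_iterate_step_sub_translate_le {M h k c y : ℝ} (hk : 0 < k) (hh : 0 ≤ h)
    (hcfl : 48 * M * h ≤ k ^ 2) {f : ℝ → ℝ} (hf : BddCont M f)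
    (hfy : ∀ x, |f (x + y) - f x| ≤ c) (n : ℕ) (x : ℝ) :
    |(step h k)^[n] f (x + y) - (step h k)^[n] f x| ≤ c := by
  have := abs_iterate_step_sub_le hk hh hcfl (hf.translate y) hf hfy n x
  rwa [iterate_step_translate] at this

theorem abs_step_sub_le {M K h k : ℝ} (hk : 0 < k) (hk1 : k ≤ 1) (hh : 0 ≤ h) (hK : 0 ≤ K)
    {g : ℝ → ℝ} (hg : BddCont M g)
    (h2 : ∀ x z, |2 * g x - g (x + z) - g (x - z)| ≤ 2 * K * z ^ 2)
    {L : ℝ} (hL : ∀ x y, |g (x + y) - g x| ≤ L * |y|) (x : ℝ) :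
    |step h k g x - g x| ≤ h * ((4 * M + 2 * K) * L) := by
  have hL0 : 0 ≤ L := by
    have := (abs_nonneg _).trans (hL 0 1)
    rwa [abs_one, mul_one] at this
  have hM := hg.nonneg
  have hv : |cutOp k g x| ≤ 4 * M + 2 * K := by
    have h3 := cutOp_sub_cutOp_mem hg.cont hg.bdd hK (h2 x) hk hk1
    have h4 := abs_le.1 (abs_cutOp_le one_pos hg.cont hg.bdd x)
    rw [div_one] at h4
    have h5 : 0 ≤ K * k := by positivity
    exact abs_le.2 ⟨by linarith, by linarith⟩
  have ha : |g x - g (x - k)| ≤ L * k := by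
    have := hL (x - k) k
    rwa [sub_add_cancel, abs_of_pos hk] at this
  have hb : |g (x + k) - g x| ≤ L * k := by
    have := hL x k
    rwa [abs_of_pos hk] at this
  have e1 : ∀ u : ℝ, max u 0 ≤ |u| := fun u => max_le (le_abs_self u) (abs_nonneg u)
  have e2 : max (cutOp k g x) 0 * max (g x - g (x - k)) 0 ≤ (4 * M + 2 * K) * (L * k) := by
    gcongr
    · exact (e1 _).trans hv
    · exact (e1 _).trans ha
  have e3 : max (-cutOp k g x) 0 * max (g (x + k) - g x) 0 ≤ (4 * M + 2 * K) * (L * k) := by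
    gcongr
    · exact (e1 _).trans (by rwa [abs_neg])
    · exact (e1 _).trans hb
  have e4 : 0 ≤ max (cutOp k g x) 0 * max (g x - g (x - k)) 0 := by positivity
  have e5 : 0 ≤ max (-cutOp k g x) 0 * max (g (x + k) - g x) 0 := by positivity
  unfold step
  rw [sub_sub_cancel_left, abs_neg, abs_mul, abs_of_nonneg hh, abs_div, abs_of_pos hk]
  refine mul_le_mul_of_nonneg_left ?_ hh
  rw [div_le_iff₀ hk]
  exact abs_le.2 ⟨by linarith, by linarith⟩

/-- Modulus of continuity in time of the scheme, uniform in the discretization. -/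
theorem exists_time_modulus {M e : ℝ} {f : ℝ → ℝ} (hf : UniformContinuous f)
    (hM : ∀ x, |f x| ≤ M) (he : 0 < e) :
    ∃ B, 0 ≤ B ∧ ∀ h k, 0 < k → k ≤ 1 → 0 ≤ h → 48 * (M + 1) * h ≤ k ^ 2 → ∀ n x,
      |(step h k)^[n] f x - f x| ≤ e + B * (n * h) := by
  obtain ⟨g, hg, hgf, K, hK⟩ := exists_contDiff_approx hf hM (e := min (e / 2) 1) (by positivity)
  have hK0 : 0 ≤ K := (abs_nonneg _).trans (hK 0)
  have hgf1 : ∀ x, |g x - f x| ≤ e / 2 := fun x => (hgf x).trans (min_le_left _ _)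
  have hgB : BddCont (M + 1) g := ⟨hg.continuous, fun x => by
    have h1 := abs_le.1 ((hgf x).trans (min_le_right _ _))
    have h2 := abs_le.1 (hM x)
    exact abs_le.2 ⟨by linarith, by linarith⟩⟩
  have hfB : BddCont (M + 1) f := ⟨hf.continuous, fun x => (hM x).trans (by linarith)⟩
  have hg1 : ContDiff ℝ 1 (deriv g) := by
    have : ContDiff ℝ (1 + 1) g := hg.of_le (by norm_num)
    exact (contDiff_succ_iff_deriv.1 this).2.2
  have hgd : Differentiable ℝ g := hg.differentiable (by norm_num)
  have hT := abs_taylor_le hgd (hg1.differentiable (by norm_num)) hK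
  have hder : ∀ x, |deriv g x| ≤ 2 * (M + 1) + K := fun x => by
    have h1 := abs_le.1 (hT x 1)
    have h2 := abs_le.1 (hgB.bdd x)
    have h3 := abs_le.1 (hgB.bdd (x + 1))
    exact abs_le.2 ⟨by linarith, by linarith⟩
  have hL : ∀ x y, |g (x + y) - g x| ≤ (2 * (M + 1) + K) * |y| := fun x y => by
    have := convex_univ.norm_image_sub_le_of_norm_deriv_le (f := g) (C := 2 * (M + 1) + K)
      (fun z _ => hgd z) (fun z _ => hder z) (mem_univ x) (mem_univ (x + y))
    rwa [add_sub_cancel_left] at this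
  have hL0 : 0 ≤ 2 * (M + 1) + K := (abs_nonneg _).trans (hder 0)
  have hM0 := hgB.nonneg
  refine ⟨(4 * (M + 1) + 2 * K) * (2 * (M + 1) + K), by positivity,
    fun h k hk hk1 hh hcfl n x => ?_⟩
  have h1 : ∀ n x, |(step h k)^[n] g x - g x| ≤
      (4 * (M + 1) + 2 * K) * (2 * (M + 1) + K) * (n * h) := by
    intro n
    induction n with
    | zero => intro x; simp
    | succ n ih =>
      intro x
      have h2 := abs_iterate_step_sub_le hk hh hcfl
        (hgB.step hk hh (by linarith [mul_nonneg hM0 hh])) hgB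
        (abs_step_sub_le hk hk1 hh hK0 hgB (fun x => second_diff_le_of_taylor (hT x)) hL) n x
      rw [← Function.iterate_succ_apply] at h2
      have h3 := abs_le.1 h2
      have h4 := abs_le.1 (ih x)
      push_cast
      exact abs_le.2 ⟨by linarith, by linarith⟩
  have h2 := abs_le.1 (abs_iterate_step_sub_le hk hh hcfl hgB hfB hgf1 n x)
  have h3 := abs_le.1 (hgf1 x)
  have h4 := abs_le.1 (h1 n x)
  exact abs_le.2 ⟨by linarith, by linarith⟩

theorem cutOp_le_cutOp_add {M ρ R e : ℝ} {f g : ℝ → ℝ} (hf : BddCont M f) (hg : BddCont M g)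
    (hρ : 0 < ρ) (hR : ρ ≤ R) (he : 0 ≤ e) {x y : ℝ}
    (h : ∀ z, |z| ≤ R → |f (x + z) - g (y + z)| ≤ e) :
    cutOp ρ f x ≤ cutOp ρ g y + (4 * e / ρ + 8 * M / R) := by
  have hR0 : 0 < R := hρ.trans_le hR
  have hd : Continuous fun z => (2 * g y - g (y + z) - g (y - z)) -
      (2 * f x - f (x + z) - f (x - z)) :=
    (continuous_second_diff hg.cont y).sub (continuous_second_diff hf.cont x)
  have hb : ∀ z, |(2 * g y - g (y + z) - g (y - z)) - (2 * f x - f (x + z) - f (x - z))| ≤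
      8 * M := fun z => (abs_sub _ _).trans (by
    linarith [abs_second_diff_le hg.bdd y z, abs_second_diff_le hf.bdd x z])
  have h1 : tailInt ρ _ = cutOp ρ g y - cutOp ρ f x :=
    tailInt_sub hρ (continuous_second_diff hg.cont y) (abs_second_diff_le hg.bdd y)
      (continuous_second_diff hf.cont x) (abs_second_diff_le hf.bdd x)
  have h2 := tailInt_split hρ hR hd hb
  have h3 := le_integral_mid hρ hR hd (b := 4 * e) (c := 0) le_rfl (fun z hz hzR => by
    have a0 := abs_le.1 (h 0 (by rw [abs_zero]; linarith))
    have a1 := abs_le.1 (h z (abs_le.2 ⟨by linarith, hzR⟩))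
    have a2 := abs_le.1 (h (-z) (abs_le.2 ⟨by linarith, by linarith⟩))
    rw [add_zero, add_zero] at a0
    rw [← sub_eq_add_neg, ← sub_eq_add_neg] at a2
    linarith) (by positivity)
  have h4 := le_tailInt hR0 hd hb (c := -(8 * M)) fun z _ => (abs_le.1 (hb z)).1
  rw [neg_div] at h4
  linarith

/-- Consistency of the scheme at a point touched from above by a parabola. -/
theorem step_touch {M h k ρ a p C : ℝ} {f : ℝ → ℝ} (hf : BddCont M f) {x : ℝ} (hk : 0 < k)
    (hkρ : k ≤ ρ) (hh : 0 < h) (hC : 0 ≤ C)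
    (hsmall : h * (2 * |p| / k + 4 * M / k ^ 2 + 4 * C) ≤ 1)
    (htouch : ∀ z, |z| ≤ ρ → f (x + z) ≤ step h k f x - a * h + p * z + C * z ^ 2) :
    a - 2 * C * k * (4 * M / ρ + 2 * C * ρ) +
      max (p - C * k) 0 * (cutOp ρ f x - 2 * C * ρ) ≤ 0 := by
  have hρ : 0 < ρ := hk.trans_le hkρ
  have hM := hf.nonneg
  obtain ⟨D, hD⟩ : ∃ D, D = step h k f x - a * h - f x := ⟨_, rfl⟩
  obtain ⟨V, hV⟩ : ∃ V, V = cutOp ρ f x - 2 * C * ρ := ⟨_, rfl⟩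
  obtain ⟨v, hv⟩ : ∃ v, v = cutOp k f x := ⟨_, rfl⟩
  obtain ⟨q, hq⟩ : ∃ q, q = max (p - C * k) 0 := ⟨_, rfl⟩
  obtain ⟨α, hα⟩ : ∃ α, α = max (f x - f (x - k)) 0 := ⟨_, rfl⟩
  obtain ⟨β, hβ⟩ : ∃ β, β = max (f (x + k) - f x) 0 := ⟨_, rfl⟩
  have hD0 : 0 ≤ D := by
    have := htouch 0 (by rw [abs_zero]; exact hρ.le)
    rw [add_zero] at this
    linarith
  have hvV : V - 2 * D / k ≤ v := by
    have hc := continuous_second_diff hf.cont x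
    have h1 : cutOp k f x = _ + cutOp ρ f x :=
      tailInt_split hk hkρ hc (abs_second_diff_le hf.bdd x)
    have h2 := le_integral_mid hk hkρ hc (b := 2 * D) (c := 2 * C) (by positivity)
      (fun z hz hzρ => by
        have a1 := htouch z (abs_le.2 ⟨by linarith, hzρ⟩)
        have a2 := htouch (-z) (abs_le.2 ⟨by linarith, by linarith⟩)
        rw [← sub_eq_add_neg] at a2
        linarith) (by positivity)
    rw [hv, hV]
    linarith
  have hvM : |v| ≤ 4 * M / k := hv ▸ abs_cutOp_le hk hf.cont hf.bdd x
  have hVm : -(4 * M / ρ + 2 * C * ρ) ≤ V := by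
    have := (abs_le.1 (abs_cutOp_le hρ hf.cont hf.bdd x)).1
    rw [hV]
    linarith
  have hB : 0 ≤ 4 * M / ρ + 2 * C * ρ := by positivity
  obtain ⟨B, hBe⟩ : ∃ B, B = 4 * M / ρ + 2 * C * ρ := ⟨_, rfl⟩
  rw [← hBe] at hVm hB ⊢
  have hq0 : 0 ≤ q := hq ▸ le_max_right _ _
  have hqp : q ≤ |p| := hq ▸ max_le (by linarith [le_abs_self p, mul_nonneg hC hk.le])
    (abs_nonneg p)
  have hα' : q * k - D ≤ α := by
    have h1 := htouch (-k) (by rwa [abs_neg, abs_of_pos hk])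
    rw [← sub_eq_add_neg] at h1
    have h2 : f x - f (x - k) ≤ α := hα ▸ le_max_left _ _
    have h3 : 0 ≤ α := hα ▸ le_max_right _ _
    rcases le_total (p - C * k) 0 with h4 | h4
    · rw [hq, max_eq_right h4]
      linarith
    · rw [hq, max_eq_left h4]
      linarith
  have hβ' : β ≤ q * k + 2 * C * k ^ 2 + D := by
    have h1 := htouch k (by rwa [abs_of_pos hk])
    have h2 : (p - C * k) * k ≤ q * k :=
      mul_le_mul_of_nonneg_right (hq ▸ le_max_left _ _) hk.le
    rw [hβ]
    refine max_le (by linarith) (by positivity)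
  have hstep : step h k f x = f x - h * ((max v 0 * α - max (-v) 0 * β) / k) := by
    rw [hv, hα, hβ]
    rfl
  have hvm : max (-v) 0 ≤ B + 2 * D / k := max_le (by linarith) (by positivity)
  have e0 : max v 0 - max (-v) 0 = v := by
    rcases le_total v 0 with h1 | h1
    · rw [max_eq_right h1, max_eq_left (by linarith)]
      ring
    · rw [max_eq_left h1, max_eq_right (by linarith)]
      ring
  have e0' : max v 0 + max (-v) 0 = |v| := by
    rcases le_total v 0 with h1 | h1
    · rw [max_eq_right h1, max_eq_left (by linarith), abs_of_nonpos h1]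
      ring
    · rw [max_eq_left h1, max_eq_right (by linarith), abs_of_nonneg h1]
      ring
  have f1 : max v 0 * (q * k - D) ≤ max v 0 * α :=
    mul_le_mul_of_nonneg_left hα' (le_max_right _ _)
  have f2 : max (-v) 0 * β ≤ max (-v) 0 * (q * k + 2 * C * k ^ 2 + D) :=
    mul_le_mul_of_nonneg_left hβ' (le_max_right _ _)
  have f3 : max (-v) 0 * (2 * C * k ^ 2) ≤ (B + 2 * D / k) * (2 * C * k ^ 2) :=
    mul_le_mul_of_nonneg_right hvm (by positivity)
  have f4 : |v| * D ≤ 4 * M / k * D := mul_le_mul_of_nonneg_right hvM hD0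
  have f5 : (V - 2 * D / k) * (q * k) ≤ v * (q * k) :=
    mul_le_mul_of_nonneg_right hvV (by positivity)
  have f6 : 2 * D * q ≤ 2 * D * |p| := mul_le_mul_of_nonneg_left hqp (by positivity)
  have f7 : k * (V * q - 2 * C * k * B - D * (2 * |p| / k + 4 * M / k ^ 2 + 4 * C)) ≤
      max v 0 * α - max (-v) 0 * β := by
    have i1 : k * (V * q - 2 * C * k * B - D * (2 * |p| / k + 4 * M / k ^ 2 + 4 * C)) =
        V * (q * k) - 2 * C * k ^ 2 * B - 2 * D * |p| - 4 * M / k * D - 4 * C * k * D := by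
      field_simp
      ring
    have i2 : (B + 2 * D / k) * (2 * C * k ^ 2) = 2 * C * k ^ 2 * B + 4 * C * k * D := by
      field_simp
      ring
    have i3 : (V - 2 * D / k) * (q * k) = V * (q * k) - 2 * D * q := by
      field_simp
    rw [i1]
    rw [i2] at f3
    rw [i3, ← e0] at f5
    rw [← e0'] at f4
    linarith
  rw [mul_comm k, ← le_div_iff₀ hk] at f7
  have f8 := mul_le_mul_of_nonneg_left f7 hh.le
  have f9 := mul_le_mul_of_nonneg_left hsmall hD0
  have f10 : h * (a - 2 * C * k * B + q * V) ≤ 0 := by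
    linarith
  rw [← hV, ← hq]
  exact nonpos_of_mul_nonpos_right f10 hh

/-- `E` is approximated on `[0,T]`, locally uniformly in space, by the scheme started at `f`. -/
def SchemeLimit (M T : ℝ) (f : ℝ → ℝ) (E : ℝ → ℝ → ℝ) : Prop :=
  ∀ e R : ℝ, 0 < e → ∃ k, 0 < k ∧ k ≤ e ∧ k ≤ 1 ∧ 48 * (M + 1) * k ≤ 1 ∧
    ∀ (j : ℕ) x, j * k ^ 3 ≤ T → |x| ≤ R →
      |(step (k ^ 3) k)^[j] f x - E (j * k ^ 3) x| ≤ e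

theorem cfl_of_cube {M k : ℝ} (hk : 0 < k) (h : 48 * (M + 1) * k ≤ 1) :
    48 * M * k ^ 3 ≤ k ^ 2 := by
  have h1 : 48 * M * k ≤ 1 := by linarith
  have h2 := mul_le_mul_of_nonneg_right h1 (sq_nonneg k)
  linarith

/-- The function `E` touched in the past can be replaced by the scheme. -/
theorem exists_scheme_touch {h t₀ x₀ a p C τ r : ℝ} {A : ℕ → ℝ → ℝ} (hA : ∀ j, Continuous (A j))
    (hh : 0 < h) (hhτ : h ≤ τ) (hτ : τ ≤ t₀) (hr : 0 < r) {E : ℝ → ℝ → ℝ}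
    {ζ s e : ℝ} (hζ : 0 < ζ) (hs : 0 < s) (hs1 : s ≤ 1)
    (hsτ : s + h ≤ τ)
    (hAE : ∀ (j : ℕ) y, j * h ≤ t₀ → |y| ≤ r → |A j (x₀ + y) - E (j * h) (x₀ + y)| ≤ e)
    (hEt : ∀ t, |t - t₀| ≤ h → |E t x₀ - E t₀ x₀| ≤ e)
    (hsm : 3 * e + |a - ζ| * h ≤ ζ * s ^ 2)
    (htouch : ∀ t y, t₀ - τ ≤ t → t ≤ t₀ → |y| ≤ r →
      E t (x₀ + y) ≤ E t₀ x₀ + a * (t - t₀) + p * y + C * y ^ 2) :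
    ∃ (m : ℕ) (y : ℝ), (m + 1) * h ≤ t₀ ∧ t₀ - s ≤ (m + 1) * h ∧ |y| ≤ s ∧
      ∀ z, |y + z| ≤ r → A m (x₀ + y + z) ≤ A (m + 1) (x₀ + y) - (a - ζ) * h +
        (p + 2 * (C + ζ) * y) * z + (C + ζ) * z ^ 2 := by
  have hJ : {j : ℕ | t₀ - τ ≤ j * h ∧ j * h ≤ t₀}.Finite :=
    (finite_Iic ⌊t₀ / h⌋₊).subset fun j hj => Nat.le_floor ((le_div_iff₀ hh).2 hj.2)
  have ht₀ : 0 ≤ t₀ := hh.le.trans (hhτ.trans hτ)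
  obtain ⟨j₀, hj₀, hj₀'⟩ : ∃ j₀ : ℕ, j₀ * h ≤ t₀ ∧ t₀ < (j₀ + 1) * h :=
    ⟨⌊t₀ / h⌋₊, (le_div_iff₀ hh).1 (Nat.floor_le (by positivity)),
      (div_lt_iff₀ hh).1 (Nat.lt_floor_add_one _)⟩
  have hcont : Continuous fun q : ℕ × ℝ => A q.1 (x₀ + q.2) -
      ((a - ζ) * (q.1 * h - t₀) + p * q.2 + (C + ζ) * q.2 ^ 2) := by
    rw [continuous_prod_of_discrete_left]
    intro j
    have := hA j
    simp only
    fun_prop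
  have hmem : (j₀, (0 : ℝ)) ∈ {j : ℕ | t₀ - τ ≤ j * h ∧ j * h ≤ t₀} ×ˢ Icc (-r) r :=
    ⟨⟨by simp only; linarith, hj₀⟩, by simp only; linarith, by simp only; linarith⟩
  obtain ⟨⟨j, y⟩, ⟨⟨hj1, hj2⟩, hy⟩, hmax⟩ :=
    (hJ.isCompact.prod isCompact_Icc).exists_isMaxOn ⟨_, hmem⟩ hcont.continuousOn
  simp only at hj1 hj2 hy
  have hy' : |y| ≤ r := abs_le.2 hy
  have h1 := hmax hmem
  simp only [mem_ofPred_eq] at h1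
  have h2 := abs_le.1 (hAE j₀ 0 hj₀ (by rw [abs_zero]; exact hr.le))
  have h3 := abs_le.1 (hEt (j₀ * h) (abs_le.2 ⟨by linarith, by linarith⟩))
  have h4 := abs_le.1 (hAE j y hj2 hy')
  have h5 := htouch (j * h) y hj1 hj2 hy'
  rw [add_zero] at h1 h2
  have h6 : -(|a - ζ| * h) ≤ -((a - ζ) * (j₀ * h - t₀)) := by
    have := neg_abs_le (-((a - ζ) * (j₀ * h - t₀)))
    rw [abs_neg, abs_mul] at this
    have h7 : |j₀ * h - t₀| ≤ h := abs_le.2 ⟨by linarith, by linarith⟩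
    have := mul_le_mul_of_nonneg_left h7 (abs_nonneg (a - ζ))
    linarith
  have h7 : ζ * ((t₀ - j * h) + y ^ 2) ≤ ζ * s ^ 2 := by linarith
  have h8 : (t₀ - j * h) + y ^ 2 ≤ s ^ 2 := le_of_mul_le_mul_left h7 hζ
  have h9 : s ^ 2 ≤ s := by
    have := mul_le_mul_of_nonneg_left hs1 hs.le
    linarith
  have hys : |y| ≤ s := abs_le_of_sq_le_sq (by linarith) hs.le
  have htj : t₀ - s ≤ j * h := by linarith [sq_nonneg y]
  obtain ⟨m, rfl⟩ : ∃ m, j = m + 1 := by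
    refine Nat.exists_eq_add_one_of_ne_zero ?_
    rintro rfl
    rw [Nat.cast_zero, zero_mul] at htj
    linarith
  push_cast at hj1 hj2 htj h1 hmax
  refine ⟨m, y, hj2, htj, hys, fun z hz => ?_⟩
  have h10 := @hmax (m, y + z) ⟨⟨by simp only; linarith, by simp only; linarith⟩, abs_le.1 hz⟩
  simp only [mem_ofPred_eq, ← add_assoc] at h10
  push_cast at h10
  linarith

set_option maxHeartbeats 1000000 in
theorem SchemeLimit.pastSub {M T : ℝ} {f : ℝ → ℝ} {E : ℝ → ℝ → ℝ} (h : SchemeLimit M T f E)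
    (hf : BddCont M f) (hE : BddUC M E) : PastSub T E := by
  intro t₀ x₀ a p C τ r ρ ht₀ ht₀T hτ hτt₀ hC hρ hρr htouch
  have hM := hE.nonneg
  refine nonpos_of_approx (X := ℝ × ℝ × ℝ × ℝ) (x₀ := (a, p, C, cutOp ρ (E t₀) x₀))
    (Ψ := fun q => q.1 + max q.2.1 0 * (q.2.2.2 - 2 * q.2.2.1 * ρ))
    (Continuous.continuousAt (by fun_prop)) fun ε hε => ?_
  obtain ⟨ζ, hζ, hζε⟩ : ∃ ζ : ℝ, 0 < ζ ∧ ζ ≤ ε / 4 := ⟨ε / 4, by positivity, le_rfl⟩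
  obtain ⟨C', hC'⟩ : ∃ C', C' = C + ζ := ⟨_, rfl⟩
  have hC'0 : 0 ≤ C' := by linarith
  obtain ⟨e₀, he₀⟩ : ∃ e₀, e₀ = ε * ρ / 32 := ⟨_, rfl⟩
  have he₀0 : 0 < e₀ := by rw [he₀]; positivity
  obtain ⟨R, hR⟩ : ∃ R, R = ρ + 32 * M / ε := ⟨_, rfl⟩
  have hRρ : ρ ≤ R := by
    have : 0 ≤ 32 * M / ε := by positivity
    linarith
  have hR0 : 0 < R := hρ.trans_le hRρ
  have hRM : 8 * M / R ≤ ε / 4 := by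
    rw [div_le_iff₀ hR0, hR, mul_add]
    have : ε / 4 * (32 * M / ε) = 8 * M := by
      field_simp
      ring
    have : 0 ≤ ε / 4 * ρ := by positivity
    linarith
  obtain ⟨d, hd, hdE⟩ := hE.modulus he₀0
  obtain ⟨s, hs, hs1, hsτ, hsr, hsC, hsd⟩ : ∃ s, 0 < s ∧ s < 1 ∧ s < τ / 2 ∧ s < r - ρ ∧
      2 * C' * s < ε / 4 ∧ s < d / 2 :=
    (eventually_pos.and ((eventually_small one_pos).and ((eventually_small (half_pos hτ)).and
      ((eventually_small (sub_pos.2 hρr)).and ((eventually_small_mul _ (by positivity)).and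
        (eventually_small (half_pos hd))))))).exists
  have hζs : 0 < ζ * s ^ 2 / 8 := by positivity
  obtain ⟨d₂, hd₂, hdE₂⟩ := hE.modulus hζs
  obtain ⟨B, hB⟩ : ∃ B, B = 4 * M / ρ + 2 * C' * ρ := ⟨_, rfl⟩
  obtain ⟨e, he, hee₀, heζ, hea, hed₂, hed, heτ, heρ, heB, heC, hes⟩ : ∃ e, 0 < e ∧ e < e₀ ∧
      e < ζ * s ^ 2 / 8 ∧ |a - ζ| * e < ζ * s ^ 2 / 8 ∧ e < d₂ ∧ e < d / 2 ∧ e < τ / 2 ∧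
      e < ρ ∧ 2 * C' * B * e < ε / 4 ∧ C' * e < ε / 4 ∧
      (2 * (|p| + 2 * C') + 4 * M + 4 * C') * e < 1 :=
    (eventually_pos.and ((eventually_small he₀0).and ((eventually_small hζs).and
      ((eventually_small_mul _ hζs).and ((eventually_small hd₂).and
      ((eventually_small (half_pos hd)).and ((eventually_small (half_pos hτ)).and
      ((eventually_small hρ).and ((eventually_small_mul _ (by positivity)).and
      ((eventually_small_mul _ (by positivity)).and
      (eventually_small_mul _ one_pos))))))))))).exists
  obtain ⟨k, hk, hke, hk1, hcfl, hlim⟩ := h (min e (ζ * s ^ 2 / 8)) (|x₀| + R + r) (by positivity)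
  have hke' : k ≤ e := hke.trans (min_le_left _ _)
  obtain ⟨h, hh⟩ : ∃ h, h = k ^ 3 := ⟨_, rfl⟩
  have hh0 : 0 < h := by rw [hh]; positivity
  have hhk : h ≤ k := by
    rw [hh]
    exact pow_le_of_le_one hk.le hk1 (by norm_num)
  have hhe : h ≤ e := hhk.trans hke'
  rw [← hh] at hlim
  have hcfl' : 48 * M * h ≤ k ^ 2 := hh ▸ cfl_of_cube hk hcfl
  have hAB : ∀ j, BddCont M ((step h k)^[j] f) := fun j => hf.iterate_step hk hh0.le hcfl' j
  obtain ⟨m, y, hm1, hm2, hy, hmt⟩ := exists_scheme_touch (h := h) (fun j => (hAB j).cont) hh0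
    (by linarith) hτt₀ (hρ.trans hρr) hζ hs hs1.le (by linarith) (e := ζ * s ^ 2 / 8)
    (fun j y hj hy => (hlim j _ (hj.trans ht₀T) ((abs_add_le _ _).trans (by linarith))).trans
      (min_le_right _ _))
    (fun t ht => hdE₂ _ _ _ _ (by linarith) (by simpa using hd₂.le))
    (by linarith [mul_le_mul_of_nonneg_left hhe (abs_nonneg (a - ζ))]) htouch
  rw [← hC'] at hmt
  obtain ⟨q, hq⟩ : ∃ q, q = p + 2 * C' * y := ⟨_, rfl⟩
  have hyC : |2 * C' * y| ≤ 2 * C' * s := by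
    rw [abs_mul, abs_of_nonneg (by positivity)]
    exact mul_le_mul_of_nonneg_left hy (by positivity)
  have hq1 : |q| ≤ |p| + 2 * C' := by
    rw [hq]
    refine (abs_add_le _ _).trans ?_
    have := mul_le_mul_of_nonneg_left hs1.le (by positivity : 0 ≤ 2 * C')
    linarith
  have hsmall : h * (2 * |q| / k + 4 * M / k ^ 2 + 4 * C') ≤ 1 := by
    have e1 : h * (2 * |q| / k + 4 * M / k ^ 2 + 4 * C') =
        (2 * |q| * k + 4 * M + 4 * C' * k ^ 2) * k := by
      rw [hh]
      field_simp
    have e2 : 2 * |q| * k ≤ 2 * (|p| + 2 * C') := by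
      have := mul_le_mul hq1 hk1 hk.le (by positivity)
      linarith
    have e3 : 4 * C' * k ^ 2 ≤ 4 * C' := mul_le_of_le_one_right (by positivity)
      (pow_le_one₀ hk.le hk1)
    have e4 : (2 * |q| * k + 4 * M + 4 * C' * k ^ 2) * k ≤
        (2 * (|p| + 2 * C') + 4 * M + 4 * C') * e := mul_le_mul (by linarith) hke' hk.le
          (by positivity)
    linarith
  have hfin := step_touch (hAB m) (x := x₀ + y) (ρ := ρ) (a := a - ζ) (p := q) (C := C') hk
    (by linarith) hh0 hC'0 hsmall fun z hz => by
      rw [← Function.iterate_succ_apply' (step h k) m f, hq]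
      exact hmt z ((abs_add_le _ _).trans (by linarith))
  rw [← hB] at hfin
  have hclose : ∀ z, |z| ≤ R →
      |(step h k)^[m] f (x₀ + y + z) - E t₀ (x₀ + z)| ≤ 2 * e₀ := fun z hz => by
    have c1 := hlim m (x₀ + y + z) (by linarith)
      ((abs_add_le _ _).trans (by linarith [abs_add_le x₀ y]))
    have c2 := hdE (m * h) t₀ (x₀ + y + z) (x₀ + z) (abs_le.2 ⟨by linarith, by linarith⟩) (by
      rw [show x₀ + y + z - (x₀ + z) = y by ring]
      linarith)
    have c3 := abs_sub_le ((step h k)^[m] f (x₀ + y + z)) (E (m * h) (x₀ + y + z))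
      (E t₀ (x₀ + z))
    linarith [min_le_left e (ζ * s ^ 2 / 8)]
  have hEB : BddCont M (E t₀) := ⟨hE.slice t₀, hE.bdd t₀⟩
  have k1 := cutOp_le_cutOp_add (hAB m) hEB hρ hRρ (by positivity) hclose
  have k2 := cutOp_le_cutOp_add hEB (hAB m) hρ hRρ (x := x₀) (y := x₀ + y) (e := 2 * e₀)
    (by positivity) fun z hz => by
    rw [abs_sub_comm]
    exact hclose z hz
  have k3 : 4 * (2 * e₀) / ρ = ε / 4 := by
    rw [he₀]
    field_simp
    norm_num
  rw [k3] at k1 k2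
  refine ⟨(a - ζ - 2 * C' * k * B, q - C' * k, C', cutOp ρ ((step h k)^[m] f) (x₀ + y)), ?_, hfin⟩
  have hB0 : 0 ≤ B := by rw [hB]; positivity
  have l1 : 2 * C' * k * B ≤ 2 * C' * B * e := by
    have := mul_le_mul_of_nonneg_left hke' (by positivity : 0 ≤ 2 * C' * B)
    linarith
  have l2 : 0 ≤ 2 * C' * k * B := by positivity
  have l3 : C' * k ≤ C' * e := mul_le_mul_of_nonneg_left hke' hC'0
  have l4 : 0 ≤ C' * k := by positivity
  have l5 := abs_le.1 hyC
  simp only [Prod.dist_eq, Real.dist_eq]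
  refine max_lt (abs_lt.2 ⟨by linarith, by linarith⟩) (max_lt (abs_lt.2 ⟨by linarith, by linarith⟩)
    (max_lt (abs_lt.2 ⟨by linarith, by linarith⟩) (abs_lt.2 ⟨by linarith, by linarith⟩)))

theorem floor_div_le {h s t : ℝ} (hh : 0 < h) (hst : s ≤ t) :
    (⌊t / h⌋₊ : ℝ) ≤ ⌊s / h⌋₊ + ((t - s) / h + 1) := by
  have h1 : 0 ≤ (t - s) / h := div_nonneg (sub_nonneg.2 hst) hh.le
  rcases le_total 0 t with ht | ht
  · have h2 := Nat.floor_le (div_nonneg ht hh.le)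
    have h3 := Nat.lt_floor_add_one (s / h)
    rw [sub_div]
    linarith
  · rw [Nat.floor_of_nonpos (div_nonpos_of_nonpos_of_nonneg ht hh.le), Nat.cast_zero]
    positivity

theorem abs_iterate_step_time_le {M h k e B : ℝ} {f : ℝ → ℝ} (hf : BddCont M f) (hk : 0 < k)
    (hh : 0 < h) (hcfl : 48 * M * h ≤ k ^ 2) (hB : 0 ≤ B)
    (H : ∀ n x, |(step h k)^[n] f x - f x| ≤ e + B * (n * h)) {s t : ℝ} (hst : s ≤ t) (x : ℝ) :
    |(step h k)^[⌊t / h⌋₊] f x - (step h k)^[⌊s / h⌋₊] f x| ≤ e + B * ((t - s) + h) := by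
  obtain ⟨j, hj⟩ := Nat.exists_eq_add_of_le
    (Nat.floor_mono (div_le_div_of_nonneg_right hst hh.le))
  have h1 := floor_div_le hh hst
  rw [hj] at h1 ⊢
  push_cast at h1
  have h2 : j * h ≤ (t - s) + h := by
    have := mul_le_mul_of_nonneg_right (add_le_add_iff_left _ |>.1 h1) hh.le
    rwa [add_mul, div_mul_cancel₀ _ hh.ne', one_mul] at this
  rw [Function.iterate_add_apply]
  refine abs_iterate_step_sub_le hk hh.le hcfl (hf.iterate_step hk hh.le hcfl j) hf
    (fun x => (H j x).trans ?_) _ x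
  have := mul_le_mul_of_nonneg_left h2 hB
  linarith

/-- Mesh sizes going to zero which are compatible with the stability condition. -/
theorem exists_mesh {M : ℝ} (hM : 0 ≤ M) : ∃ k : ℕ → ℝ, (∀ n, 0 < k n ∧ k n ≤ 1 ∧
    48 * (M + 1) * k n ≤ 1) ∧ ∀ e > 0, ∀ᶠ n in atTop, k n ≤ e := by
  refine ⟨fun n => (48 * (M + 1) + n)⁻¹, fun n => ⟨by positivity, inv_le_one_of_one_le₀ ?_, ?_⟩,
    fun e he => ?_⟩
  · have : (0 : ℝ) ≤ n := n.cast_nonneg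
    linarith
  · rw [mul_inv_le_iff₀ (by positivity), one_mul]
    linarith [(n.cast_nonneg : (0 : ℝ) ≤ n)]
  · filter_upwards [eventually_ge_atTop ⌈e⁻¹⌉₊] with n hn
    refine inv_le_of_inv_le₀ he ?_
    linarith [Nat.ceil_le.1 hn]

theorem SchemeLimit.dual {M T : ℝ} {f : ℝ → ℝ} {E : ℝ → ℝ → ℝ} (h : SchemeLimit M T f E) :
    SchemeLimit M T (fun x => -f (-x)) (dual E) := by
  intro e R he
  obtain ⟨k, hk, hke, hk1, hcfl, H⟩ := h e R he
  refine ⟨k, hk, hke, hk1, hcfl, fun j x hj hx => ?_⟩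
  rw [iterate_step_reflect]
  have := H j (-x) hj (by rwa [abs_neg])
  rw [abs_sub_comm] at this
  refine le_of_eq_of_le (congrArg _ ?_) this
  unfold _root_.dual
  ring

theorem exists_ultrafilter_limit {M : ℝ} (U : Ultrafilter ℕ) {A : ℕ → ℝ → ℝ → ℝ}
    (hA : ∀ n t x, |A n t x| ≤ M) :
    ∃ E : ℝ → ℝ → ℝ, ∀ t x, Tendsto (fun n => A n t x) U (𝓝 (E t x)) := by
  have : ∀ t x, ∃ l, Tendsto (fun n => A n t x) U (𝓝 l) := fun t x => by
    obtain ⟨l, -, hl⟩ := (isCompact_Icc (a := -M) (b := M)).ultrafilter_le_nhds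
      (U.map fun n => A n t x) (by
        rw [le_principal_iff]
        exact Ultrafilter.mem_map.2 (univ_mem' fun n => abs_le.1 (hA n t x)))
    exact ⟨l, hl⟩
  choose E hE using this
  exact ⟨E, hE⟩

/-- Asymptotically equicontinuous sequences converge locally uniformly. -/
theorem eventually_forall_abs_sub_le {l : Filter ℕ} {A : ℕ → ℝ → ℝ → ℝ} {E : ℝ → ℝ → ℝ}
    (hE : ∀ t x, Tendsto (fun n => A n t x) l (𝓝 (E t x)))
    (hA : ∀ e > 0, ∃ d > 0, ∀ᶠ n in l, ∀ t s x y, |t - s| ≤ d → |x - y| ≤ d →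
      |A n t x - A n s y| ≤ e)
    (hEc : ∀ e > 0, ∃ d > 0, ∀ t s x y, |t - s| ≤ d → |x - y| ≤ d → |E t x - E s y| ≤ e)
    {Q : Set (ℝ × ℝ)} (hQ : IsCompact Q) {e : ℝ} (he : 0 < e) :
    ∀ᶠ n in l, ∀ q ∈ Q, |A n q.1 q.2 - E q.1 q.2| ≤ e := by
  refine hQ.induction_on (p := fun s => ∀ᶠ n in l, ∀ q ∈ s, |A n q.1 q.2 - E q.1 q.2| ≤ e)
    (by simp) (fun s t hst ht => ht.mono fun n hn q hq => hn q (hst hq))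
    (fun s t hs ht => (hs.and ht).mono fun n hn q hq => hq.elim (hn.1 q) (hn.2 q))
    fun q _ => ?_
  obtain ⟨d, hd, H⟩ := hA (e / 3) (by positivity)
  obtain ⟨d', hd', H'⟩ := hEc (e / 3) (by positivity)
  refine ⟨Metric.ball q (min d d'), mem_nhdsWithin_of_mem_nhds
    (Metric.ball_mem_nhds _ (lt_min hd hd')), ?_⟩
  filter_upwards [H, Metric.tendsto_nhds.1 (hE q.1 q.2) (e / 3) (by positivity)] with n hn hn' q' hq'
  rw [Metric.mem_ball, Prod.dist_eq, Real.dist_eq, Real.dist_eq, max_lt_iff, lt_min_iff,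
    lt_min_iff] at hq'
  obtain ⟨⟨a1, a2⟩, a3, a4⟩ := hq'
  have b1 := abs_le.1 (hn _ _ _ _ a1.le a3.le)
  have b2 := abs_le.1 (H' _ _ _ _ a2.le a4.le)
  have b3 := abs_lt.1 hn'
  exact abs_le.2 ⟨by linarith, by linarith⟩

theorem exists_schemeLimit {M : ℝ} {f : ℝ → ℝ} (hf : UniformContinuous f) (hM : ∀ x, |f x| ≤ M) :
    ∃ E, BddUC M E ∧ E 0 = f ∧ (∀ T, SchemeLimit M T f E) ∧
      ∀ y c, (∀ x, |f (x + y) - f x| ≤ c) → ∀ t x, |E t (x + y) - E t x| ≤ c := by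
  have hfB : BddCont M f := ⟨hf.continuous, hM⟩
  obtain ⟨k, hk, hk0⟩ := exists_mesh hfB.nonneg
  have hcfl : ∀ n, 48 * M * k n ^ 3 ≤ k n ^ 2 := fun n => cfl_of_cube (hk n).1 (hk n).2.2
  have hh : ∀ n, 0 < k n ^ 3 := fun n => pow_pos (hk n).1 3
  have hhk : ∀ n, k n ^ 3 ≤ k n := fun n => pow_le_of_le_one (hk n).1.le (hk n).2.1 (by norm_num)
  obtain ⟨A, hA⟩ : ∃ A : ℕ → ℝ → ℝ → ℝ,
    ∀ n t, A n t = (step (k n ^ 3) (k n))^[⌊t / k n ^ 3⌋₊] f := ⟨_, fun _ _ => rfl⟩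
  have hAB : ∀ n t x, |A n t x| ≤ M := fun n t x => by
    rw [hA]
    exact (hfB.iterate_step (hk n).1 (hh n).le (hcfl n) _).bdd x
  have hAy : ∀ y c, (∀ x, |f (x + y) - f x| ≤ c) → ∀ n t x, |A n t (x + y) - A n t x| ≤ c :=
    fun y c hc n t x => by
      rw [hA]
      exact abs_iterate_step_sub_translate_le (hk n).1 (hh n).le (hcfl n) hfB hc _ x
  have hequi : ∀ e > 0, ∃ d > 0, ∀ᶠ n in atTop, ∀ t s x y, |t - s| ≤ d → |x - y| ≤ d →
      |A n t x - A n s y| ≤ e := fun e he => by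
    obtain ⟨B, hB, H⟩ := exists_time_modulus hf hM (e := e / 4) (by positivity)
    obtain ⟨d, hd, hfd⟩ := Metric.uniformContinuous_iff.1 hf (e / 2) (by positivity)
    obtain ⟨d', hd', hdd, hdB⟩ : ∃ d', 0 < d' ∧ d' < d ∧ 2 * B * d' < e / 4 :=
      (eventually_pos.and ((eventually_small hd).and
        (eventually_small_mul _ (by positivity)))).exists
    refine ⟨d', hd', (hk0 d' hd').mono fun n hn => ?_⟩
    have ht : ∀ t s x, s ≤ t → t - s ≤ d' → |A n t x - A n s x| ≤ e / 2 := fun t s x hst hts => by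
      have h1 := abs_iterate_step_time_le hfB (hk n).1 (hh n) (hcfl n) hB
        (H _ _ (hk n).1 (hk n).2.1 (hh n).le (by
          have := mul_le_mul_of_nonneg_right (hk n).2.2 (sq_nonneg (k n))
          linarith)) hst x
      rw [hA, hA]
      have h2 : B * ((t - s) + k n ^ 3) ≤ B * (d' + d') :=
        mul_le_mul_of_nonneg_left (add_le_add hts ((hhk n).trans hn)) hB
      linarith
    intro t s x y hts hxy
    have h1 : |A n t x - A n s x| ≤ e / 2 := by
      have := abs_le.1 hts
      rcases le_total s t with h | h
      · exact ht t s x h (by linarith)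
      · rw [abs_sub_comm]
        exact ht s t x h (by linarith)
    have h2 := hAy (x - y) (e / 2) (fun z => (hfd (by
      rw [Real.dist_eq, add_sub_cancel_left]
      linarith)).le) n s y
    rw [add_sub_cancel] at h2
    linarith [abs_sub_le (A n t x) (A n s x) (A n s y)]
  obtain ⟨E, hE⟩ := exists_ultrafilter_limit (hyperfilter ℕ) hAB
  have hUle : ∀ {p : ℕ → Prop}, (∀ᶠ n in atTop, p n) → ∀ᶠ n in hyperfilter ℕ, p n := by
    have : (hyperfilter ℕ : Filter ℕ) ≤ atTop := by
      rw [← Nat.cofinite_eq_atTop]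
      exact hyperfilter_le_cofinite
    exact fun {p} hp => this hp
  have hEmod : ∀ e > 0, ∃ d > 0, ∀ t s x y, |t - s| ≤ d → |x - y| ≤ d → |E t x - E s y| ≤ e :=
    fun e he => by
      obtain ⟨d, hd, H⟩ := hequi e he
      exact ⟨d, hd, fun t s x y h1 h2 => le_of_tendsto ((hE t x).sub (hE s y)).abs
        ((hUle H).mono fun n hn => hn t s x y h1 h2)⟩
  have hEB : BddUC M E := by
    refine ⟨fun t x => le_of_tendsto (hE t x).abs (Eventually.of_forall fun n => hAB n t x), ?_⟩
    refine Metric.uniformContinuous_iff.2 fun e he => ?_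
    obtain ⟨d, hd, H⟩ := hEmod (e / 2) (by positivity)
    refine ⟨d, hd, fun {p q} hpq => ?_⟩
    rw [Prod.dist_eq, Real.dist_eq, Real.dist_eq, max_lt_iff] at hpq
    rw [Real.dist_eq]
    linarith [H p.1 q.1 p.2 q.2 hpq.1.le hpq.2.le]
  refine ⟨E, hEB, funext fun x => tendsto_nhds_unique (hE 0 x) ?_, fun T e R he => ?_,
    fun y c hc t x => le_of_tendsto ((hE t (x + y)).sub (hE t x)).abs
      (Eventually.of_forall fun n => hAy y c hc n t x)⟩
  · refine tendsto_const_nhds.congr fun n => ?_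
    rw [hA, zero_div, Nat.floor_zero, Function.iterate_zero, id]
  · obtain ⟨n, hn1, hn2⟩ := ((eventually_forall_abs_sub_le hE
      (fun e he => (hequi e he).imp fun d hd => ⟨hd.1, hUle hd.2⟩) hEmod
      ((isCompact_Icc (a := 0) (b := T)).prod (isCompact_Icc (a := -R) (b := R))) he).and
        (hUle (hk0 e he))).exists
    refine ⟨k n, (hk n).1, hn2, (hk n).2.1, (hk n).2.2, fun j x hj hx => ?_⟩
    have := hn1 (j * k n ^ 3, x) ⟨⟨by have := hh n; positivity, hj⟩, abs_le.1 hx⟩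
    rwa [hA, mul_div_cancel_right₀ _ (hh n).ne', Nat.floor_natCast] at this

theorem BddUC.bucOn {M T : ℝ} {F : ℝ → ℝ → ℝ} (h : BddUC M F) :
    BUCOn (fun p => F p.1 p.2) (Icc 0 T ×ˢ univ) :=
  ⟨⟨M, fun p _ => h.bdd p.1 p.2⟩, h.uc.uniformContinuousOn⟩

theorem PastSub.isSolution {M : ℝ} {F : ℝ → ℝ → ℝ} (hF : ∀ T, PastSub T F)
    (hF' : ∀ T, PastSub T (dual F)) (bF : BddUC M F) : IsSolution HTilde F := by
  refine ⟨PastSub.isSubsolution hF hF' bF, ?_⟩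
  have h1 := (PastSub.isSubsolution hF' (by rwa [dual_dual]) bF.dual).dual
    bF.dual.continuous₂.continuousOn
  rw [dual_dual] at h1
  exact h1.congr fun t x ht => (lscEnv_eq bF.continuous₂.continuousOn ht x).symm

/-- A viscosity solution coincides with any function which is a sub- and supersolution tested in
the past and has the same initial value. -/
theorem IsSolution.eq_of_pastSub {M : ℝ} {F E : ℝ → ℝ → ℝ} (hF : IsSolution HTilde F)
    (hb : ∀ T > (0 : ℝ), BUCOn (fun p => F p.1 p.2) (Icc 0 T ×ˢ univ)) (hE : ∀ T, PastSub T E)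
    (hE' : ∀ T, PastSub T (dual E)) (bE : BddUC M E) (h0 : ∀ x, F 0 x = E 0 x) {t : ℝ}
    (ht : 0 ≤ t) (x : ℝ) : F t x = E t x := by
  obtain ⟨M', G, bG, hG, hG', hGF⟩ := hF.pastSub hb (T := t + 1) (by linarith)
  have h0' : ∀ x, G 0 x = E 0 x := fun x => by
    rw [hGF 0 le_rfl (by linarith), h0]
  rw [← hGF t ht (by linarith)]
  exact le_antisymm (hG.comparison (hE' _) bG bE (fun x => (h0' x).le) ht (by linarith) x)
    ((hE _).comparison hG' bE bG (fun x => (h0' x).ge) ht (by linarith) x)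

/-- For `F₀ ∈ BUC(ℝ)`: (i) there is a unique `F`, belonging to
`BUC([0,T] × ℝ)` for every `T > 0`, which is a viscosity solution of
`∂ₜF + (∂ₓF)₊ H̃[F] = 0` with `F(0,·) = F₀`; (ii) if `F₀` is `K`-Lipschitz then
`F(t,·)` is `K`-Lipschitz for every `t ≥ 0`. -/
theorem exists_unique_BUC_viscosity_solution
    (F₀ : ℝ → ℝ) (hb : ∃ M, ∀ x, |F₀ x| ≤ M) (huc : UniformContinuous F₀) :
    (∃ F : ℝ → ℝ → ℝ,
      (∀ T > (0 : ℝ), BUCOn (fun p => F p.1 p.2) (Set.Icc 0 T ×ˢ Set.univ)) ∧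
      IsSolution HTilde F ∧ (∀ x, F 0 x = F₀ x)) ∧
    (∀ F G : ℝ → ℝ → ℝ,
      ((∀ T > (0 : ℝ), BUCOn (fun p => F p.1 p.2) (Set.Icc 0 T ×ˢ Set.univ)) ∧
        IsSolution HTilde F ∧ (∀ x, F 0 x = F₀ x)) →
      ((∀ T > (0 : ℝ), BUCOn (fun p => G p.1 p.2) (Set.Icc 0 T ×ˢ Set.univ)) ∧
        IsSolution HTilde G ∧ (∀ x, G 0 x = F₀ x)) →
      ∀ t x, 0 ≤ t → F t x = G t x) ∧
    (∀ K : NNReal, LipschitzWith K F₀ →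
      ∀ F : ℝ → ℝ → ℝ,
        ((∀ T > (0 : ℝ), BUCOn (fun p => F p.1 p.2) (Set.Icc 0 T ×ˢ Set.univ)) ∧
          IsSolution HTilde F ∧ (∀ x, F 0 x = F₀ x)) →
        ∀ t, 0 ≤ t → LipschitzWith K (F t)) := by
  obtain ⟨M, hM⟩ := hb
  obtain ⟨E, bE, hE0, hlim, hEy⟩ := exists_schemeLimit huc hM
  have hE : ∀ T, PastSub T E := fun T => (hlim T).pastSub ⟨huc.continuous, hM⟩ bE
  have hE' : ∀ T, PastSub T (dual E) := fun T => (hlim T).dual.pastSub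
    ⟨(huc.continuous.comp continuous_neg).neg, fun x => by rw [abs_neg]; exact hM _⟩ bE.dual
  have key : ∀ F : ℝ → ℝ → ℝ,
      ((∀ T > (0 : ℝ), BUCOn (fun p => F p.1 p.2) (Set.Icc 0 T ×ˢ Set.univ)) ∧
        IsSolution HTilde F ∧ (∀ x, F 0 x = F₀ x)) → ∀ t x, 0 ≤ t → F t x = E t x :=
    fun F hF t x ht => hF.2.1.eq_of_pastSub hF.1 hE hE' bE (by rw [hE0]; exact hF.2.2) ht x
  refine ⟨⟨E, fun T _ => bE.bucOn, PastSub.isSolution hE hE' bE, fun x => by rw [hE0]⟩,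
    fun F G hF hG t x ht => (key F hF t x ht).trans (key G hG t x ht).symm,
    fun K hK F hF t ht => LipschitzWith.of_dist_le_mul fun x y => ?_⟩
  rw [key F hF t x ht, key F hF t y ht, Real.dist_eq, Real.dist_eq]
  have := hEy (x - y) (K * |x - y|) (fun z => by
    have := hK.dist_le_mul (z + (x - y)) z
    rwa [Real.dist_eq, Real.dist_eq, add_sub_cancel_left] at this) t y
  rwa [add_sub_cancel] at this
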